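/- Let N ≥ 2, 0 < c_N < … < c_2 < c_1 = 1 with ∑_{j=2}^N (1 − c_j)² < 1/16, and let u be a smooth solution of the quartic gKdV equation satisfying lim_{t→+∞} ‖u(t,·) − ∑_{j=1}^N Q_{c_j}(· − c_j t − Δ_j)‖_{H¹} = 0 for some Δ_j ∈ ℝ, and also lim_{t→−∞} ‖u(t,·) − ∑_{j=1}^{N⁻} Q_{c⁻_j}(· − c⁻_j t − Δ⁻_j)‖_{H¹} = 0 for some N⁻ ≥ 2, speeds 0 < c⁻_{N⁻} < … < c⁻_1 and shifts Δ⁻_j ∈ ℝ. Then for every j = 1, …, N⁻ one has 16/25 < c⁻_j < 3/2, and moreover |N⁻ − N| ≤ √N/8. -/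

import Mathlib

open Real MeasureTheory Filter

noncomputable def Q (x : ℝ) : ℝ := (5 / (2 * Real.cosh (3 * x / 2) ^ 2)) ^ ((1:ℝ)/3)

noncomputable def Qc (c x : ℝ) : ℝ := c ^ ((1:ℝ)/3) * Q (Real.sqrt c * x)

noncomputable def H1norm (f : ℝ → ℝ) : ℝ :=
  Real.sqrt (∫ x : ℝ, ((f x) ^ 2 + (deriv f x) ^ 2))

noncomputable def IsGKdVSolution (u : ℝ → ℝ → ℝ) : Prop :=
  ContDiff ℝ (⊤ : ℕ∞) (Function.uncurry u) ∧
  (∀ t x : ℝ, deriv (fun s => u s x) t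
      + deriv (fun y => iteratedDeriv 2 (u t) y + (u t y) ^ 4) x = 0) ∧
  (∀ (t : ℝ) (k : ℕ), Integrable (fun x => (iteratedDeriv k (u t) x) ^ 2))

/-- An integrable function with integrable derivative is bounded by the `L¹` norm of the latter. -/
lemma abs_le_integral_abs_deriv {g g' : ℝ → ℝ} (hg : ∀ x, HasDerivAt g (g' x) x)
    (h0 : Integrable g) (h1 : Integrable g') (x : ℝ) : |g x| ≤ ∫ y, |g' y| := by
  have h := integral_Iic_of_hasDerivAt_of_tendsto' (a := x) (fun y _ => hg y) h1.integrableOn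
    (tendsto_zero_of_hasDerivAt_of_integrableOn_Iic (a := x) (fun y _ => hg y)
      h1.integrableOn h0.integrableOn)
  rw [sub_zero] at h
  rw [← h]
  calc |∫ y in Set.Iic x, g' y| ≤ ∫ y in Set.Iic x, |g' y| := abs_integral_le_integral_abs
    _ ≤ ∫ y, |g' y| := setIntegral_le_integral h1.abs (Eventually.of_forall fun y => abs_nonneg _)

/-- Products of square-integrable continuous functions are integrable. -/
lemma integrable_mul_of_sq {X : Type*} [MeasurableSpace X] {μ : Measure X} {f g : X → ℝ}
    (hf : AEStronglyMeasurable f μ) (hg : AEStronglyMeasurable g μ)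
    (h0 : Integrable (fun x => f x ^ 2) μ) (h1 : Integrable (fun x => g x ^ 2) μ) :
    Integrable (fun x => f x * g x) μ := by
  refine (h0.add h1).mono' (hf.mul hg) (Eventually.of_forall fun x => ?_)
  simp only [Pi.add_apply, norm_eq_abs, abs_mul]
  nlinarith [sq_nonneg (|f x| - |g x|), sq_abs (f x), sq_abs (g x), abs_nonneg (f x),
    abs_nonneg (g x)]

/-- If `s ≤ λ y + m / λ` for every `λ > 0`, then `s² ≤ 4 m y`. -/
lemma sq_le_of_forall_le {s y m : ℝ} (hs : 0 ≤ s) (hy : 0 ≤ y) (hm : 0 ≤ m)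
    (h : ∀ l : ℝ, 0 < l → s ≤ l * y + m / l) : s ^ 2 ≤ 4 * m * y := by
  rcases hs.eq_or_lt with rfl | hs
  · nlinarith [mul_nonneg hm hy]
  rcases hy.eq_or_lt with rfl | hy
  · have h1 := h (2 * (m + 1) / s) (by positivity)
    have h2 : m / (2 * (m + 1) / s) < s := by
      rw [div_div_eq_mul_div, div_lt_iff₀ (by positivity)]
      nlinarith
    simp only [mul_zero, zero_add] at h1
    linarith
  · have h1 := h (s / (2 * y)) (by positivity)
    have e : s / (2 * y) * y + m / (s / (2 * y)) = s / 2 + 2 * m * y / s := by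
      field_simp
    rw [e] at h1
    have h2 : s / 2 ≤ 2 * m * y / s := by linarith
    rw [le_div_iff₀ hs] at h2
    nlinarith

/-- One-dimensional Sobolev inequality with a parameter. -/
lemma sq_le_integral_sq {f f' : ℝ → ℝ} (hf : ∀ x, HasDerivAt f (f' x) x) (hf' : Continuous f')
    (h0 : Integrable (fun x => f x ^ 2)) (h1 : Integrable (fun x => f' x ^ 2)) {l : ℝ}
    (hl : 0 < l) (x : ℝ) : f x ^ 2 ≤ l * (∫ y, f' y ^ 2) + (∫ y, f y ^ 2) / l := by
  have hc : Continuous f := continuous_iff_continuousAt.2 fun x => (hf x).continuousAt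
  have hi : Integrable (fun x => 2 * (f x * f' x)) :=
    (integrable_mul_of_sq hc.aestronglyMeasurable hf'.aestronglyMeasurable h0 h1).const_mul 2
  have h := abs_le_integral_abs_deriv (g := fun x => f x ^ 2) (g' := fun x => 2 * (f x * f' x))
    (fun x => ((hf x).pow 2).congr_deriv (by norm_num; ring)) h0 hi x
  rw [abs_of_nonneg (sq_nonneg _)] at h
  refine h.trans ?_
  rw [← integral_const_mul, ← integral_div, ← integral_add (h1.const_mul _) (h0.div_const _)]
  refine integral_mono hi.abs ((h1.const_mul _).add (h0.div_const _)) fun y => ?_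
  simp only [abs_mul, abs_two]
  have e : l * f' y ^ 2 + f y ^ 2 / l - 2 * (|f y| * |f' y|) = (l * |f' y| - |f y|) ^ 2 / l := by
    field_simp
    rw [← sq_abs (f' y), ← sq_abs (f y)]
    ring
  have := div_nonneg (sq_nonneg (l * |f' y| - |f y|)) hl.le
  linarith

lemma sq_le_integral_add {f f' : ℝ → ℝ} (hf : ∀ x, HasDerivAt f (f' x) x) (hf' : Continuous f')
    (h0 : Integrable (fun x => f x ^ 2)) (h1 : Integrable (fun x => f' x ^ 2))
    (x : ℝ) : f x ^ 2 ≤ ∫ y, (f y ^ 2 + f' y ^ 2) := by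
  have := sq_le_integral_sq hf hf' h0 h1 one_pos x
  rw [integral_add h0 h1]
  linarith

/-- Fatou lemma for nonnegative real functions. -/
lemma integrable_of_frequently_integral_le {X : Type*} [MeasurableSpace X] {μ : Measure X}
    {F : ℕ → X → ℝ} {f : X → ℝ} {b : ℝ} (h0 : ∀ n x, 0 ≤ F n x) (hi : ∀ n, Integrable (F n) μ)
    (hlim : ∀ x, Tendsto (fun n => F n x) atTop (nhds (f x)))
    (hb : ∃ᶠ n in atTop, ∫ x, F n x ∂μ ≤ b) : Integrable f μ ∧ ∫ x, f x ∂μ ≤ b := by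
  have hf0 : ∀ x, 0 ≤ f x := fun x => ge_of_tendsto' (hlim x) fun n => h0 n x
  have hfm : AEStronglyMeasurable f μ :=
    aestronglyMeasurable_of_tendsto_ae atTop (fun n => (hi n).aestronglyMeasurable)
      (Eventually.of_forall hlim)
  have key : ∫⁻ x, ENNReal.ofReal (f x) ∂μ ≤ ENNReal.ofReal b := by
    calc ∫⁻ x, ENNReal.ofReal (f x) ∂μ
        = ∫⁻ x, liminf (fun n => ENNReal.ofReal (F n x)) atTop ∂μ := by
          refine lintegral_congr fun x => ?_
          exact ((ENNReal.continuous_ofReal.tendsto _).comp (hlim x)).liminf_eq.symm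
      _ ≤ liminf (fun n => ∫⁻ x, ENNReal.ofReal (F n x) ∂μ) atTop :=
          lintegral_liminf_le' fun n => (hi n).aemeasurable.ennreal_ofReal
      _ ≤ ENNReal.ofReal b := by
          refine liminf_le_of_frequently_le' (hb.mono fun n hn => ?_)
          rw [← ofReal_integral_eq_lintegral_ofReal (hi n) (Eventually.of_forall (h0 n))]
          exact ENNReal.ofReal_le_ofReal hn
  have hInt : Integrable f μ := by
    refine ⟨hfm, ?_⟩
    rw [hasFiniteIntegral_iff_ofReal (Eventually.of_forall hf0)]
    exact key.trans_lt ENNReal.ofReal_lt_top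
  refine ⟨hInt, ?_⟩
  obtain ⟨n, hn⟩ := hb.exists
  have hb0 : 0 ≤ b := (integral_nonneg (h0 n)).trans hn
  rw [← ofReal_integral_eq_lintegral_ofReal hInt (Eventually.of_forall hf0)] at key
  exact (ENNReal.ofReal_le_ofReal_iff hb0).1 key

/-- The product of Lebesgue measure on the time interval `[a, b]` and on the line. -/
noncomputable abbrev slab (a b : ℝ) : Measure (ℝ × ℝ) := (volume.restrict (Set.Icc a b)).prod volume

lemma integrable_slab {F : ℝ → ℝ → ℝ} {a b K : ℝ} (hab : a ≤ b)
    (hF : Continuous (Function.uncurry F)) (h0 : ∀ t x, 0 ≤ F t x)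
    (hi : ∀ t ∈ Set.Icc a b, Integrable (F t)) (hK : ∀ t ∈ Set.Icc a b, ∫ x, F t x ≤ K) :
    Integrable (fun p : ℝ × ℝ => F p.1 p.2) (slab a b) ∧
      ∫ p, F p.1 p.2 ∂(slab a b) ≤ (b - a) * K := by
  have hm : AEStronglyMeasurable (fun p : ℝ × ℝ => F p.1 p.2) (slab a b) :=
    hF.aestronglyMeasurable
  have hInt : Integrable (fun p : ℝ × ℝ => F p.1 p.2) (slab a b) := by
    rw [integrable_prod_iff hm]
    refine ⟨(ae_restrict_iff' measurableSet_Icc).2 (Eventually.of_forall hi), ?_⟩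
    refine Integrable.mono' (g := fun _ => K) (by simp) hm.norm.integral_prod_right' ?_
    refine (ae_restrict_iff' measurableSet_Icc).2 (Eventually.of_forall fun t ht => ?_)
    simp only [norm_eq_abs, abs_of_nonneg (h0 _ _)]
    rw [abs_of_nonneg (integral_nonneg (h0 t))]
    exact hK t ht
  refine ⟨hInt, ?_⟩
  rw [integral_prod _ hInt]
  calc ∫ t in Set.Icc a b, ∫ x, F t x ≤ ∫ t in Set.Icc a b, K :=
        setIntegral_mono_on hInt.integral_prod_left (by simp) measurableSet_Icc hK
    _ = (b - a) * K := by simp [hab]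

/-- The difference quotient is bounded in `L²` by the derivative. -/
lemma integral_diffQuot_sq_le {f f' : ℝ → ℝ} (hf : ∀ x, HasDerivAt f (f' x) x)
    (hf' : Continuous f') (h1 : Integrable (fun x => f' x ^ 2)) {h : ℝ} (hh : h ≠ 0) :
    Integrable (fun x => ((f (x + h) - f x) / h) ^ 2) ∧
      ∫ x, ((f (x + h) - f x) / h) ^ 2 ≤ ∫ x, f' x ^ 2 := by
  have hc : Continuous f := continuous_iff_continuousAt.2 fun x => (hf x).continuousAt
  obtain ⟨hInt, hle⟩ := integrable_slab (F := fun s x => f' (x + s * h) ^ 2) (a := 0) (b := 1)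
    (K := ∫ x, f' x ^ 2) zero_le_one (by fun_prop) (fun _ _ => sq_nonneg _)
    (fun t _ => h1.comp_add_right (t * h))
    (fun t _ => (integral_add_right_eq_self (fun x => f' x ^ 2) (t * h)).le)
  have key : ∀ x, ((f (x + h) - f x) / h) ^ 2 ≤ ∫ s in Set.Icc (0 : ℝ) 1, f' (x + s * h) ^ 2 := by
    intro x
    have hq : (f (x + h) - f x) / h = ∫ s in (0 : ℝ)..1, f' (x + s * h) := by
      have hd : ∀ s ∈ Set.uIcc (0 : ℝ) 1,
          HasDerivAt (fun s => f (x + s * h) / h) (f' (x + s * h)) s := by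
        intro s _
        have := ((hf (x + s * h)).comp s
          (((hasDerivAt_id s).mul_const h).const_add x)).div_const h
        exact this.congr_deriv (by field_simp)
      rw [intervalIntegral.integral_eq_sub_of_hasDerivAt hd
        (Continuous.intervalIntegrable (by fun_prop) _ _)]
      simp [sub_div]
    set m := (f (x + h) - f x) / h with hm
    have h2 : 0 ≤ ∫ s in (0 : ℝ)..1,
        (f' (x + s * h) ^ 2 - 2 * m * f' (x + s * h) + m ^ 2) :=
      intervalIntegral.integral_nonneg zero_le_one fun s _ => by
        nlinarith [sq_nonneg (f' (x + s * h) - m)]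
    rw [intervalIntegral.integral_add, intervalIntegral.integral_sub,
      intervalIntegral.integral_const_mul, ← hq] at h2
    · rw [integral_Icc_eq_integral_Ioc, ← intervalIntegral.integral_of_le zero_le_one]
      simp at h2
      nlinarith
    all_goals exact Continuous.intervalIntegrable (by fun_prop) _ _
  have hInt' := hInt.integral_prod_right
  have hq : Integrable (fun x => ((f (x + h) - f x) / h) ^ 2) := by
    refine hInt'.mono' (Continuous.aestronglyMeasurable (by fun_prop))
      (Eventually.of_forall fun x => ?_)
    rw [norm_eq_abs, abs_of_nonneg (sq_nonneg _)]
    exact key x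
  refine ⟨hq, (integral_mono hq hInt' key).trans ?_⟩
  rw [integral_prod_symm _ hInt] at hle
  linarith

lemma integrable_slab_of_continuous {F : ℝ → ℝ → ℝ} {a b R : ℝ}
    (hF : Continuous (Function.uncurry F)) (h0 : ∀ t x, R ≤ |x| → F t x = 0) :
    Integrable (fun p : ℝ × ℝ => F p.1 p.2) (slab a b) := by
  have e : slab a b = ((volume : Measure ℝ).prod volume).restrict (Set.Icc a b ×ˢ Set.univ) := by
    rw [← Measure.prod_restrict, Measure.restrict_univ]
  rw [e]
  have hc : IntegrableOn (Function.uncurry F) (Set.Icc a b ×ˢ Set.Icc (-R) R)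
      ((volume : Measure ℝ).prod volume) :=
    hF.continuousOn.integrableOn_compact (isCompact_Icc.prod isCompact_Icc)
  refine hc.of_forall_sdiff_eq_zero (measurableSet_Icc.prod MeasurableSet.univ) ?_
  rintro ⟨t, x⟩ ⟨⟨ht, -⟩, hx⟩
  refine h0 t x ?_
  by_contra hR
  exact hx ⟨ht, abs_le.1 (not_le.1 hR).le⟩

lemma integrable_of_continuous_of_eq_zero {f : ℝ → ℝ} {R : ℝ} (hf : Continuous f)
    (h0 : ∀ x, R ≤ |x| → f x = 0) : Integrable f := by
  refine hf.integrable_of_hasCompactSupport (HasCompactSupport.intro (isCompact_Icc (a := -R) (b := R)) ?_)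
  intro x hx
  refine h0 x ?_
  by_contra hR
  exact hx (abs_le.1 (not_le.1 hR).le)

/-- Integrated form of a balance law `∂ₜ A = ∂ₓ Ξ + Θ` with compact support in space. -/
lemma integral_sub_eq_integral_slab {A At Ξ Ξx Θ : ℝ → ℝ → ℝ} {a b R : ℝ} (hab : a ≤ b)
    (hA : ∀ t x, HasDerivAt (fun s => A s x) (At t x) t)
    (hΞ : ∀ t x, HasDerivAt (Ξ t) (Ξx t x) x)
    (hE : ∀ t x, At t x = Ξx t x + Θ t x)
    (cA : Continuous (Function.uncurry A)) (cΞ : Continuous (Function.uncurry Ξx))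
    (cΘ : Continuous (Function.uncurry Θ))
    (zA : ∀ t x, R ≤ |x| → A t x = 0) (zΞ : ∀ t x, R ≤ |x| → Ξ t x = 0)
    (zΘ : ∀ t x, R ≤ |x| → Θ t x = 0) :
    (∫ x, A b x) - ∫ x, A a x = ∫ p, Θ p.1 p.2 ∂(slab a b) := by
  have zAt : ∀ t x, R ≤ |x| → At t x = 0 := fun t x hx =>
    (hA t x).unique (by simpa [zA _ x hx] using hasDerivAt_const t (0 : ℝ))
  have zΞx : ∀ t x, R ≤ |x| → Ξx t x = 0 := fun t x hx => by
    have := hE t x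
    rw [zAt t x hx, zΘ t x hx] at this
    linarith
  have cAt : Continuous (Function.uncurry At) := by
    have : Function.uncurry At = fun p => Function.uncurry Ξx p + Function.uncurry Θ p := by
      ext p; exact hE p.1 p.2
    rw [this]; exact cΞ.add cΘ
  have cs : ∀ {F : ℝ → ℝ → ℝ} (_ : Continuous (Function.uncurry F)) (t : ℝ), Continuous (F t) :=
    fun h t => h.comp (Continuous.prodMk_right t)
  have ct : ∀ {F : ℝ → ℝ → ℝ} (_ : Continuous (Function.uncurry F)) (x : ℝ),
      Continuous (fun t => F t x) := fun h x => h.comp (Continuous.prodMk_left x)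
  have iA : ∀ t, Integrable (A t) := fun t => integrable_of_continuous_of_eq_zero (cs cA t) (zA t)
  have iAt := integrable_slab_of_continuous (a := a) (b := b) cAt zAt
  have iΞ := integrable_slab_of_continuous (a := a) (b := b) cΞ zΞx
  have iΘ := integrable_slab_of_continuous (a := a) (b := b) cΘ zΘ
  have h1 : ∫ p, At p.1 p.2 ∂(slab a b) = (∫ x, A b x) - ∫ x, A a x := by
    rw [integral_prod_symm _ iAt, ← integral_sub (iA b) (iA a)]
    refine integral_congr_ae (Eventually.of_forall fun x => ?_)
    simp only
    rw [integral_Icc_eq_integral_Ioc, ← intervalIntegral.integral_of_le hab]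
    exact intervalIntegral.integral_eq_sub_of_hasDerivAt (fun t _ => hA t x)
      ((ct cAt x).intervalIntegrable _ _)
  have h2 : ∫ p, Ξx p.1 p.2 ∂(slab a b) = 0 := by
    rw [integral_prod _ iΞ]
    refine integral_eq_zero_of_ae (Eventually.of_forall fun t => ?_)
    have cΞt : Continuous (Ξ t) := continuous_iff_continuousAt.2 fun x => (hΞ t x).continuousAt
    exact integral_eq_zero_of_hasDerivAt_of_integrable (hΞ t)
      (integrable_of_continuous_of_eq_zero (cs cΞ t) (zΞx t))
      (integrable_of_continuous_of_eq_zero cΞt (zΞ t))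
  rw [← h1]
  calc ∫ p, At p.1 p.2 ∂(slab a b) = ∫ p, (Ξx p.1 p.2 + Θ p.1 p.2) ∂(slab a b) := by
        simp only [hE]
    _ = _ := by rw [integral_add iΞ iΘ, h2, zero_add]

/-- A smooth even cutoff `χ` equal to one on `[-1, 1]` and supported in `[-2, 2]`, together with
its first three derivatives, all bounded by `C`. -/
structure IsCutoff (χ χ1 χ2 χ3 : ℝ → ℝ) (C : ℝ) : Prop where
  d0 : ∀ x, HasDerivAt χ (χ1 x) x
  d1 : ∀ x, HasDerivAt χ1 (χ2 x) x
  d2 : ∀ x, HasDerivAt χ2 (χ3 x) x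
  c3 : Continuous χ3
  even : ∀ x, χ (-x) = χ x
  eq_one : ∀ x, |x| ≤ 1 → χ x = 1
  eq_zero : ∀ x, 2 ≤ |x| → χ x = 0 ∧ χ1 x = 0 ∧ χ2 x = 0 ∧ χ3 x = 0
  bd : ∀ x, |χ x| ≤ C ∧ |χ1 x| ≤ C ∧ |χ2 x| ≤ C ∧ |χ3 x| ≤ C

lemma exists_isCutoff : ∃ χ χ1 χ2 χ3 C, IsCutoff χ χ1 χ2 χ3 C := by
  let f : ContDiffBump (0 : ℝ) := ⟨1, 2, one_pos, one_lt_two⟩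
  have hs : ContDiff ℝ (⊤ : ℕ∞) (f : ℝ → ℝ) := f.contDiff
  have hd : ∀ n : ℕ, ∀ x, HasDerivAt (iteratedDeriv n f) (iteratedDeriv (n + 1) f x) x := by
    intro n x
    rw [iteratedDeriv_succ]
    exact ((hs.differentiable_iteratedDeriv n (by exact_mod_cast ENat.natCast_lt_top n)) x).hasDerivAt
  have hcont : ∀ n : ℕ, Continuous (iteratedDeriv n f) := fun n =>
    continuous_iff_continuousAt.2 fun x => (hd n x).continuousAt
  have hz : ∀ n : ℕ, ∀ x, 2 ≤ |x| → iteratedDeriv n f x = 0 := by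
    intro n
    induction n with
    | zero =>
      intro x hx
      rw [iteratedDeriv_zero]
      exact f.zero_of_le_dist (by simpa [Real.dist_eq] using hx)
    | succ n ih =>
      have hopen : ∀ x, 2 < |x| → iteratedDeriv (n + 1) f x = 0 := by
        intro x hx
        refine (hd n x).unique ((hasDerivAt_const x (0 : ℝ)).congr_of_eventuallyEq ?_)
        filter_upwards [(isOpen_lt continuous_const continuous_abs).mem_nhds hx] with y hy
        exact ih y (le_of_lt hy)
      intro x hx
      have hcl : Tendsto (fun k : ℕ => iteratedDeriv (n + 1) f (x * (1 + 1 / ((k : ℝ) + 1)))) atTop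
          (nhds (iteratedDeriv (n + 1) f (x * (1 + 0)))) :=
        ((hcont (n + 1)).tendsto _).comp
          ((tendsto_one_div_add_atTop_nhds_zero_nat.const_add 1).const_mul x)
      rw [add_zero, mul_one] at hcl
      refine tendsto_nhds_unique hcl (tendsto_const_nhds.congr fun k => (hopen _ ?_).symm)
      have hk : (0 : ℝ) < 1 / ((k : ℝ) + 1) := by positivity
      rw [abs_mul, abs_of_pos (by positivity : (0 : ℝ) < 1 + 1 / ((k : ℝ) + 1))]
      nlinarith
  have hb : ∀ n : ℕ, ∃ C, ∀ x, |iteratedDeriv n f x| ≤ C := by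
    intro n
    have hcs : HasCompactSupport (iteratedDeriv n f) := by
      refine HasCompactSupport.intro (isCompact_Icc (a := -2) (b := (2 : ℝ))) fun x hx => hz n x ?_
      by_contra hR
      exact hx (abs_le.1 (not_le.1 hR).le)
    exact hcs.exists_bound_of_continuous (hcont n)
  choose C hC using hb
  have hpos : ∀ n, 0 ≤ C n := fun n => (abs_nonneg _).trans (hC n 0)
  refine ⟨iteratedDeriv 0 f, iteratedDeriv 1 f, iteratedDeriv 2 f, iteratedDeriv 3 f,
    C 0 + C 1 + C 2 + C 3, ?_⟩
  refine ⟨hd 0, hd 1, hd 2, hcont 3, fun x => ?_, fun x hx => ?_,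
    fun x hx => ⟨hz 0 x hx, hz 1 x hx, hz 2 x hx, hz 3 x hx⟩, fun x => ?_⟩
  · simp only [iteratedDeriv_zero]; exact f.neg x
  · simp only [iteratedDeriv_zero]
    exact f.one_of_mem_closedBall (by simpa [Metric.mem_closedBall, Real.dist_eq] using hx)
  · have := hpos 0; have := hpos 1; have := hpos 2; have := hpos 3
    refine ⟨?_, ?_, ?_, ?_⟩
    · linarith [hC 0 x]
    · linarith [hC 1 x]
    · linarith [hC 2 x]
    · linarith [hC 3 x]

section

/-- `w` solves `∂ₜ w + ∂ₓ (∂ₓ² w + S) = 0`, where `wᵢ = ∂ₓⁱ w` and `S1 = ∂ₓ S`. -/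
structure IsFlow (w w1 w2 w3 S S1 : ℝ → ℝ → ℝ) : Prop where
  dt : ∀ t x, HasDerivAt (fun s => w s x) (-(w3 t x + S1 t x)) t
  d0 : ∀ t x, HasDerivAt (w t) (w1 t x) x
  d1 : ∀ t x, HasDerivAt (w1 t) (w2 t x) x
  d2 : ∀ t x, HasDerivAt (w2 t) (w3 t x) x
  dS : ∀ t x, HasDerivAt (S t) (S1 t x) x
  c0 : Continuous fun p : ℝ × ℝ => w p.1 p.2
  c1 : Continuous fun p : ℝ × ℝ => w1 p.1 p.2
  c2 : Continuous fun p : ℝ × ℝ => w2 p.1 p.2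
  c3 : Continuous fun p : ℝ × ℝ => w3 p.1 p.2
  cS : Continuous fun p : ℝ × ℝ => S p.1 p.2
  cS1 : Continuous fun p : ℝ × ℝ => S1 p.1 p.2

/-- `f` is a `C³` function with derivatives `f1`, `f2`, `f3`. -/
structure IsWeight (f f1 f2 f3 : ℝ → ℝ) : Prop where
  d0 : ∀ x, HasDerivAt f (f1 x) x
  d1 : ∀ x, HasDerivAt f1 (f2 x) x
  d2 : ∀ x, HasDerivAt f2 (f3 x) x
  c3 : Continuous f3

lemma continuous_of_hasDerivAt {f f' : ℝ → ℝ} (h : ∀ x, HasDerivAt f (f' x) x) : Continuous f :=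
  continuous_iff_continuousAt.2 fun x => (h x).continuousAt

lemma continuous_section {F : ℝ → ℝ → ℝ} (h : Continuous fun p : ℝ × ℝ => F p.1 p.2) (t : ℝ) :
    Continuous (F t) := h.comp (Continuous.prodMk_right t)

variable {w w1 w2 w3 S S1 : ℝ → ℝ → ℝ} {f f1 f2 f3 : ℝ → ℝ}

/-- Localised mass identity with a compactly supported weight. -/
lemma IsFlow.mass_of_compact (hw : IsFlow w w1 w2 w3 S S1) (hf : IsWeight f f1 f2 f3) {a b R : ℝ}
    (hab : a ≤ b)
    (hz : ∀ x, R ≤ |x| → f x = 0 ∧ f1 x = 0 ∧ f2 x = 0 ∧ f3 x = 0) :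
    (∫ x, w b x ^ 2 * f x) - ∫ x, w a x ^ 2 * f x = ∫ p : ℝ × ℝ, (w p.1 p.2 ^ 2 * f3 p.2
      - 3 * w1 p.1 p.2 ^ 2 * f1 p.2
      + 2 * (w1 p.1 p.2 * f p.2 + w p.1 p.2 * f1 p.2) * S p.1 p.2) ∂(slab a b) := by
  have c0 := hw.c0
  have c1 := hw.c1
  have c2 := hw.c2
  have c3 := hw.c3
  have cS := hw.cS
  have cS1 := hw.cS1
  have k0 := continuous_of_hasDerivAt hf.d0
  have k1 := continuous_of_hasDerivAt hf.d1
  have k2 := continuous_of_hasDerivAt hf.d2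
  have k3 := hf.c3
  refine integral_sub_eq_integral_slab (R := R)
    (A := fun t x => w t x ^ 2 * f x)
    (At := fun t x => -(2 * w t x * f x * (w3 t x + S1 t x)))
    (Ξ := fun t x => -(2 * w t x * f x * w2 t x) + f x * w1 t x ^ 2 + 2 * f1 x * (w t x * w1 t x)
      - f2 x * w t x ^ 2 - 2 * w t x * f x * S t x)
    (Ξx := fun t x => -(2 * w t x * f x * (w3 t x + S1 t x)) + 3 * f1 x * w1 t x ^ 2
      - f3 x * w t x ^ 2 - 2 * (w1 t x * f x + w t x * f1 x) * S t x)
    (Θ := fun t x => w t x ^ 2 * f3 x - 3 * w1 t x ^ 2 * f1 x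
      + 2 * (w1 t x * f x + w t x * f1 x) * S t x) hab ?_ ?_ ?_ ?_ ?_ ?_ ?_ ?_ ?_
  · intro t x
    exact (((hw.dt t x).pow 2).mul_const (f x)).congr_deriv (by norm_num; ring)
  · intro t x
    have h0 := hw.d0 t x
    have h1 := hw.d1 t x
    have h2 := hw.d2 t x
    have hS := hw.dS t x
    have e0 := hf.d0 x
    have e1 := hf.d1 x
    have e2 := hf.d2 x
    have := ((((((h0.const_mul 2).mul e0).mul h2).neg.add (e0.mul (h1.pow 2))).add
      ((e1.const_mul 2).mul (h0.mul h1))).sub (e2.mul (h0.pow 2))).sub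
      (((h0.const_mul 2).mul e0).mul hS)
    exact this.congr_deriv (by norm_num; ring)
  · intro t x; ring
  · simp only [Function.uncurry_def]; fun_prop
  · simp only [Function.uncurry_def]; fun_prop
  · simp only [Function.uncurry_def]; fun_prop
  all_goals
    intro t x hx
    obtain ⟨z0, z1, z2, z3⟩ := hz x hx
    simp [z0, z1, z2, z3]

/-- Localised mass identity with a bounded weight. -/
lemma IsFlow.mass (hw : IsFlow w w1 w2 w3 S S1) (hf : IsWeight f f1 f2 f3) {a b K B : ℝ}
    (hab : a ≤ b)
    (hB : ∀ x, |f x| ≤ B ∧ |f1 x| ≤ B ∧ |f2 x| ≤ B ∧ |f3 x| ≤ B)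
    (i0 : ∀ t ∈ Set.Icc a b, Integrable (fun x => w t x ^ 2))
    (i1 : ∀ t ∈ Set.Icc a b, Integrable (fun x => w1 t x ^ 2))
    (iS : ∀ t ∈ Set.Icc a b, Integrable (fun x => S t x ^ 2))
    (k0 : ∀ t ∈ Set.Icc a b, ∫ x, w t x ^ 2 ≤ K)
    (k1 : ∀ t ∈ Set.Icc a b, ∫ x, w1 t x ^ 2 ≤ K)
    (kS : ∀ t ∈ Set.Icc a b, ∫ x, S t x ^ 2 ≤ K) :
    (∫ x, w b x ^ 2 * f x) - ∫ x, w a x ^ 2 * f x = ∫ p : ℝ × ℝ, (w p.1 p.2 ^ 2 * f3 p.2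
      - 3 * w1 p.1 p.2 ^ 2 * f1 p.2
      + 2 * (w1 p.1 p.2 * f p.2 + w p.1 p.2 * f1 p.2) * S p.1 p.2) ∂(slab a b) := by
  obtain ⟨χ, χ1, χ2, χ3, C, hχ⟩ := exists_isCutoff
  have c0 := hw.c0
  have c1 := hw.c1
  have cS := hw.cS
  have l0 := continuous_of_hasDerivAt hf.d0
  have l1 := continuous_of_hasDerivAt hf.d1
  have l2 := continuous_of_hasDerivAt hf.d2
  have l3 := hf.c3
  have m0 := continuous_of_hasDerivAt hχ.d0
  have m1 := continuous_of_hasDerivAt hχ.d1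
  have m2 := continuous_of_hasDerivAt hχ.d2
  have m3 := hχ.c3
  have hC : 0 ≤ C := (abs_nonneg _).trans (hχ.bd 0).1
  have hB0 : 0 ≤ B := (abs_nonneg _).trans (hB 0).1
  let r : ℕ → ℝ := fun n => 1 / ((n : ℝ) + 1)
  have r0 : ∀ n, 0 < r n := fun n => by positivity
  have r1 : ∀ n, r n ≤ 1 := fun n => by
    simp only [r]
    rw [div_le_one (by positivity)]
    have : (0 : ℝ) ≤ n := Nat.cast_nonneg n
    linarith
  have rlim : Tendsto r atTop (nhds 0) := tendsto_one_div_add_atTop_nhds_zero_nat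
  let g : ℕ → ℝ → ℝ := fun n x => f x * χ (x * r n)
  let g1 : ℕ → ℝ → ℝ := fun n x => f1 x * χ (x * r n) + r n * (f x * χ1 (x * r n))
  let g2 : ℕ → ℝ → ℝ := fun n x => f2 x * χ (x * r n) + 2 * r n * (f1 x * χ1 (x * r n))
    + r n ^ 2 * (f x * χ2 (x * r n))
  let g3 : ℕ → ℝ → ℝ := fun n x => f3 x * χ (x * r n) + 3 * r n * (f2 x * χ1 (x * r n))
    + 3 * r n ^ 2 * (f1 x * χ2 (x * r n)) + r n ^ 3 * (f x * χ3 (x * r n))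
  have hd : ∀ {k k' : ℝ → ℝ} (_ : ∀ x, HasDerivAt k (k' x) x) (n : ℕ) (x : ℝ),
      HasDerivAt (fun x => k (x * r n)) (k' (x * r n) * r n) x := by
    intro k k' h n x
    have := (h (x * r n)).comp x ((hasDerivAt_id x).mul_const (r n))
    exact this.congr_deriv (by simp)
  have hg : ∀ n, IsWeight (g n) (g1 n) (g2 n) (g3 n) := by
    intro n
    refine ⟨fun x => ?_, fun x => ?_, fun x => ?_, ?_⟩
    · exact ((hf.d0 x).mul (hd hχ.d0 n x)).congr_deriv (by simp only [g1]; ring)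
    · exact (((hf.d1 x).mul (hd hχ.d0 n x)).add
        (((hf.d0 x).mul (hd hχ.d1 n x)).const_mul _)).congr_deriv (by simp only [g2]; ring)
    · exact ((((hf.d2 x).mul (hd hχ.d0 n x)).add
        (((hf.d1 x).mul (hd hχ.d1 n x)).const_mul _)).add
        (((hf.d0 x).mul (hd hχ.d2 n x)).const_mul _)).congr_deriv (by simp only [g3]; ring)
    · simp only [g3]; fun_prop
  have hgz : ∀ n x, 2 / r n ≤ |x| → g n x = 0 ∧ g1 n x = 0 ∧ g2 n x = 0 ∧ g3 n x = 0 := by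
    intro n x hx
    obtain ⟨z0, z1, z2, z3⟩ := hχ.eq_zero (x * r n) (by
      rw [abs_mul, abs_of_pos (r0 n)]
      exact (div_le_iff₀ (r0 n)).1 hx)
    simp [g, g1, g2, g3, z0, z1, z2, z3]
  have hb : ∀ {x y : ℝ}, |x| ≤ B → |y| ≤ C → |x * y| ≤ B * C := fun hx hy => by
    rw [abs_mul]; exact mul_le_mul hx hy (abs_nonneg _) hB0
  have hrb : ∀ (n : ℕ) (k : ℕ) {x : ℝ}, |x| ≤ B * C → |r n ^ k * x| ≤ B * C := by
    intro n k x hx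
    rw [abs_mul, abs_of_pos (pow_pos (r0 n) k)]
    exact (mul_le_of_le_one_left (abs_nonneg _) (pow_le_one₀ (r0 n).le (r1 n))).trans hx
  have hgb : ∀ n x, |g n x| ≤ 8 * (B * C) ∧ |g1 n x| ≤ 8 * (B * C) ∧ |g3 n x| ≤ 8 * (B * C) := by
    intro n x
    obtain ⟨b0, b1, b2, b3⟩ := hB x
    obtain ⟨e0, e1, e2, e3⟩ := hχ.bd (x * r n)
    have hBC : 0 ≤ B * C := mul_nonneg hB0 hC
    have t00 := abs_le.1 (hb b0 e0)
    have t10 := abs_le.1 (hb b1 e0)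
    have t30 := abs_le.1 (hb b3 e0)
    have t01 := abs_le.1 (hrb n 1 (hb b0 e1))
    have t21 := abs_le.1 (hrb n 1 (hb b2 e1))
    have t12 := abs_le.1 (hrb n 2 (hb b1 e2))
    have t03 := abs_le.1 (hrb n 3 (hb b0 e3))
    rw [pow_one] at t01 t21
    simp only [g, g1, g3]
    refine ⟨?_, ?_, ?_⟩ <;> rw [abs_le] <;> constructor <;> linarith
  have hχlim : ∀ x, Tendsto (fun n => χ (x * r n)) atTop (nhds 1) := by
    intro x
    have : Tendsto (fun n => χ (x * r n)) atTop (nhds (χ (x * 0))) :=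
      (m0.tendsto _).comp (rlim.const_mul x)
    rwa [mul_zero, hχ.eq_one 0 (by simp)] at this
  have hχl : ∀ {k : ℝ → ℝ} (_ : Continuous k) (x : ℝ),
      Tendsto (fun n => k (x * r n)) atTop (nhds (k 0)) := by
    intro k hk x
    have : Tendsto (fun n => k (x * r n)) atTop (nhds (k (x * 0))) :=
      (hk.tendsto _).comp (rlim.const_mul x)
    rwa [mul_zero] at this
  have gl0 : ∀ x, Tendsto (fun n => g n x) atTop (nhds (f x)) := fun x => by
    simpa using (hχlim x).const_mul (f x)
  have gl1 : ∀ x, Tendsto (fun n => g1 n x) atTop (nhds (f1 x)) := fun x => by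
    simpa using ((hχlim x).const_mul (f1 x)).add (rlim.mul ((hχl m1 x).const_mul (f x)))
  have gl3 : ∀ x, Tendsto (fun n => g3 n x) atTop (nhds (f3 x)) := fun x => by
    simpa using ((((hχlim x).const_mul (f3 x)).add
      ((rlim.const_mul 3).mul ((hχl m1 x).const_mul (f2 x)))).add
      (((rlim.pow 2).const_mul 3).mul ((hχl m2 x).const_mul (f1 x)))).add
      ((rlim.pow 3).mul ((hχl m3 x).const_mul (f x)))
  have cg : ∀ n, Continuous (g n) := fun n => continuous_of_hasDerivAt (hg n).d0
  have cg1 : ∀ n, Continuous (g1 n) := fun n => continuous_of_hasDerivAt (hg n).d1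
  have cg3 : ∀ n, Continuous (g3 n) := fun n => (hg n).c3
  have lhs : ∀ t ∈ Set.Icc a b, Tendsto (fun n => ∫ x, w t x ^ 2 * g n x) atTop
      (nhds (∫ x, w t x ^ 2 * f x)) := by
    intro t ht
    have cw := continuous_section c0 t
    refine tendsto_integral_of_dominated_convergence (fun x => w t x ^ 2 * (8 * (B * C)))
      (fun n => ?_) ((i0 t ht).mul_const _) (fun n => Eventually.of_forall fun x => ?_)
      (Eventually.of_forall fun x => (gl0 x).const_mul _)
    · have := cg n
      exact Continuous.aestronglyMeasurable (by fun_prop)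
    · rw [norm_eq_abs, abs_mul, abs_of_nonneg (sq_nonneg (w t x))]
      exact mul_le_mul_of_nonneg_left (hgb n x).1 (sq_nonneg _)
  have j0 := (integrable_slab (F := fun t x => w t x ^ 2) hab
    (by simp only [Function.uncurry_def]; fun_prop) (fun _ _ => sq_nonneg _) i0 k0).1
  have j1 := (integrable_slab (F := fun t x => w1 t x ^ 2) hab
    (by simp only [Function.uncurry_def]; fun_prop) (fun _ _ => sq_nonneg _) i1 k1).1
  have jS := (integrable_slab (F := fun t x => S t x ^ 2) hab
    (by simp only [Function.uncurry_def]; fun_prop) (fun _ _ => sq_nonneg _) iS kS).1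
  have rhs : Tendsto (fun n => ∫ p : ℝ × ℝ, (w p.1 p.2 ^ 2 * g3 n p.2
      - 3 * w1 p.1 p.2 ^ 2 * g1 n p.2
      + 2 * (w1 p.1 p.2 * g n p.2 + w p.1 p.2 * g1 n p.2) * S p.1 p.2) ∂(slab a b)) atTop
      (nhds (∫ p : ℝ × ℝ, (w p.1 p.2 ^ 2 * f3 p.2
      - 3 * w1 p.1 p.2 ^ 2 * f1 p.2
      + 2 * (w1 p.1 p.2 * f p.2 + w p.1 p.2 * f1 p.2) * S p.1 p.2) ∂(slab a b))) := by
    refine tendsto_integral_of_dominated_convergence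
      (fun p => (8 * (B * C)) * (2 * w p.1 p.2 ^ 2 + 4 * w1 p.1 p.2 ^ 2 + 2 * S p.1 p.2 ^ 2))
      (fun n => ?_) ((((j0.const_mul 2).add (j1.const_mul 4)).add (jS.const_mul 2)).const_mul _)
      (fun n => Eventually.of_forall fun p => ?_) (Eventually.of_forall fun p => ?_)
    · have := cg n
      have := cg1 n
      have := cg3 n
      exact Continuous.aestronglyMeasurable (by fun_prop)
    · obtain ⟨b0, b1, b3⟩ := hgb n p.2
      generalize g n p.2 = y0 at *
      generalize g1 n p.2 = y1 at *
      generalize g3 n p.2 = y3 at *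
      generalize w p.1 p.2 = z at *
      generalize w1 p.1 p.2 = z1 at *
      generalize S p.1 p.2 = s at *
      set D := 8 * (B * C)
      have a1 : |z ^ 2 * y3| ≤ D * z ^ 2 := by
        rw [abs_mul, abs_of_nonneg (sq_nonneg z), mul_comm]
        exact mul_le_mul_of_nonneg_right b3 (sq_nonneg _)
      have a2 : |z1 ^ 2 * y1| ≤ D * z1 ^ 2 := by
        rw [abs_mul, abs_of_nonneg (sq_nonneg z1), mul_comm]
        exact mul_le_mul_of_nonneg_right b1 (sq_nonneg _)
      have a3 : |2 * (z1 * s) * y0| ≤ D * (z1 ^ 2 + s ^ 2) := by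
        rw [abs_mul, mul_comm]
        refine mul_le_mul b0 ?_ (abs_nonneg _) ((abs_nonneg _).trans b0)
        rw [abs_le]; constructor <;> nlinarith [sq_nonneg (z1 - s), sq_nonneg (z1 + s)]
      have a4 : |2 * (z * s) * y1| ≤ D * (z ^ 2 + s ^ 2) := by
        rw [abs_mul, mul_comm]
        refine mul_le_mul b1 ?_ (abs_nonneg _) ((abs_nonneg _).trans b1)
        rw [abs_le]; constructor <;> nlinarith [sq_nonneg (z - s), sq_nonneg (z + s)]
      rw [abs_le] at a1 a2 a3 a4
      rw [norm_eq_abs, abs_le]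
      constructor <;> nlinarith
    · exact (((gl3 p.2).const_mul _).sub ((gl1 p.2).const_mul _)).add
        (((((gl0 p.2).const_mul _).add ((gl1 p.2).const_mul _)).const_mul 2).mul_const _)
  refine tendsto_nhds_unique ((lhs b ⟨hab, le_rfl⟩).sub (lhs a ⟨le_rfl, hab⟩)) (rhs.congr fun n => ?_)
  exact (hw.mass_of_compact (hg n) hab (hgz n)).symm

end

section

/-- `u` solves the quartic gKdV equation, `uᵢ = ∂ₓⁱ u`, and `u(t) ∈ H¹` for every `t`. -/
structure IsSol (u u1 u2 u3 : ℝ → ℝ → ℝ) : Prop where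
  flow : IsFlow u u1 u2 u3 (fun t x => u t x ^ 4) (fun t x => 4 * u t x ^ 3 * u1 t x)
  i0 : ∀ t, Integrable fun x => u t x ^ 2
  i1 : ∀ t, Integrable fun x => u1 t x ^ 2

lemma exists_hasDerivAt_snd {v : ℝ → ℝ → ℝ} (hv : ContDiff ℝ (⊤ : ℕ∞) (Function.uncurry v)) :
    ∃ v1 : ℝ → ℝ → ℝ, ContDiff ℝ (⊤ : ℕ∞) (Function.uncurry v1) ∧
      ∀ t x, HasDerivAt (v t) (v1 t x) x := by
  refine ⟨fun t x => fderiv ℝ (Function.uncurry v) (t, x) (0, 1), ?_, fun t x => ?_⟩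
  · have : ContDiff ℝ (⊤ : ℕ∞) (fderiv ℝ (Function.uncurry v)) :=
      hv.fderiv_right (by norm_cast)
    exact this.clm_apply contDiff_const
  · have h := (hv.differentiable (by simp) (t, x)).hasFDerivAt
    have h2 : HasDerivAt (fun y : ℝ => (t, y)) ((0 : ℝ), (1 : ℝ)) x :=
      (hasDerivAt_const x t).prodMk (hasDerivAt_id x)
    exact h.comp_hasDerivAt x h2

lemma IsGKdVSolution.exists_isSol {u : ℝ → ℝ → ℝ} (hu : IsGKdVSolution u) :
    ∃ u1 u2 u3, IsSol u u1 u2 u3 := by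
  obtain ⟨hs, heq, hInt⟩ := hu
  obtain ⟨u1, s1, d1⟩ := exists_hasDerivAt_snd hs
  obtain ⟨u2, s2, d2⟩ := exists_hasDerivAt_snd s1
  obtain ⟨u3, s3, d3⟩ := exists_hasDerivAt_snd s2
  have e1 : ∀ t, iteratedDeriv 1 (u t) = u1 t := fun t => by
    rw [iteratedDeriv_one]; exact deriv_eq (d1 t)
  have e2 : ∀ t, iteratedDeriv 2 (u t) = u2 t := fun t => by
    rw [iteratedDeriv_succ, e1]; exact deriv_eq (d2 t)
  have dS : ∀ t x, HasDerivAt (fun y => u t y ^ 4) (4 * u t x ^ 3 * u1 t x) x := fun t x =>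
    ((d1 t x).pow 4).congr_deriv (by norm_num)
  refine ⟨u1, u2, u3, ⟨fun t x => ?_, d1, d2, d3, dS, hs.continuous, s1.continuous, s2.continuous,
    s3.continuous, ?_, ?_⟩, fun t => ?_, fun t => ?_⟩
  · have hd : DifferentiableAt ℝ (fun s => u s x) t := by
      have h := (hs.differentiable (by simp) (t, x))
      exact h.comp (g := Function.uncurry u) (f := fun s : ℝ => (s, x)) t
        (differentiableAt_id.prodMk (differentiableAt_const x))
    have h1 := heq t x
    have h2 : HasDerivAt (fun y => u2 t y + u t y ^ 4) (u3 t x + 4 * u t x ^ 3 * u1 t x) x :=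
      (d3 t x).add (dS t x)
    rw [e2, h2.deriv] at h1
    exact hd.hasDerivAt.congr_deriv (by linarith)
  · exact hs.continuous.pow 4
  · exact ((hs.continuous.pow 3).const_mul 4).mul s1.continuous
  · simpa using hInt t 0
  · simpa [e1] using hInt t 1

/-- The space-time reversal of a solution is a solution. -/
lemma IsSol.reverse {u u1 u2 u3 : ℝ → ℝ → ℝ} (h : IsSol u u1 u2 u3) :
    IsSol (fun t x => u (-t) (-x)) (fun t x => -u1 (-t) (-x)) (fun t x => u2 (-t) (-x))
      (fun t x => -u3 (-t) (-x)) := by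
  have hd : ∀ {g g' : ℝ → ℝ} (_ : ∀ x, HasDerivAt g (g' x) x) (x : ℝ),
      HasDerivAt (fun x => g (-x)) (-g' (-x)) x := fun hg x =>
    ((hg (-x)).comp x (hasDerivAt_neg x)).congr_deriv (by ring)
  have c0 := h.flow.c0
  have c1 := h.flow.c1
  have c2 := h.flow.c2
  have c3 := h.flow.c3
  have hc : ∀ {g : ℝ → ℝ → ℝ} (_ : Continuous fun p : ℝ × ℝ => g p.1 p.2),
      Continuous fun p : ℝ × ℝ => g (-p.1) (-p.2) := fun hg =>
    hg.comp (continuous_fst.neg.prodMk continuous_snd.neg)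
  have d0 : ∀ t x, HasDerivAt (fun x => u (-t) (-x)) (-u1 (-t) (-x)) x := fun t =>
    hd (h.flow.d0 (-t))
  refine ⟨⟨fun t x => ?_, d0, fun t x => ?_, fun t => hd (h.flow.d2 (-t)), fun t x => ?_,
    hc c0, (hc c1).neg, hc c2, (hc c3).neg, (hc c0).pow 4, ?_⟩, fun t => ?_, fun t => ?_⟩
  · exact (hd (fun s => h.flow.dt s (-x)) t).congr_deriv (by ring)
  · exact (hd (h.flow.d1 (-t)) x).neg.congr_deriv (by ring)
  · exact ((d0 t x).pow 4).congr_deriv (by norm_num)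
  · exact (((hc c0).pow 3).const_mul 4).mul (hc c1).neg
  · exact (h.i0 (-t)).comp_neg
  · simpa using (h.i1 (-t)).comp_neg

variable {u u1 u2 u3 : ℝ → ℝ → ℝ}

/-- Squared `H¹` norm. -/
noncomputable def hNorm (u u1 : ℝ → ℝ → ℝ) (t : ℝ) : ℝ := ∫ x, (u t x ^ 2 + u1 t x ^ 2)

/-- Energy. -/
noncomputable def energy (u u1 : ℝ → ℝ → ℝ) (t : ℝ) : ℝ :=
  (∫ x, u1 t x ^ 2) / 2 - (∫ x, u t x ^ 5) / 5

namespace IsSol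

lemma cu (h : IsSol u u1 u2 u3) (t : ℝ) : Continuous (u t) := continuous_section h.flow.c0 t
lemma cu1 (h : IsSol u u1 u2 u3) (t : ℝ) : Continuous (u1 t) := continuous_section h.flow.c1 t

lemma hNorm_eq (h : IsSol u u1 u2 u3) (t : ℝ) :
    hNorm u u1 t = (∫ x, u t x ^ 2) + ∫ x, u1 t x ^ 2 := integral_add (h.i0 t) (h.i1 t)

lemma sq_le_hNorm (h : IsSol u u1 u2 u3) (t x : ℝ) : u t x ^ 2 ≤ hNorm u u1 t :=
  sq_le_integral_add (h.flow.d0 t) (h.cu1 t) (h.i0 t) (h.i1 t) x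

lemma hNorm_nonneg (h : IsSol u u1 u2 u3) (t : ℝ) : 0 ≤ hNorm u u1 t :=
  (sq_nonneg _).trans (h.sq_le_hNorm t 0)

lemma mass_le (h : IsSol u u1 u2 u3) (t : ℝ) : ∫ x, u t x ^ 2 ≤ hNorm u u1 t := by
  have : 0 ≤ ∫ x, u1 t x ^ 2 := integral_nonneg fun x => sq_nonneg _
  rw [h.hNorm_eq]; linarith

lemma deriv_le (h : IsSol u u1 u2 u3) (t : ℝ) : ∫ x, u1 t x ^ 2 ≤ hNorm u u1 t := by
  have : 0 ≤ ∫ x, u t x ^ 2 := integral_nonneg fun x => sq_nonneg _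
  rw [h.hNorm_eq]; linarith

/-- `u^(2+k)` is integrable. -/
lemma integrable_pow (h : IsSol u u1 u2 u3) (t : ℝ) (k : ℕ) :
    Integrable fun x => u t x ^ (2 + k) := by
  have c := h.cu t
  refine ((h.i0 t).mul_const (√(hNorm u u1 t) ^ k)).mono'
    (Continuous.aestronglyMeasurable (by fun_prop)) (Eventually.of_forall fun x => ?_)
  rw [norm_eq_abs, abs_pow, pow_add, sq_abs]
  refine mul_le_mul_of_nonneg_left (pow_le_pow_left₀ (abs_nonneg _) ?_ k) (sq_nonneg _)
  exact Real.abs_le_sqrt (h.sq_le_hNorm t x)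

lemma integrable_pow_eight (h : IsSol u u1 u2 u3) (t : ℝ) :
    Integrable fun x => (u t x ^ 4) ^ 2 := by
  simpa only [← pow_mul] using h.integrable_pow t 6

lemma integral_pow_eight_le (h : IsSol u u1 u2 u3) {t K : ℝ} (hK : hNorm u u1 t ≤ K) :
    ∫ x, (u t x ^ 4) ^ 2 ≤ K ^ 4 := by
  have h0 := h.hNorm_nonneg t
  calc ∫ x, (u t x ^ 4) ^ 2 ≤ ∫ x, K ^ 3 * u t x ^ 2 := by
        refine integral_mono (h.integrable_pow_eight t) ((h.i0 t).const_mul _) fun x => ?_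
        have : (u t x ^ 2) ^ 3 ≤ K ^ 3 :=
          pow_le_pow_left₀ (sq_nonneg _) ((h.sq_le_hNorm t x).trans hK) 3
        calc (u t x ^ 4) ^ 2 = (u t x ^ 2) ^ 3 * u t x ^ 2 := by ring
          _ ≤ _ := mul_le_mul_of_nonneg_right this (sq_nonneg _)
    _ = K ^ 3 * ∫ x, u t x ^ 2 := integral_const_mul _ _
    _ ≤ K ^ 3 * K := mul_le_mul_of_nonneg_left ((h.mass_le t).trans hK) (pow_nonneg (h0.trans hK) 3)
    _ = K ^ 4 := by ring

/-- Localised mass identity for solutions bounded in `H¹`. -/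
lemma mass_weight (h : IsSol u u1 u2 u3) {f f1 f2 f3 : ℝ → ℝ} (hf : IsWeight f f1 f2 f3)
    {a b K B : ℝ} (hab : a ≤ b) (hB : ∀ x, |f x| ≤ B ∧ |f1 x| ≤ B ∧ |f2 x| ≤ B ∧ |f3 x| ≤ B)
    (hK : ∀ t ∈ Set.Icc a b, hNorm u u1 t ≤ K) :
    (∫ x, u b x ^ 2 * f x) - ∫ x, u a x ^ 2 * f x = ∫ p : ℝ × ℝ, (u p.1 p.2 ^ 2 * f3 p.2
      - 3 * u1 p.1 p.2 ^ 2 * f1 p.2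
      + 2 * (u1 p.1 p.2 * f p.2 + u p.1 p.2 * f1 p.2) * u p.1 p.2 ^ 4) ∂(slab a b) :=
  h.flow.mass hf (K := max K (K ^ 4)) hab hB (fun t _ => h.i0 t) (fun t _ => h.i1 t)
    (fun t _ => h.integrable_pow_eight t)
    (fun t ht => ((h.mass_le t).trans (hK t ht)).trans (le_max_left _ _))
    (fun t ht => ((h.deriv_le t).trans (hK t ht)).trans (le_max_left _ _))
    (fun t ht => (h.integral_pow_eight_le (hK t ht)).trans (le_max_right _ _))

lemma isWeight_one : IsWeight (fun _ => 1) (fun _ => 0) (fun _ => 0) (fun _ => 0) :=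
  ⟨fun x => hasDerivAt_const x _, fun x => hasDerivAt_const x _, fun x => hasDerivAt_const x _,
    continuous_const⟩

lemma integrable_slab_sq (h : IsSol u u1 u2 u3) {a b K : ℝ} (hab : a ≤ b)
    (hK : ∀ t ∈ Set.Icc a b, hNorm u u1 t ≤ K) :
    Integrable (fun p : ℝ × ℝ => u p.1 p.2 ^ 2) (slab a b) := by
  have c0 := h.flow.c0
  exact (integrable_slab (F := fun t x => u t x ^ 2) hab
    (by simp only [Function.uncurry_def]; fun_prop) (fun _ _ => sq_nonneg _) (fun t _ => h.i0 t)
    (fun t ht => (h.mass_le t).trans (hK t ht))).1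

lemma integrable_slab_deriv_sq (h : IsSol u u1 u2 u3) {a b K : ℝ} (hab : a ≤ b)
    (hK : ∀ t ∈ Set.Icc a b, hNorm u u1 t ≤ K) :
    Integrable (fun p : ℝ × ℝ => u1 p.1 p.2 ^ 2) (slab a b) := by
  have c1 := h.flow.c1
  exact (integrable_slab (F := fun t x => u1 t x ^ 2) hab
    (by simp only [Function.uncurry_def]; fun_prop) (fun _ _ => sq_nonneg _) (fun t _ => h.i1 t)
    (fun t ht => (h.deriv_le t).trans (hK t ht))).1

lemma integrable_slab_pow_eight (h : IsSol u u1 u2 u3) {a b K : ℝ} (hab : a ≤ b)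
    (hK : ∀ t ∈ Set.Icc a b, hNorm u u1 t ≤ K) :
    Integrable (fun p : ℝ × ℝ => (u p.1 p.2 ^ 4) ^ 2) (slab a b) := by
  have c0 := h.flow.c0
  exact (integrable_slab (F := fun t x => (u t x ^ 4) ^ 2) hab
    (by simp only [Function.uncurry_def]; fun_prop) (fun _ _ => sq_nonneg _)
    (fun t _ => h.integrable_pow_eight t)
    (fun t ht => h.integral_pow_eight_le (hK t ht))).1

/-- Mass conservation on an interval where the `H¹` norm is bounded. -/
lemma mass_eq_of_bounded (h : IsSol u u1 u2 u3) {a b K : ℝ} (hab : a ≤ b)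
    (hK : ∀ t ∈ Set.Icc a b, hNorm u u1 t ≤ K) :
    ∫ x, u b x ^ 2 = ∫ x, u a x ^ 2 := by
  have key := h.mass_weight isWeight_one (B := 1) hab (by simp) hK
  have c0 := h.flow.c0
  have c1 := h.flow.c1
  have hi : Integrable (fun p : ℝ × ℝ => 2 * (u1 p.1 p.2 * u p.1 p.2 ^ 4)) (slab a b) :=
    (integrable_mul_of_sq c1.aestronglyMeasurable (c0.pow 4).aestronglyMeasurable
      (h.integrable_slab_deriv_sq hab hK) (h.integrable_slab_pow_eight hab hK)).const_mul 2
  have hz : ∫ p : ℝ × ℝ, 2 * (u1 p.1 p.2 * u p.1 p.2 ^ 4) ∂(slab a b) = 0 := by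
    rw [integral_prod _ hi]
    refine integral_eq_zero_of_ae (Eventually.of_forall fun t => ?_)
    have c0 := h.cu t
    have c1 := h.cu1 t
    refine integral_eq_zero_of_hasDerivAt_of_integrable (f := fun x => (2 / 5) * u t x ^ 5)
      (fun x => (((h.flow.d0 t x).pow 5).const_mul (2 / 5)).congr_deriv (by norm_num; ring)) ?_
      ((h.integrable_pow t 3).const_mul _)
    exact (integrable_mul_of_sq c1.aestronglyMeasurable (c0.pow 4).aestronglyMeasurable
      (h.i1 t) (h.integrable_pow_eight t)).const_mul 2
  simp only [mul_one, mul_zero, sub_zero, add_zero, zero_add, mul_assoc] at key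
  linarith

end IsSol

end

/-- The derivative of the sigmoid function. -/
noncomputable def bell (x : ℝ) : ℝ := sigmoid x * (1 - sigmoid x)

noncomputable def bell1 (x : ℝ) : ℝ := bell x * (1 - 2 * sigmoid x)

noncomputable def bell2 (x : ℝ) : ℝ := bell x * (1 - 6 * bell x)

noncomputable def bell3 (x : ℝ) : ℝ := bell1 x * (1 - 12 * bell x)

lemma hasDerivAt_sigmoid_bell (x : ℝ) : HasDerivAt sigmoid (bell x) x := hasDerivAt_sigmoid x

lemma hasDerivAt_bell (x : ℝ) : HasDerivAt bell (bell1 x) x :=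
  ((hasDerivAt_sigmoid_bell x).mul ((hasDerivAt_sigmoid_bell x).const_sub 1)).congr_deriv
    (by simp only [bell1]; ring)

lemma hasDerivAt_bell1 (x : ℝ) : HasDerivAt bell1 (bell2 x) x :=
  ((hasDerivAt_bell x).mul (((hasDerivAt_sigmoid_bell x).const_mul 2).const_sub 1)).congr_deriv
    (by simp only [bell2, bell1, bell]; ring)

lemma hasDerivAt_bell2 (x : ℝ) : HasDerivAt bell2 (bell3 x) x :=
  ((hasDerivAt_bell x).mul (((hasDerivAt_bell x).const_mul 6).const_sub 1)).congr_deriv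
    (by simp only [bell3]; ring)

lemma continuous_bell : Continuous bell := continuous_of_hasDerivAt hasDerivAt_bell
lemma continuous_bell1 : Continuous bell1 := continuous_of_hasDerivAt hasDerivAt_bell1
lemma continuous_bell2 : Continuous bell2 := continuous_of_hasDerivAt hasDerivAt_bell2
lemma continuous_bell3 : Continuous bell3 :=
  continuous_bell1.mul (continuous_const.sub (continuous_bell.const_mul 12))

lemma bell_pos (x : ℝ) : 0 < bell x :=
  mul_pos (sigmoid_pos x) (sub_pos.2 (sigmoid_lt_one x))

lemma bell_le (x : ℝ) : bell x ≤ 1 / 4 := by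
  simp only [bell]; nlinarith [sq_nonneg (sigmoid x - 1 / 2)]

lemma bell_neg (x : ℝ) : bell (-x) = bell x := by
  simp only [bell, sigmoid_neg]; ring

lemma abs_bell1_le (x : ℝ) : |bell1 x| ≤ bell x := by
  rw [bell1, abs_mul, abs_of_pos (bell_pos x)]
  refine mul_le_of_le_one_right (bell_pos x).le ?_
  have := sigmoid_pos x
  have := sigmoid_lt_one x
  rw [abs_le]; constructor <;> linarith

lemma abs_bell2_le (x : ℝ) : |bell2 x| ≤ bell x := by
  rw [bell2, abs_mul, abs_of_pos (bell_pos x)]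
  refine mul_le_of_le_one_right (bell_pos x).le ?_
  have := bell_pos x
  have := bell_le x
  rw [abs_le]; constructor <;> linarith

lemma abs_bell3_le (x : ℝ) : |bell3 x| ≤ 2 * bell x := by
  rw [bell3, abs_mul, mul_comm]
  have := bell_pos x
  have := bell_le x
  refine mul_le_mul ?_ (abs_bell1_le x) (abs_nonneg _) zero_le_two
  rw [abs_le]; constructor <;> linarith

lemma bell_eq (x : ℝ) : bell x = 1 / (2 + exp x + exp (-x)) := by
  have h := exp_pos x
  rw [bell, sigmoid, exp_neg]
  field_simp
  ring

lemma bell_add_le (x h : ℝ) : bell (x + h) ≤ exp |h| * bell x := by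
  rw [bell_eq, bell_eq, mul_one_div]
  have p : ∀ y, 0 < exp y := exp_pos
  rw [div_le_div_iff₀ (by positivity) (by positivity)]
  have h1 : exp x ≤ exp |h| * exp (x + h) := by
    rw [← exp_add]; exact exp_le_exp.2 (by linarith [neg_abs_le h])
  have h2 : exp (-x) ≤ exp |h| * exp (-(x + h)) := by
    rw [← exp_add]; exact exp_le_exp.2 (by linarith [le_abs_self h])
  have h3 : 1 ≤ exp |h| := one_le_exp (abs_nonneg h)
  nlinarith

/-- Weight `y ↦ bell (y - x)`. -/
lemma isWeight_bell (x : ℝ) : IsWeight (fun y => bell (y - x)) (fun y => bell1 (y - x))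
    (fun y => bell2 (y - x)) (fun y => bell3 (y - x)) :=
  ⟨fun y => (hasDerivAt_bell (y - x)).comp_sub_const y x,
    fun y => (hasDerivAt_bell1 (y - x)).comp_sub_const y x,
    fun y => (hasDerivAt_bell2 (y - x)).comp_sub_const y x,
    continuous_bell3.comp (continuous_id.sub continuous_const)⟩

section Convolution

variable {d : ℝ → ℝ}

lemma hasDerivAt_conv (hd : Integrable d) {G G' : ℝ → ℝ} (hG : ∀ x, HasDerivAt G (G' x) x)
    (cG' : Continuous G') {B : ℝ} (b0 : ∀ x, |G x| ≤ B) (b1 : ∀ x, |G' x| ≤ B) (x : ℝ) :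
    HasDerivAt (fun x => ∫ y, G (x - y) * d y) (∫ y, G' (x - y) * d y) x := by
  have cG := continuous_of_hasDerivAt hG
  have m : ∀ {H : ℝ → ℝ} (_ : Continuous H) (x : ℝ),
      AEStronglyMeasurable (fun y => H (x - y) * d y) := fun hH x =>
    (Continuous.aestronglyMeasurable (by fun_prop)).mul hd.aestronglyMeasurable
  have bd : ∀ {H : ℝ → ℝ} (_ : ∀ x, |H x| ≤ B) (x y : ℝ), ‖H (x - y) * d y‖ ≤ B * ‖d y‖ :=
    fun hH x y => by
      rw [norm_mul]; exact mul_le_mul_of_nonneg_right (hH _) (norm_nonneg _)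
  refine (hasDerivAt_integral_of_dominated_loc_of_deriv_le (s := Set.univ)
    (bound := fun y => B * ‖d y‖) (F := fun x y => G (x - y) * d y)
    (F' := fun x y => G' (x - y) * d y) univ_mem
    (Eventually.of_forall fun x => m cG x) ?_ (m cG' x) ?_ (hd.norm.const_mul B) ?_).2
  · exact (hd.norm.const_mul B).mono' (m cG x) (Eventually.of_forall fun y => bd b0 x y)
  · exact Eventually.of_forall fun y z _ => bd b1 z y
  · exact Eventually.of_forall fun y z _ => ((hG (z - y)).comp_sub_const z y).mul_const _

lemma continuous_conv (hd : Integrable d) {G : ℝ → ℝ} (cG : Continuous G) {B : ℝ}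
    (b0 : ∀ x, |G x| ≤ B) : Continuous (fun x => ∫ y, G (x - y) * d y) := by
  refine continuous_of_dominated (bound := fun y => B * ‖d y‖) (fun x => ?_)
    (fun x => Eventually.of_forall fun y => ?_) (hd.norm.const_mul B)
    (Eventually.of_forall fun y => by fun_prop)
  · exact (Continuous.aestronglyMeasurable (by fun_prop)).mul hd.aestronglyMeasurable
  · rw [norm_mul]; exact mul_le_mul_of_nonneg_right (b0 _) (norm_nonneg _)

lemma integrable_conv (hd : Integrable d) {G : ℝ → ℝ} (cG : Continuous G) {B : ℝ}
    (b0 : ∀ x, |G x| ≤ B) (x : ℝ) : Integrable (fun y => G (x - y) * d y) := by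
  refine (hd.norm.const_mul B).mono'
    ((Continuous.aestronglyMeasurable (by fun_prop)).mul hd.aestronglyMeasurable)
    (Eventually.of_forall fun y => ?_)
  rw [norm_mul]; exact mul_le_mul_of_nonneg_right (b0 _) (norm_nonneg _)

lemma abs_sigmoid_le (x : ℝ) : |sigmoid x| ≤ 1 := by
  rw [abs_of_pos (sigmoid_pos x)]; exact (sigmoid_lt_one x).le

lemma abs_bell_le (x : ℝ) : |bell x| ≤ 1 := by
  rw [abs_of_pos (bell_pos x)]; linarith [bell_le x]

lemma abs_bell1_le_one (x : ℝ) : |bell1 x| ≤ 1 := by linarith [bell_le x, abs_bell1_le x]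

lemma abs_bell2_le_one (x : ℝ) : |bell2 x| ≤ 1 := by linarith [bell_le x, abs_bell2_le x]

lemma abs_bell3_le_one (x : ℝ) : |bell3 x| ≤ 1 := by linarith [bell_le x, abs_bell3_le x]

/-- For a nonnegative integrable density `d`, the convolution with the sigmoid is a bounded
weight whose derivative `θ` controls the higher derivatives and varies slowly. -/
lemma exists_weight (hd : Integrable d) (d0 : ∀ x, 0 ≤ d x) :
    ∃ φ φ2 φ3 : ℝ → ℝ, IsWeight φ (fun x => ∫ y, bell (x - y) * d y) φ2 φ3 ∧
      ∀ x, |φ x| ≤ ∫ y, d y ∧ |∫ y, bell (x - y) * d y| ≤ ∫ y, d y ∧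
        |φ2 x| ≤ ∫ y, d y ∧ |φ3 x| ≤ ∫ y, d y := by
  have bd : ∀ {G : ℝ → ℝ} (_ : Continuous G) (_ : ∀ x, |G x| ≤ 1) (x : ℝ),
      |∫ y, G (x - y) * d y| ≤ ∫ y, d y := by
    intro G cG hG x
    refine abs_integral_le_integral_abs.trans
      (integral_mono (integrable_conv hd cG hG x).abs hd fun y => ?_)
    simp only
    rw [abs_mul, abs_of_nonneg (d0 y)]
    exact mul_le_of_le_one_left (d0 y) (hG _)
  exact ⟨fun x => ∫ y, sigmoid (x - y) * d y, fun x => ∫ y, bell1 (x - y) * d y,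
    fun x => ∫ y, bell2 (x - y) * d y,
    ⟨hasDerivAt_conv hd hasDerivAt_sigmoid_bell continuous_bell abs_sigmoid_le abs_bell_le,
      hasDerivAt_conv hd hasDerivAt_bell continuous_bell1 abs_bell_le abs_bell1_le_one,
      hasDerivAt_conv hd hasDerivAt_bell1 continuous_bell2 abs_bell1_le_one abs_bell2_le_one,
      continuous_conv hd continuous_bell2 abs_bell2_le_one⟩,
    fun x => ⟨bd continuous_sigmoid abs_sigmoid_le x, bd continuous_bell abs_bell_le x,
      bd continuous_bell1 abs_bell1_le_one x, bd continuous_bell2 abs_bell2_le_one x⟩⟩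

lemma conv_bell_nonneg (d0 : ∀ x, 0 ≤ d x) (x : ℝ) : 0 ≤ ∫ y, bell (x - y) * d y :=
  integral_nonneg fun y => mul_nonneg (bell_pos _).le (d0 y)

lemma conv_bell_add_le (hd : Integrable d) (d0 : ∀ x, 0 ≤ d x) (x h : ℝ) :
    ∫ y, bell (x + h - y) * d y ≤ exp |h| * ∫ y, bell (x - y) * d y := by
  rw [← integral_const_mul]
  refine integral_mono (integrable_conv hd continuous_bell abs_bell_le _)
    ((integrable_conv hd continuous_bell abs_bell_le _).const_mul _) fun y => ?_
  have := bell_add_le (x - y) h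
  rw [show x - y + h = x + h - y by ring] at this
  simp only
  rw [← mul_assoc]
  exact mul_le_mul_of_nonneg_right this (d0 y)

end Convolution

lemma slab_eq_restrict (a b : ℝ) :
    slab a b = ((volume : Measure ℝ).prod volume).restrict (Set.Icc a b ×ˢ Set.univ) := by
  rw [← Measure.prod_restrict, Measure.restrict_univ]

lemma slab_mono {a b t : ℝ} (ht : t ≤ b) : slab a t ≤ slab a b := by
  rw [slab_eq_restrict, slab_eq_restrict]
  exact Measure.restrict_mono (Set.prod_mono (Set.Icc_subset_Icc_right ht) subset_rfl) le_rfl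

namespace IsSol

variable {u u1 u2 u3 : ℝ → ℝ → ℝ}

/-- Pointwise bound of `u` by a localised mass. -/
lemma pow_four_le (h : IsSol u u1 u2 u3) (t x : ℝ) :
    u t x ^ 4 ≤ 128 * hNorm u u1 t * ∫ y, u t y ^ 2 * bell (y - x) := by
  have c0 := h.cu t
  have c1 := h.cu1 t
  have cb := continuous_bell
  have cb1 := continuous_bell1
  have iA : Integrable fun y => u t y ^ 2 * bell (y - x) := by
    refine (h.i0 t).mono' (Continuous.aestronglyMeasurable (by fun_prop))
      (Eventually.of_forall fun y => ?_)
    rw [norm_mul, norm_pow, norm_eq_abs, sq_abs]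
    exact mul_le_of_le_one_right (sq_nonneg _) (abs_bell_le _)
  have iN : Integrable fun y => u t y ^ 2 + u1 t y ^ 2 := (h.i0 t).add (h.i1 t)
  have hA0 : 0 ≤ ∫ y, u t y ^ 2 * bell (y - x) :=
    integral_nonneg fun y => mul_nonneg (sq_nonneg _) (bell_pos _).le
  have hd : ∀ y, HasDerivAt (fun y => u t y ^ 2 * bell (y - x))
      (2 * u t y * u1 t y * bell (y - x) + u t y ^ 2 * bell1 (y - x)) y := fun y =>
    (((h.flow.d0 t y).pow 2).mul ((hasDerivAt_bell (y - x)).comp_sub_const y x)).congr_deriv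
      (by norm_num)
  have bd : ∀ l : ℝ, 0 < l → ∀ y, |2 * u t y * u1 t y * bell (y - x) + u t y ^ 2 * bell1 (y - x)|
      ≤ l * (2 * (u t y ^ 2 + u1 t y ^ 2)) + u t y ^ 2 * bell (y - x) / l := by
    intro l hl y
    have b0 := bell_pos (y - x)
    have b1 := bell_le (y - x)
    have b2 := abs_bell1_le (y - x)
    set p := |u t y| with hp
    set q := |u1 t y| with hq
    have p0 : 0 ≤ p := abs_nonneg _
    have q0 : 0 ≤ q := abs_nonneg _
    rw [← sq_abs (u t y), ← sq_abs (u1 t y), ← hp, ← hq]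
    calc |2 * u t y * u1 t y * bell (y - x) + p ^ 2 * bell1 (y - x)|
        ≤ |2 * u t y * u1 t y * bell (y - x)| + |p ^ 2 * bell1 (y - x)| := abs_add_le _ _
      _ ≤ 2 * p * q * bell (y - x) + p ^ 2 * bell (y - x) := by
          simp only [abs_mul, abs_two, abs_of_pos b0, ← hp, ← hq, abs_pow, abs_of_nonneg p0]
          gcongr
      _ ≤ l * (2 * (p ^ 2 + q ^ 2)) + p ^ 2 * bell (y - x) / l := by
          set k := bell (y - x)
          have e : p ^ 2 * k / l + l * (q + p / 2) ^ 2 * k - (2 * p * q * k + p ^ 2 * k)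
            = k / l * (p - l * (q + p / 2)) ^ 2 := by
            field_simp
            ring
          have e2 : 0 ≤ k / l * (p - l * (q + p / 2)) ^ 2 := by positivity
          have e3 : l * (q + p / 2) ^ 2 * k ≤ l * (q + p / 2) ^ 2 * 1 :=
            mul_le_mul_of_nonneg_left (by linarith) (by positivity)
          have e4 : (q + p / 2) ^ 2 ≤ 2 * (p ^ 2 + q ^ 2) := by
            nlinarith [sq_nonneg (q - p / 2)]
          have e5 := mul_le_mul_of_nonneg_left e4 hl.le
          linarith
  have ig : Integrable fun y => 2 * u t y * u1 t y * bell (y - x) + u t y ^ 2 * bell1 (y - x) := by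
    refine Integrable.mono' (((iN.const_mul 2).const_mul 1).add (iA.div_const 1))
      (Continuous.aestronglyMeasurable (by fun_prop)) (Eventually.of_forall fun y => ?_)
    exact bd 1 one_pos y
  have key := sq_le_of_forall_le (s := u t x ^ 2 / 4) (y := 2 * hNorm u u1 t)
    (m := ∫ y, u t y ^ 2 * bell (y - x)) (by positivity)
    (mul_nonneg zero_le_two (h.hNorm_nonneg t)) hA0 (fun l hl => by
      have h1 := abs_le_integral_abs_deriv hd iA ig x
      have hb : bell 0 = 1 / 4 := by norm_num [bell, sigmoid_zero]
      rw [sub_self, hb, abs_of_nonneg (by positivity)] at h1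
      calc u t x ^ 2 / 4 = u t x ^ 2 * (1 / 4) := by ring
        _ ≤ _ := h1
        _ ≤ ∫ y, (l * (2 * (u t y ^ 2 + u1 t y ^ 2)) + u t y ^ 2 * bell (y - x) / l) :=
            integral_mono ig.abs (((iN.const_mul 2).const_mul l).add (iA.div_const l)) (bd l hl)
        _ = l * (2 * hNorm u u1 t) + (∫ y, u t y ^ 2 * bell (y - x)) / l := by
            rw [integral_add ((iN.const_mul 2).const_mul l) (iA.div_const l), integral_const_mul,
              integral_const_mul, integral_div, hNorm])
  nlinarith

/-- On an interval where the `H¹` norm is bounded, `u⁶` is dominated by the convolution of `bell`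
with a fixed integrable density. -/
lemma exists_density (h : IsSol u u1 u2 u3) {a b K : ℝ} (hab : a ≤ b)
    (hK : ∀ t ∈ Set.Icc a b, hNorm u u1 t ≤ K) :
    ∃ (d : ℝ → ℝ) (C : ℝ), Integrable d ∧ (∀ x, 0 ≤ d x) ∧ 0 ≤ C ∧
      ∀ t ∈ Set.Icc a b, ∀ x, u t x ^ 6 ≤ C * ∫ y, bell (x - y) * d y := by
  have c0 := h.flow.c0
  have c1 := h.flow.c1
  have cb := continuous_bell
  have cb1 := continuous_bell1
  have cb3 := continuous_bell3
  have K0 : 0 ≤ K := (h.hNorm_nonneg a).trans (hK a ⟨le_rfl, hab⟩)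
  have j0 := h.integrable_slab_sq hab hK
  have j1 := h.integrable_slab_deriv_sq hab hK
  have j : Integrable (fun p : ℝ × ℝ => u p.1 p.2 ^ 2 + u1 p.1 p.2 ^ 2) (slab a b) := j0.add j1
  let d : ℝ → ℝ := fun y => u a y ^ 2 + ∫ t in Set.Icc a b, (u t y ^ 2 + u1 t y ^ 2)
  have di : Integrable d := (h.i0 a).add j.integral_prod_right
  have d0 : ∀ x, 0 ≤ d x := fun x =>
    add_nonneg (sq_nonneg _) (integral_nonneg fun t => by positivity)
  have jb : ∀ x, Integrable (fun p : ℝ × ℝ => bell (p.2 - x) * (u p.1 p.2 ^ 2 + u1 p.1 p.2 ^ 2))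
      (slab a b) := by
    intro x
    refine j.mono' (Continuous.aestronglyMeasurable (by fun_prop))
      (Eventually.of_forall fun p => ?_)
    have : 0 ≤ u p.1 p.2 ^ 2 + u1 p.1 p.2 ^ 2 := by positivity
    rw [norm_mul, norm_eq_abs, norm_eq_abs, abs_of_nonneg this]
    exact mul_le_of_le_one_left this (abs_bell_le _)
  have ia : ∀ t x, Integrable fun y => u t y ^ 2 * bell (y - x) := by
    intro t x
    have c := h.cu t
    refine (h.i0 t).mono' (Continuous.aestronglyMeasurable (by fun_prop))
      (Eventually.of_forall fun y => ?_)
    rw [norm_mul, norm_pow, norm_eq_abs, sq_abs]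
    exact mul_le_of_le_one_right (sq_nonneg _) (abs_bell_le _)
  have hθ : ∀ x, ∫ y, bell (x - y) * d y = (∫ y, u a y ^ 2 * bell (y - x))
      + ∫ p : ℝ × ℝ, bell (p.2 - x) * (u p.1 p.2 ^ 2 + u1 p.1 p.2 ^ 2) ∂(slab a b) := by
    intro x
    rw [integral_prod_symm _ (jb x), ← integral_add (ia a x) (jb x).integral_prod_right]
    refine integral_congr_ae (Eventually.of_forall fun y => ?_)
    simp only [d]
    rw [integral_const_mul, ← neg_sub y x, bell_neg]
    ring
  let C := 5 + 2 * K ^ 2 + K ^ 3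
  have hC : 0 ≤ C := by positivity
  have hloc : ∀ t ∈ Set.Icc a b, ∀ x, ∫ y, u t y ^ 2 * bell (y - x)
      ≤ C * ∫ y, bell (x - y) * d y := by
    intro t ht x
    have hKt : ∀ s ∈ Set.Icc a t, hNorm u u1 s ≤ K := fun s hs => hK s ⟨hs.1, hs.2.trans ht.2⟩
    have key := h.mass_weight (isWeight_bell x) (B := 1) ht.1
      (fun y => ⟨abs_bell_le _, abs_bell1_le_one _, abs_bell2_le_one _, abs_bell3_le_one _⟩) hKt
    have pw : ∀ p : ℝ × ℝ, p.1 ∈ Set.Icc a b → |u p.1 p.2 ^ 2 * bell3 (p.2 - x)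
      - 3 * u1 p.1 p.2 ^ 2 * bell1 (p.2 - x)
      + 2 * (u1 p.1 p.2 * bell (p.2 - x) + u p.1 p.2 * bell1 (p.2 - x)) * u p.1 p.2 ^ 4|
      ≤ C * (bell (p.2 - x) * (u p.1 p.2 ^ 2 + u1 p.1 p.2 ^ 2)) := by
      intro p hp
      have hv : u p.1 p.2 ^ 2 ≤ K := (h.sq_le_hNorm _ _).trans (hK _ hp)
      have b0 := bell_pos (p.2 - x)
      have b1 := abs_bell1_le (p.2 - x)
      have b3 := abs_bell3_le (p.2 - x)
      generalize u p.1 p.2 = z at *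
      generalize u1 p.1 p.2 = z1 at *
      generalize bell (p.2 - x) = k at *
      generalize bell1 (p.2 - x) = k1 at *
      generalize bell3 (p.2 - x) = k3 at *
      have z8 : z ^ 8 ≤ K ^ 3 * z ^ 2 := by
        calc z ^ 8 = (z ^ 2) ^ 3 * z ^ 2 := by ring
          _ ≤ _ := mul_le_mul_of_nonneg_right (pow_le_pow_left₀ (sq_nonneg _) hv 3) (sq_nonneg _)
      have z3 : |z ^ 3| ≤ 1 + K ^ 2 := by
        have : (z ^ 2) ^ 2 ≤ K ^ 2 := pow_le_pow_left₀ (sq_nonneg _) hv 2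
        rw [abs_le]; constructor <;>
        nlinarith [sq_nonneg (z ^ 2 - z), sq_nonneg (z ^ 2 + z), sq_nonneg (z - 1),
          sq_nonneg (z + 1), sq_nonneg (z ^ 2 - 1)]
      have a1 : |z ^ 2 * k3| ≤ 2 * (k * z ^ 2) := by
        rw [abs_mul, abs_of_nonneg (sq_nonneg z)]; nlinarith [sq_nonneg z]
      have a2 : |3 * z1 ^ 2 * k1| ≤ 3 * (k * z1 ^ 2) := by
        rw [abs_mul, abs_of_nonneg (by positivity)]; nlinarith [sq_nonneg z1]
      have a3 : |2 * (z1 * z ^ 4) * k| ≤ k * (z1 ^ 2 + K ^ 3 * z ^ 2) := by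
        rw [abs_mul, abs_of_pos b0, mul_comm]
        refine mul_le_mul_of_nonneg_left ?_ b0.le
        rw [abs_le]; constructor <;> nlinarith [sq_nonneg (z1 - z ^ 4), sq_nonneg (z1 + z ^ 4)]
      have a4 : |2 * (z ^ 2 * z ^ 3) * k1| ≤ 2 * (k * (z ^ 2 * (1 + K ^ 2))) := by
        rw [abs_mul, abs_mul, abs_mul, abs_two, abs_of_nonneg (sq_nonneg z)]
        calc 2 * (z ^ 2 * |z ^ 3|) * |k1| ≤ 2 * (z ^ 2 * (1 + K ^ 2)) * k := by gcongr
          _ = _ := by ring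
      have e : z ^ 2 * k3 - 3 * z1 ^ 2 * k1 + 2 * (z1 * k + z * k1) * z ^ 4
        = z ^ 2 * k3 - 3 * z1 ^ 2 * k1 + 2 * (z1 * z ^ 4) * k + 2 * (z ^ 2 * z ^ 3) * k1 := by
        ring
      rw [e]
      have n1 : 0 ≤ k * z ^ 2 := by positivity
      have n2 : 0 ≤ k * z1 ^ 2 := by positivity
      have n3 : 0 ≤ (2 * K ^ 2 + K ^ 3) * (k * z1 ^ 2) := by positivity
      rw [abs_le] at a1 a2 a3 a4 ⊢
      simp only [C]
      constructor <;> nlinarith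
    have hae : ∀ᵐ p ∂(slab a t), p.1 ∈ Set.Icc a b := by
      rw [slab_eq_restrict]
      refine (ae_restrict_iff' (measurableSet_Icc.prod MeasurableSet.univ)).2
        (Eventually.of_forall fun p hp => ⟨hp.1.1, hp.1.2.trans ht.2⟩)
    have jt := (jb x).mono_measure (slab_mono (a := a) ht.2)
    have up : ∫ p : ℝ × ℝ, (u p.1 p.2 ^ 2 * bell3 (p.2 - x)
      - 3 * u1 p.1 p.2 ^ 2 * bell1 (p.2 - x)
      + 2 * (u1 p.1 p.2 * bell (p.2 - x) + u p.1 p.2 * bell1 (p.2 - x)) * u p.1 p.2 ^ 4)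
        ∂(slab a t) ≤ ∫ p : ℝ × ℝ, C * (bell (p.2 - x) * (u p.1 p.2 ^ 2 + u1 p.1 p.2 ^ 2))
        ∂(slab a t) := by
      refine integral_mono_ae ((jt.const_mul C).mono'
        (Continuous.aestronglyMeasurable (by fun_prop)) ?_) (jt.const_mul C) ?_
      · filter_upwards [hae] with p hp using pw p hp
      · filter_upwards [hae] with p hp using (le_abs_self _).trans (pw p hp)
    have mono : ∫ p : ℝ × ℝ, (bell (p.2 - x) * (u p.1 p.2 ^ 2 + u1 p.1 p.2 ^ 2)) ∂(slab a t)
        ≤ ∫ p : ℝ × ℝ, (bell (p.2 - x) * (u p.1 p.2 ^ 2 + u1 p.1 p.2 ^ 2)) ∂(slab a b) :=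
      integral_mono_measure (slab_mono ht.2) (Eventually.of_forall fun p =>
        mul_nonneg (bell_pos _).le (by positivity)) (jb x)
    rw [integral_const_mul] at up
    have hA : 0 ≤ ∫ y, u a y ^ 2 * bell (y - x) :=
      integral_nonneg fun y => mul_nonneg (sq_nonneg _) (bell_pos _).le
    rw [hθ]
    have h1 : 1 ≤ C := by simp only [C]; nlinarith [pow_nonneg K0 2, pow_nonneg K0 3]
    nlinarith
  refine ⟨d, K * (128 * K * C), di, d0, by positivity, fun t ht x => ?_⟩
  have h2 := h.sq_le_hNorm t x
  have h3 := hK t ht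
  calc u t x ^ 6 = u t x ^ 2 * u t x ^ 4 := by ring
    _ ≤ K * (128 * K * (C * ∫ y, bell (x - y) * d y)) := by
        refine mul_le_mul (h2.trans h3) ((h.pow_four_le t x).trans ?_) (by positivity) K0
        refine mul_le_mul (by linarith) (hloc t ht x) ?_ (by positivity)
        exact integral_nonneg fun y => mul_nonneg (sq_nonneg _) (bell_pos _).le
    _ = _ := by ring

end IsSol

/-- Spatial difference quotient. -/
noncomputable def diffQuot (h : ℝ) (v : ℝ → ℝ → ℝ) (t x : ℝ) : ℝ := (v t (x + h) - v t x) / h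

/-- The divided difference `(A⁴ - B⁴) / (A - B)` for `A = u(x + h)`, `B = u(x)`. -/
noncomputable def quarticSlope (h : ℝ) (u : ℝ → ℝ → ℝ) (t x : ℝ) : ℝ :=
  u t (x + h) ^ 3 + u t (x + h) ^ 2 * u t x + u t (x + h) * u t x ^ 2 + u t x ^ 3

lemma diffQuot_pow_four (h : ℝ) (u : ℝ → ℝ → ℝ) (t x : ℝ) :
    diffQuot h (fun t x => u t x ^ 4) t x = diffQuot h u t x * quarticSlope h u t x := by
  simp only [diffQuot, quarticSlope]; ring

lemma continuous_diffQuot {v : ℝ → ℝ → ℝ} (hv : Continuous fun p : ℝ × ℝ => v p.1 p.2) (h : ℝ) :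
    Continuous fun p : ℝ × ℝ => diffQuot h v p.1 p.2 := by
  have : Continuous fun p : ℝ × ℝ => v p.1 (p.2 + h) :=
    hv.comp (continuous_fst.prodMk (continuous_snd.add continuous_const))
  exact (this.sub hv).div_const h

lemma hasDerivAt_diffQuot {v v' : ℝ → ℝ → ℝ} (hv : ∀ t x, HasDerivAt (v t) (v' t x) x) (h t x : ℝ) :
    HasDerivAt (diffQuot h v t) (diffQuot h v' t x) x :=
  (((hv t (x + h)).comp_add_const x h).sub (hv t x)).div_const h

lemma IsFlow.diffQuot {w w1 w2 w3 S S1 : ℝ → ℝ → ℝ} (hw : IsFlow w w1 w2 w3 S S1) (h : ℝ) :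
    IsFlow (diffQuot h w) (diffQuot h w1) (diffQuot h w2) (diffQuot h w3) (diffQuot h S)
      (diffQuot h S1) where
  dt t x := (((hw.dt t (x + h)).sub (hw.dt t x)).div_const h).congr_deriv
    (by simp only [_root_.diffQuot]; ring)
  d0 := hasDerivAt_diffQuot hw.d0 h
  d1 := hasDerivAt_diffQuot hw.d1 h
  d2 := hasDerivAt_diffQuot hw.d2 h
  dS := hasDerivAt_diffQuot hw.dS h
  c0 := continuous_diffQuot hw.c0 h
  c1 := continuous_diffQuot hw.c1 h
  c2 := continuous_diffQuot hw.c2 h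
  c3 := continuous_diffQuot hw.c3 h
  cS := continuous_diffQuot hw.cS h
  cS1 := continuous_diffQuot hw.cS1 h

lemma quarticSlope_sq_le (A B : ℝ) :
    (A ^ 3 + A ^ 2 * B + A * B ^ 2 + B ^ 3) ^ 2 ≤ 8 * (A ^ 6 + B ^ 6) := by
  have h1 : (A + B) ^ 2 ≤ 2 * (A ^ 2 + B ^ 2) := by nlinarith [sq_nonneg (A - B)]
  have h2 : (A ^ 2 + B ^ 2) ^ 3 ≤ 4 * (A ^ 6 + B ^ 6) := by
    nlinarith [mul_nonneg (add_nonneg (sq_nonneg A) (sq_nonneg B)) (sq_nonneg (A ^ 2 - B ^ 2))]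
  calc (A ^ 3 + A ^ 2 * B + A * B ^ 2 + B ^ 3) ^ 2
      = (A + B) ^ 2 * (A ^ 2 + B ^ 2) ^ 2 := by ring
    _ ≤ 2 * (A ^ 2 + B ^ 2) * (A ^ 2 + B ^ 2) ^ 2 := mul_le_mul_of_nonneg_right h1 (sq_nonneg _)
    _ = 2 * (A ^ 2 + B ^ 2) ^ 3 := by ring
    _ ≤ _ := by linarith

lemma abs_two_mul_le {p q s θ C η : ℝ} (hθ : 0 ≤ θ) (hC : 0 ≤ C) (hη : 0 < η)
    (hs : s ^ 2 ≤ C * θ) : |2 * (p * q * s)| ≤ η * (p ^ 2 * θ) + C / η * q ^ 2 := by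
  refine abs_le_of_sq_le_sq ?_ (by positivity)
  have e : (η * (p ^ 2 * θ) + C / η * q ^ 2) ^ 2
      = (η * (p ^ 2 * θ) - C / η * q ^ 2) ^ 2 + 4 * (p ^ 2 * q ^ 2) * (C * θ) := by
    field_simp
    ring
  rw [e]
  have := mul_le_mul_of_nonneg_left hs (by positivity : 0 ≤ 4 * (p ^ 2 * q ^ 2))
  nlinarith [sq_nonneg (η * (p ^ 2 * θ) - C / η * q ^ 2)]

namespace IsSol

variable {u u1 u2 u3 : ℝ → ℝ → ℝ}

lemma diffQuot_sq (h : IsSol u u1 u2 u3) {ε : ℝ} (hε : ε ≠ 0) (t : ℝ) :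
    Integrable (fun x => diffQuot ε u t x ^ 2) ∧
      ∫ x, diffQuot ε u t x ^ 2 ≤ ∫ x, u1 t x ^ 2 :=
  integral_diffQuot_sq_le (h.flow.d0 t) (h.cu1 t) (h.i1 t) hε

lemma diffQuot_deriv_sq (h : IsSol u u1 u2 u3) (ε t : ℝ) :
    Integrable (fun x => diffQuot ε u1 t x ^ 2) ∧
      ∫ x, diffQuot ε u1 t x ^ 2 ≤ 4 / ε ^ 2 * ∫ x, u1 t x ^ 2 := by
  have c1 := h.cu1 t
  have i1 := h.i1 t
  have i2 : Integrable fun x => u1 t (x + ε) ^ 2 := i1.comp_add_right ε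
  have iB : Integrable fun x => 2 / ε ^ 2 * (u1 t (x + ε) ^ 2 + u1 t x ^ 2) :=
    (i2.add i1).const_mul _
  have pw : ∀ x, diffQuot ε u1 t x ^ 2 ≤ 2 / ε ^ 2 * (u1 t (x + ε) ^ 2 + u1 t x ^ 2) := by
    intro x
    simp only [diffQuot, div_pow]
    rw [div_mul_eq_mul_div]
    refine div_le_div_of_nonneg_right ?_ (sq_nonneg _)
    nlinarith [sq_nonneg (u1 t (x + ε) + u1 t x)]
  have i : Integrable (fun x => diffQuot ε u1 t x ^ 2) := by
    refine iB.mono' (Continuous.aestronglyMeasurable (by unfold diffQuot; fun_prop))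
      (Eventually.of_forall fun x => ?_)
    rw [norm_eq_abs, abs_of_nonneg (sq_nonneg _)]
    exact pw x
  refine ⟨i, (integral_mono i iB pw).trans_eq ?_⟩
  rw [integral_const_mul, integral_add i2 i1, integral_add_right_eq_self (fun x => u1 t x ^ 2)]
  ring

lemma quarticSlope_sq_le_const (h : IsSol u u1 u2 u3) {t K : ℝ} (hK : hNorm u u1 t ≤ K)
    (ε x : ℝ) : quarticSlope ε u t x ^ 2 ≤ 16 * K ^ 3 := by
  have h1 : (u t (x + ε) ^ 2) ^ 3 ≤ K ^ 3 :=
    pow_le_pow_left₀ (sq_nonneg _) ((h.sq_le_hNorm t _).trans hK) 3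
  have h2 : (u t x ^ 2) ^ 3 ≤ K ^ 3 :=
    pow_le_pow_left₀ (sq_nonneg _) ((h.sq_le_hNorm t _).trans hK) 3
  norm_num [← pow_mul] at h1 h2
  have := quarticSlope_sq_le (u t (x + ε)) (u t x)
  unfold quarticSlope
  linarith

lemma diffQuot_pow_four_sq (h : IsSol u u1 u2 u3) {ε t K : ℝ} (hε : ε ≠ 0)
    (hK : hNorm u u1 t ≤ K) :
    Integrable (fun x => diffQuot ε (fun t x => u t x ^ 4) t x ^ 2) ∧
      ∫ x, diffQuot ε (fun t x => u t x ^ 4) t x ^ 2 ≤ 16 * K ^ 4 := by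
  obtain ⟨i, le⟩ := h.diffQuot_sq hε t
  have c := h.cu t
  have K0 := (h.hNorm_nonneg t).trans hK
  have pw : ∀ x, diffQuot ε (fun t x => u t x ^ 4) t x ^ 2 ≤ 16 * K ^ 3 * diffQuot ε u t x ^ 2 := by
    intro x
    rw [diffQuot_pow_four, mul_pow, mul_comm]
    exact mul_le_mul_of_nonneg_right (h.quarticSlope_sq_le_const hK ε x) (sq_nonneg _)
  have j : Integrable (fun x => diffQuot ε (fun t x => u t x ^ 4) t x ^ 2) := by
    refine (i.const_mul (16 * K ^ 3)).mono'
      (Continuous.aestronglyMeasurable (by unfold diffQuot; fun_prop))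
      (Eventually.of_forall fun x => ?_)
    rw [norm_eq_abs, abs_of_nonneg (sq_nonneg _)]
    exact pw x
  refine ⟨j, (integral_mono j (i.const_mul _) pw).trans ?_⟩
  rw [integral_const_mul]
  calc 16 * K ^ 3 * ∫ x, diffQuot ε u t x ^ 2 ≤ 16 * K ^ 3 * K :=
        mul_le_mul_of_nonneg_left ((le.trans (h.deriv_le t)).trans hK) (by positivity)
    _ = _ := by ring

/-- Localised mass identity for the difference quotient. -/
lemma diffQuot_mass (h : IsSol u u1 u2 u3) {f f1 f2 f3 : ℝ → ℝ} (hf : IsWeight f f1 f2 f3)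
    {a b K B ε : ℝ} (hε : ε ≠ 0) (hab : a ≤ b)
    (hB : ∀ x, |f x| ≤ B ∧ |f1 x| ≤ B ∧ |f2 x| ≤ B ∧ |f3 x| ≤ B)
    (hK : ∀ t ∈ Set.Icc a b, hNorm u u1 t ≤ K) :
    (∫ x, diffQuot ε u b x ^ 2 * f x) - ∫ x, diffQuot ε u a x ^ 2 * f x =
      ∫ p : ℝ × ℝ, (diffQuot ε u p.1 p.2 ^ 2 * f3 p.2 - 3 * diffQuot ε u1 p.1 p.2 ^ 2 * f1 p.2
      + 2 * (diffQuot ε u1 p.1 p.2 * f p.2 + diffQuot ε u p.1 p.2 * f1 p.2)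
        * (diffQuot ε u p.1 p.2 * quarticSlope ε u p.1 p.2)) ∂(slab a b) := by
  have K0 : 0 ≤ K := (h.hNorm_nonneg a).trans (hK a ⟨le_rfl, hab⟩)
  have e4 : 0 ≤ 4 / ε ^ 2 * K := by positivity
  have k4 : 0 ≤ 16 * K ^ 4 := by positivity
  have := (h.flow.diffQuot ε).mass hf (K := K + 4 / ε ^ 2 * K + 16 * K ^ 4) hab hB
    (fun t _ => (h.diffQuot_sq hε t).1) (fun t _ => (h.diffQuot_deriv_sq ε t).1)
    (fun t ht => (h.diffQuot_pow_four_sq hε (hK t ht)).1)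
    (fun t ht => by
      have := (h.diffQuot_sq hε t).2
      have := h.deriv_le t
      have := hK t ht
      linarith)
    (fun t ht => by
      have h1 := (h.diffQuot_deriv_sq ε t).2
      have h2 := mul_le_mul_of_nonneg_left ((h.deriv_le t).trans (hK t ht))
        (by positivity : 0 ≤ 4 / ε ^ 2)
      linarith)
    (fun t ht => by
      have := (h.diffQuot_pow_four_sq hε (hK t ht)).2
      linarith)
  simp only [diffQuot_pow_four] at this
  exact this

lemma integrable_slab_diffQuot_sq (h : IsSol u u1 u2 u3) {a b K ε : ℝ} (hε : ε ≠ 0) (hab : a ≤ b)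
    (hK : ∀ t ∈ Set.Icc a b, hNorm u u1 t ≤ K) :
    Integrable (fun p : ℝ × ℝ => diffQuot ε u p.1 p.2 ^ 2) (slab a b) ∧
      ∫ p : ℝ × ℝ, diffQuot ε u p.1 p.2 ^ 2 ∂(slab a b)
        ≤ ∫ p : ℝ × ℝ, u1 p.1 p.2 ^ 2 ∂(slab a b) := by
  have c := continuous_diffQuot h.flow.c0 ε
  have i := (integrable_slab (F := fun t x => diffQuot ε u t x ^ 2) (K := K) hab
    (by simp only [Function.uncurry_def]; fun_prop) (fun _ _ => sq_nonneg _)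
    (fun t _ => (h.diffQuot_sq hε t).1)
    (fun t ht => ((h.diffQuot_sq hε t).2.trans (h.deriv_le t)).trans (hK t ht))).1
  have j := h.integrable_slab_deriv_sq hab hK
  refine ⟨i, ?_⟩
  rw [integral_prod _ i, integral_prod _ j]
  exact integral_mono i.integral_prod_left j.integral_prod_left fun t => (h.diffQuot_sq hε t).2

lemma integrable_slab_diffQuot_deriv_sq (h : IsSol u u1 u2 u3) {a b K : ℝ} (ε : ℝ) (hab : a ≤ b)
    (hK : ∀ t ∈ Set.Icc a b, hNorm u u1 t ≤ K) :
    Integrable (fun p : ℝ × ℝ => diffQuot ε u1 p.1 p.2 ^ 2) (slab a b) := by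
  have c := continuous_diffQuot h.flow.c1 ε
  exact (integrable_slab (F := fun t x => diffQuot ε u1 t x ^ 2) (K := 4 / ε ^ 2 * K) hab
    (by simp only [Function.uncurry_def]; fun_prop) (fun _ _ => sq_nonneg _)
    (fun t _ => (h.diffQuot_deriv_sq ε t).1)
    (fun t ht => (h.diffQuot_deriv_sq ε t).2.trans
      (mul_le_mul_of_nonneg_left ((h.deriv_le t).trans (hK t ht)) (by positivity)))).1

/-- Kato smoothing for difference quotients. -/
lemma exists_kato (h : IsSol u u1 u2 u3) {a b K : ℝ} (hab : a ≤ b)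
    (hK : ∀ t ∈ Set.Icc a b, hNorm u u1 t ≤ K) :
    ∃ (θ : ℝ → ℝ) (C D : ℝ), Continuous θ ∧ (∀ x, 0 ≤ θ x) ∧ (∃ B, ∀ x, θ x ≤ B) ∧ 0 ≤ C ∧ 0 ≤ D ∧
      (∀ ε, |ε| ≤ 1 → ∀ t ∈ Set.Icc a b, ∀ x, quarticSlope ε u t x ^ 2 ≤ C * θ x) ∧
      ∀ ε, ε ≠ 0 → |ε| ≤ 1 →
        ∫ p : ℝ × ℝ, diffQuot ε u1 p.1 p.2 ^ 2 * θ p.2 ∂(slab a b) ≤ D := by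
  obtain ⟨d, C0, di, d0, hC0, hdom⟩ := h.exists_density hab hK
  obtain ⟨φ, φ2, φ3, hφ, bφ⟩ := exists_weight di d0
  have K0 : 0 ≤ K := (h.hNorm_nonneg a).trans (hK a ⟨le_rfl, hab⟩)
  set θ : ℝ → ℝ := fun x => ∫ y, bell (x - y) * d y with hθdef
  set E : ℝ := ∫ y, d y with hE
  have E0 : 0 ≤ E := integral_nonneg d0
  have θ0 : ∀ x, 0 ≤ θ x := conv_bell_nonneg d0
  have θE : ∀ x, θ x ≤ E := fun x => (le_abs_self _).trans (bφ x).2.1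
  have cθ : Continuous θ := continuous_of_hasDerivAt hφ.d1
  have cφ : Continuous φ := continuous_of_hasDerivAt hφ.d0
  have cφ3 : Continuous φ3 := hφ.c3
  set C : ℝ := 8 * C0 * (exp 1 + 1) with hC
  have C1 : 0 ≤ C := by positivity
  have hslope : ∀ ε, |ε| ≤ 1 → ∀ t ∈ Set.Icc a b, ∀ x, quarticSlope ε u t x ^ 2 ≤ C * θ x := by
    intro ε hε t ht x
    have h1 := quarticSlope_sq_le (u t (x + ε)) (u t x)
    have h2 := hdom t ht (x + ε)
    have h3 := hdom t ht x
    have h4 : θ (x + ε) ≤ exp 1 * θ x := (conv_bell_add_le di d0 x ε).trans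
      (mul_le_mul_of_nonneg_right (exp_le_exp.2 hε) (θ0 x))
    have h5 := mul_le_mul_of_nonneg_left h4 hC0
    unfold quarticSlope
    simp only [hθdef] at *
    calc _ ≤ _ := h1
      _ ≤ 8 * (C0 * (exp 1 * ∫ y, bell (x - y) * d y) + C0 * ∫ y, bell (x - y) * d y) := by
          linarith
      _ = _ := by rw [hC]; ring
  refine ⟨θ, C, E * K * 2 + (E + C * E ^ 2 + 2 * E * (1 + 16 * K ^ 3)) * ((b - a) * K), cθ, θ0,
    ⟨E, θE⟩, C1, ?_, hslope, ?_⟩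
  · have := sub_nonneg.2 hab
    positivity
  intro ε hε hε1
  have key := h.diffQuot_mass hφ hε hab bφ hK
  have c0 := continuous_diffQuot h.flow.c0 ε
  have c1 := continuous_diffQuot h.flow.c1 ε
  have cP : Continuous fun p : ℝ × ℝ => quarticSlope ε u p.1 p.2 := by
    have k0 := h.flow.c0
    have k1 : Continuous fun p : ℝ × ℝ => u p.1 (p.2 + ε) :=
      k0.comp (continuous_fst.prodMk (continuous_snd.add continuous_const))
    unfold quarticSlope
    fun_prop
  obtain ⟨iq, -⟩ := h.integrable_slab_diffQuot_sq hε hab hK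
  have iq1 := h.integrable_slab_diffQuot_deriv_sq ε hab hK
  have iqθ : Integrable (fun p : ℝ × ℝ => diffQuot ε u1 p.1 p.2 ^ 2 * θ p.2) (slab a b) := by
    refine (iq1.mul_const E).mono' (Continuous.aestronglyMeasurable (by fun_prop))
      (Eventually.of_forall fun p => ?_)
    rw [norm_mul, norm_pow, norm_eq_abs, norm_eq_abs, sq_abs, abs_of_nonneg (θ0 _)]
    exact mul_le_mul_of_nonneg_left (θE _) (sq_nonneg _)
  have hae : ∀ᵐ p ∂(slab a b), p.1 ∈ Set.Icc a b := by
    rw [slab_eq_restrict]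
    exact (ae_restrict_iff' (measurableSet_Icc.prod MeasurableSet.univ)).2
      (Eventually.of_forall fun p hp => hp.1)
  set L : ℝ := E + C * E ^ 2 + 2 * E * (1 + 16 * K ^ 3) with hL
  have pw : ∀ᵐ p ∂(slab a b), |(diffQuot ε u p.1 p.2 ^ 2 * φ3 p.2
      - 3 * diffQuot ε u1 p.1 p.2 ^ 2 * θ p.2
      + 2 * (diffQuot ε u1 p.1 p.2 * φ p.2 + diffQuot ε u p.1 p.2 * θ p.2)
        * (diffQuot ε u p.1 p.2 * quarticSlope ε u p.1 p.2))
      + 3 * (diffQuot ε u1 p.1 p.2 ^ 2 * θ p.2)|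
      ≤ 1 * (diffQuot ε u1 p.1 p.2 ^ 2 * θ p.2) + L * diffQuot ε u p.1 p.2 ^ 2 := by
    filter_upwards [hae] with p hp
    have s1 := hslope ε hε1 p.1 hp p.2
    have s2 := h.quarticSlope_sq_le_const (hK p.1 hp) ε p.2
    obtain ⟨f0, -, -, f3⟩ := bφ p.2
    have t0 := θ0 p.2
    have tE := θE p.2
    generalize diffQuot ε u1 p.1 p.2 = q1 at *
    generalize diffQuot ε u p.1 p.2 = q at *
    generalize quarticSlope ε u p.1 p.2 = s at *
    generalize φ p.2 = y at *
    generalize φ3 p.2 = y3 at *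
    generalize θ p.2 = z at *
    have a1 : |q ^ 2 * y3| ≤ E * q ^ 2 := by
      rw [abs_mul, abs_of_nonneg (sq_nonneg q), mul_comm]
      exact mul_le_mul_of_nonneg_right f3 (sq_nonneg _)
    have a2 : |2 * (q1 * q * (s * y))| ≤ 1 * (q1 ^ 2 * z) + C * E ^ 2 / 1 * q ^ 2 := by
      refine abs_two_mul_le t0 (by positivity) one_pos ?_
      have y2 : y ^ 2 ≤ E ^ 2 := by rw [← sq_abs y]; exact pow_le_pow_left₀ (abs_nonneg _) f0 2
      calc (s * y) ^ 2 = s ^ 2 * y ^ 2 := by ring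
        _ ≤ C * z * E ^ 2 := mul_le_mul s1 y2 (sq_nonneg _) (by positivity)
        _ = _ := by ring
    have a3 : |2 * q ^ 2 * (z * s)| ≤ 2 * q ^ 2 * (E * (1 + 16 * K ^ 3)) := by
      rw [abs_mul, abs_of_nonneg (by positivity), abs_mul, abs_of_nonneg t0]
      have : |s| ≤ 1 + 16 * K ^ 3 := by
        nlinarith [sq_abs s, abs_nonneg s, sq_nonneg (|s| - 1)]
      gcongr
    have e : q ^ 2 * y3 - 3 * q1 ^ 2 * z + 2 * (q1 * y + q * z) * (q * s) + 3 * (q1 ^ 2 * z)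
      = q ^ 2 * y3 + 2 * (q1 * q * (s * y)) + 2 * q ^ 2 * (z * s) := by ring
    rw [e, hL]
    rw [abs_le] at a1 a2 a3 ⊢
    rw [div_one] at a2
    constructor <;> nlinarith
  have iR : Integrable (fun p : ℝ × ℝ => 1 * (diffQuot ε u1 p.1 p.2 ^ 2 * θ p.2)
      + L * diffQuot ε u p.1 p.2 ^ 2) (slab a b) := (iqθ.const_mul 1).add (iq.const_mul L)
  have iF : Integrable (fun p : ℝ × ℝ => (diffQuot ε u p.1 p.2 ^ 2 * φ3 p.2
      - 3 * diffQuot ε u1 p.1 p.2 ^ 2 * θ p.2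
      + 2 * (diffQuot ε u1 p.1 p.2 * φ p.2 + diffQuot ε u p.1 p.2 * θ p.2)
        * (diffQuot ε u p.1 p.2 * quarticSlope ε u p.1 p.2))
      + 3 * (diffQuot ε u1 p.1 p.2 ^ 2 * θ p.2)) (slab a b) :=
    iR.mono' (Continuous.aestronglyMeasurable (by fun_prop)) pw
  have le := integral_mono_ae iF iR (pw.mono fun p hp => (le_abs_self _).trans hp)
  have iG : Integrable (fun p : ℝ × ℝ => (diffQuot ε u p.1 p.2 ^ 2 * φ3 p.2
      - 3 * diffQuot ε u1 p.1 p.2 ^ 2 * θ p.2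
      + 2 * (diffQuot ε u1 p.1 p.2 * φ p.2 + diffQuot ε u p.1 p.2 * θ p.2)
        * (diffQuot ε u p.1 p.2 * quarticSlope ε u p.1 p.2))) (slab a b) := by
    have := iF.sub (iqθ.const_mul 3)
    refine this.congr (Eventually.of_forall fun p => ?_)
    simp only [Pi.sub_apply]
    ring
  rw [integral_add iG (iqθ.const_mul 3), integral_add (iqθ.const_mul 1) (iq.const_mul L), ← key,
    integral_const_mul, integral_const_mul, integral_const_mul] at le
  have bdry : ∀ t ∈ Set.Icc a b, |∫ x, diffQuot ε u t x ^ 2 * φ x| ≤ E * K := by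
    intro t ht
    obtain ⟨i, le⟩ := h.diffQuot_sq hε t
    refine abs_integral_le_integral_abs.trans ?_
    calc ∫ x, |diffQuot ε u t x ^ 2 * φ x| ≤ ∫ x, E * diffQuot ε u t x ^ 2 := by
          refine integral_mono_of_nonneg (Eventually.of_forall fun x => abs_nonneg _)
            (i.const_mul E) (Eventually.of_forall fun x => ?_)
          simp only
          rw [abs_mul, abs_of_nonneg (sq_nonneg _), mul_comm]
          exact mul_le_mul_of_nonneg_right (bφ x).1 (sq_nonneg _)
      _ = E * ∫ x, diffQuot ε u t x ^ 2 := integral_const_mul _ _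
      _ ≤ E * K := mul_le_mul_of_nonneg_left ((le.trans (h.deriv_le t)).trans (hK t ht)) E0
  have b1 := abs_le.1 (bdry a ⟨le_rfl, hab⟩)
  have b2 := abs_le.1 (bdry b ⟨hab, le_rfl⟩)
  have hq : ∫ p : ℝ × ℝ, diffQuot ε u p.1 p.2 ^ 2 ∂(slab a b) ≤ (b - a) * K :=
    (integrable_slab (F := fun t x => diffQuot ε u t x ^ 2) (K := K) hab
      (by simp only [Function.uncurry_def]; fun_prop) (fun _ _ => sq_nonneg _)
      (fun t _ => (h.diffQuot_sq hε t).1)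
      (fun t ht => ((h.diffQuot_sq hε t).2.trans (h.deriv_le t)).trans (hK t ht))).2
  have hL0 : 0 ≤ L := by positivity
  have hq' := mul_le_mul_of_nonneg_left hq hL0
  have hn : 0 ≤ ∫ p : ℝ × ℝ, diffQuot ε u1 p.1 p.2 ^ 2 * θ p.2 ∂(slab a b) :=
    integral_nonneg fun p => mul_nonneg (sq_nonneg _) (θ0 _)
  nlinarith

end IsSol

lemma tendsto_diffQuot {v v' : ℝ → ℝ → ℝ} (hv : ∀ t x, HasDerivAt (v t) (v' t x) x) (t x : ℝ) :
    Tendsto (fun n : ℕ => diffQuot (1 / ((n : ℝ) + 1)) v t x) atTop (nhds (v' t x)) := by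
  have h := (hasDerivAt_iff_tendsto_slope_zero.1 (hv t x))
  have h2 : Tendsto (fun n : ℕ => 1 / ((n : ℝ) + 1)) atTop (nhdsWithin 0 {0}ᶜ) := by
    refine tendsto_nhdsWithin_iff.2 ⟨tendsto_one_div_add_atTop_nhds_zero_nat,
      Eventually.of_forall fun n => ?_⟩
    have : 0 < 1 / ((n : ℝ) + 1) := by positivity
    exact this.ne'
  refine (h.comp h2).congr fun n => ?_
  simp only [Function.comp_apply, smul_eq_mul, diffQuot]
  exact inv_mul_eq_div _ _

lemma integral_linear_combination {α : Type*} [MeasurableSpace α] {μ : Measure α} {f g k : α → ℝ}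
    (hf : Integrable f μ) (hg : Integrable g μ) (hk : Integrable k μ) (a b c : ℝ) :
    ∫ x, (a * f x + b * g x + c * k x) ∂μ
      = a * (∫ x, f x ∂μ) + b * (∫ x, g x ∂μ) + c * ∫ x, k x ∂μ := by
  have h1 : Integrable (fun x => a * f x + b * g x) μ := (hf.const_mul a).add (hg.const_mul b)
  rw [integral_add h1 (hk.const_mul c), integral_add (hf.const_mul a) (hg.const_mul b),
    integral_const_mul, integral_const_mul, integral_const_mul]

namespace IsSol

variable {u u1 u2 u3 : ℝ → ℝ → ℝ}

lemma tendsto_integral_diffQuot_sq (h : IsSol u u1 u2 u3) (t : ℝ) :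
    Tendsto (fun n : ℕ => ∫ x, diffQuot (1 / ((n : ℝ) + 1)) u t x ^ 2) atTop
      (nhds (∫ x, u1 t x ^ 2)) := by
  have hne : ∀ n : ℕ, (1 / ((n : ℝ) + 1)) ≠ 0 := fun n => by positivity
  refine tendsto_order.2 ⟨fun c hc => ?_, fun c hc => Eventually.of_forall fun n =>
    (h.diffQuot_sq (hne n) t).2.trans_lt hc⟩
  by_contra hcon
  rw [not_eventually] at hcon
  have := (integrable_of_frequently_integral_le (b := c) (fun n x => sq_nonneg _)
    (fun n => (h.diffQuot_sq (hne n) t).1)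
    (fun x => (tendsto_diffQuot h.flow.d0 t x).pow 2) (hcon.mono fun n hn => not_lt.1 hn)).2
  linarith

/-- Balance of the `L²` norm of the derivative on an interval where the `H¹` norm is bounded. -/
lemma deriv_balance (h : IsSol u u1 u2 u3) {a b K : ℝ} (hab : a ≤ b)
    (hK : ∀ t ∈ Set.Icc a b, hNorm u u1 t ≤ K) :
    Integrable (fun p : ℝ × ℝ => 2 * (u2 p.1 p.2 * u1 p.1 p.2 * (4 * u p.1 p.2 ^ 3))) (slab a b) ∧
    (∫ x, u1 b x ^ 2) - ∫ x, u1 a x ^ 2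
      = ∫ p : ℝ × ℝ, 2 * (u2 p.1 p.2 * u1 p.1 p.2 * (4 * u p.1 p.2 ^ 3)) ∂(slab a b) := by
  obtain ⟨θ, C, D, cθ, θ0, ⟨B, θB⟩, C0, D0, hslope, hkato⟩ := h.exists_kato hab hK
  have c0 := h.flow.c0
  have c1 := h.flow.c1
  have c2 := h.flow.c2
  let r : ℕ → ℝ := fun n => 1 / ((n : ℝ) + 1)
  have r0 : ∀ n, 0 < r n := fun n => by positivity
  have r1 : ∀ n, |r n| ≤ 1 := fun n => by
    rw [abs_of_pos (r0 n)]
    simp only [r]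
    rw [div_le_one (by positivity)]
    have : (0 : ℝ) ≤ n := Nat.cast_nonneg n
    linarith
  have rlim : Tendsto r atTop (nhds 0) := tendsto_one_div_add_atTop_nhds_zero_nat
  let q : ℕ → ℝ × ℝ → ℝ := fun n p => diffQuot (r n) u p.1 p.2
  let q1 : ℕ → ℝ × ℝ → ℝ := fun n p => diffQuot (r n) u1 p.1 p.2
  let s : ℕ → ℝ × ℝ → ℝ := fun n p => quarticSlope (r n) u p.1 p.2
  have cq : ∀ n, Continuous (q n) := fun n => continuous_diffQuot c0 _
  have cq1 : ∀ n, Continuous (q1 n) := fun n => continuous_diffQuot c1 _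
  have cs : ∀ n, Continuous (s n) := by
    intro n
    have k1 : Continuous fun p : ℝ × ℝ => u p.1 (p.2 + r n) :=
      c0.comp (continuous_fst.prodMk (continuous_snd.add continuous_const))
    simp only [s, quarticSlope]
    fun_prop
  have lq : ∀ p, Tendsto (fun n => q n p) atTop (nhds (u1 p.1 p.2)) := fun p =>
    tendsto_diffQuot h.flow.d0 _ _
  have lq1 : ∀ p, Tendsto (fun n => q1 n p) atTop (nhds (u2 p.1 p.2)) := fun p =>
    tendsto_diffQuot h.flow.d1 _ _
  have ls : ∀ p, Tendsto (fun n => s n p) atTop (nhds (4 * u p.1 p.2 ^ 3)) := by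
    intro p
    have cu := h.cu p.1
    have ct : Continuous fun ε => quarticSlope ε u p.1 p.2 := by
      simp only [quarticSlope]; fun_prop
    have := (ct.tendsto 0).comp rlim
    have e : quarticSlope 0 u p.1 p.2 = 4 * u p.1 p.2 ^ 3 := by
      simp only [quarticSlope, add_zero]; ring
    rwa [e] at this
  have hae : ∀ᵐ p ∂(slab a b), p.1 ∈ Set.Icc a b := by
    rw [slab_eq_restrict]
    exact (ae_restrict_iff' (measurableSet_Icc.prod MeasurableSet.univ)).2
      (Eventually.of_forall fun p hp => hp.1)
  have iu1 := h.integrable_slab_deriv_sq hab hK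
  have iq : ∀ n, Integrable (fun p => q n p ^ 2) (slab a b) := fun n =>
    (h.integrable_slab_diffQuot_sq (r0 n).ne' hab hK).1
  have iqθ : ∀ n, Integrable (fun p : ℝ × ℝ => q1 n p ^ 2 * θ p.2) (slab a b) := by
    intro n
    have := cq1 n
    refine ((h.integrable_slab_diffQuot_deriv_sq (r n) hab hK).mul_const B).mono'
      (Continuous.aestronglyMeasurable (by fun_prop)) (Eventually.of_forall fun p => ?_)
    rw [norm_mul, norm_pow, norm_eq_abs, norm_eq_abs, sq_abs, abs_of_nonneg (θ0 _)]
    exact mul_le_mul_of_nonneg_left (θB _) (sq_nonneg _)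
  obtain ⟨iθ, hθD⟩ := integrable_of_frequently_integral_le (b := D)
    (F := fun n (p : ℝ × ℝ) => q1 n p ^ 2 * θ p.2)
    (fun n p => mul_nonneg (sq_nonneg _) (θ0 _)) iqθ
    (fun p => ((lq1 p).pow 2).mul_const _)
    (Eventually.of_forall fun n => hkato (r n) (r0 n).ne' (r1 n)).frequently
  have hθ0 : 0 ≤ ∫ p : ℝ × ℝ, u2 p.1 p.2 ^ 2 * θ p.2 ∂(slab a b) :=
    integral_nonneg fun p => mul_nonneg (sq_nonneg _) (θ0 _)
  have hZ : ∀ η : ℝ, 0 < η → ∀ n, ∀ᵐ p ∂(slab a b), |2 * (q1 n p * q n p * s n p)|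
      ≤ η * (q1 n p ^ 2 * θ p.2) + C / η * q n p ^ 2 := by
    intro η hη n
    filter_upwards [hae] with p hp
    exact abs_two_mul_le (θ0 _) C0 hη (hslope (r n) (r1 n) p.1 hp p.2)
  have iZ : ∀ n, Integrable (fun p => 2 * (q1 n p * q n p * s n p)) (slab a b) := by
    intro n
    have := cq n
    have := cq1 n
    have := cs n
    exact (((iqθ n).const_mul 1).add ((iq n).const_mul (C / 1))).mono'
      (Continuous.aestronglyMeasurable (by fun_prop)) (hZ 1 one_pos n)
  have hs0 : ∀ p : ℝ × ℝ, p.1 ∈ Set.Icc a b → (4 * u p.1 p.2 ^ 3) ^ 2 ≤ C * θ p.2 := fun p hp =>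
    le_of_tendsto ((ls p).pow 2) (Eventually.of_forall fun n => hslope (r n) (r1 n) p.1 hp p.2)
  have iZ0 : Integrable (fun p : ℝ × ℝ => 2 * (u2 p.1 p.2 * u1 p.1 p.2 * (4 * u p.1 p.2 ^ 3)))
      (slab a b) := by
    refine ((iθ.const_mul 1).add (iu1.const_mul (C / 1))).mono'
      (Continuous.aestronglyMeasurable (by fun_prop)) ?_
    filter_upwards [hae] with p hp
    exact abs_two_mul_le (θ0 _) C0 one_pos (hs0 p hp)
  refine ⟨iZ0, ?_⟩
  have hbal : ∀ n, (∫ x, diffQuot (r n) u b x ^ 2) - ∫ x, diffQuot (r n) u a x ^ 2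
      = ∫ p, 2 * (q1 n p * q n p * s n p) ∂(slab a b) := by
    intro n
    have := h.diffQuot_mass isWeight_one (B := 1) (r0 n).ne' hab (by simp) hK
    simp only [mul_one, mul_zero, sub_zero, add_zero, zero_add] at this
    rw [this]
    refine integral_congr_ae (Eventually.of_forall fun p => ?_)
    simp only [q, q1, s]
    ring
  set z := (∫ x, u1 b x ^ 2) - ∫ x, u1 a x ^ 2 with hz
  have hlim : Tendsto (fun n => ∫ p, 2 * (q1 n p * q n p * s n p) ∂(slab a b)) atTop (nhds z) :=
    ((h.tendsto_integral_diffQuot_sq b).sub (h.tendsto_integral_diffQuot_sq a)).congr hbal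
  -- the one-sided estimate, for both signs `σ = ±1`
  have side : ∀ σ : ℝ, |σ| = 1 → ∀ η : ℝ, 0 < η →
      σ * ∫ p : ℝ × ℝ, 2 * (u2 p.1 p.2 * u1 p.1 p.2 * (4 * u p.1 p.2 ^ 3)) ∂(slab a b)
        ≤ σ * z + η + η * D := by
    intro σ hσ η hη
    let W : ℕ → ℝ × ℝ → ℝ := fun n p => max 0 (σ * (2 * (q1 n p * q n p * s n p))
      + η * (q1 n p ^ 2 * θ p.2) + C / η * q n p ^ 2)
    have hW : ∀ n, W n =ᵐ[slab a b] fun p => σ * (2 * (q1 n p * q n p * s n p))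
      + η * (q1 n p ^ 2 * θ p.2) + C / η * q n p ^ 2 := by
      intro n
      filter_upwards [hZ η hη n] with p hp
      refine max_eq_right ?_
      have : |σ * (2 * (q1 n p * q n p * s n p))| ≤ η * (q1 n p ^ 2 * θ p.2) + C / η * q n p ^ 2 := by
        rw [abs_mul, hσ, one_mul]; exact hp
      linarith [neg_abs_le (σ * (2 * (q1 n p * q n p * s n p)))]
    have iV : ∀ n, Integrable (fun p => σ * (2 * (q1 n p * q n p * s n p))
      + η * (q1 n p ^ 2 * θ p.2) + C / η * q n p ^ 2) (slab a b) := fun n =>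
      (((iZ n).const_mul σ).add ((iqθ n).const_mul η)).add ((iq n).const_mul _)
    have hev : ∀ᶠ n in atTop, ∫ p, W n p ∂(slab a b)
        ≤ (σ * z + η) + η * D + C / η * ∫ p : ℝ × ℝ, u1 p.1 p.2 ^ 2 ∂(slab a b) := by
      have h1 : ∀ᶠ n in atTop, σ * (∫ p, 2 * (q1 n p * q n p * s n p) ∂(slab a b)) < σ * z + η :=
        (hlim.const_mul σ).eventually_lt_const (by linarith)
      filter_upwards [h1] with n hn
      have e : ∫ p, W n p ∂(slab a b) = σ * (∫ p, 2 * (q1 n p * q n p * s n p) ∂(slab a b))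
          + η * (∫ p, q1 n p ^ 2 * θ p.2 ∂(slab a b)) + C / η * ∫ p, q n p ^ 2 ∂(slab a b) := by
        rw [integral_congr_ae (hW n), integral_linear_combination (iZ n) (iqθ n) (iq n)]
      rw [e]
      have h2 := mul_le_mul_of_nonneg_left (hkato (r n) (r0 n).ne' (r1 n)) hη.le
      have h3 := mul_le_mul_of_nonneg_left
        (h.integrable_slab_diffQuot_sq (r0 n).ne' hab hK).2 (by positivity : 0 ≤ C / η)
      simp only [q, q1] at *
      linarith
    obtain ⟨-, hfat⟩ := integrable_of_frequently_integral_le (F := W)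
      (fun n p => le_max_left _ _) (fun n => (iV n).congr (hW n).symm)
      (fun p => tendsto_const_nhds.max
        ((((((lq1 p).mul (lq p)).mul (ls p)).const_mul 2).const_mul σ |>.add
        ((((lq1 p).pow 2).mul_const (θ p.2)).const_mul η)).add (((lq p).pow 2).const_mul (C / η))))
      hev.frequently
    have iV0 := ((iZ0.const_mul σ).add (iθ.const_mul η)).add (iu1.const_mul (C / η))
    have low : ∫ p : ℝ × ℝ, (σ * (2 * (u2 p.1 p.2 * u1 p.1 p.2 * (4 * u p.1 p.2 ^ 3)))
        + η * (u2 p.1 p.2 ^ 2 * θ p.2) + C / η * u1 p.1 p.2 ^ 2) ∂(slab a b)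
        ≤ ∫ p : ℝ × ℝ, max 0 (σ * (2 * (u2 p.1 p.2 * u1 p.1 p.2 * (4 * u p.1 p.2 ^ 3)))
        + η * (u2 p.1 p.2 ^ 2 * θ p.2) + C / η * u1 p.1 p.2 ^ 2) ∂(slab a b) :=
      integral_mono iV0 (by
        have := iV0.pos_part
        refine this.congr (Eventually.of_forall fun p => ?_)
        simp only [Pi.add_apply]
        rw [max_comm]) fun p => le_max_right _ _
    have e0 : ∫ p : ℝ × ℝ, (σ * (2 * (u2 p.1 p.2 * u1 p.1 p.2 * (4 * u p.1 p.2 ^ 3)))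
        + η * (u2 p.1 p.2 ^ 2 * θ p.2) + C / η * u1 p.1 p.2 ^ 2) ∂(slab a b)
        = σ * (∫ p : ℝ × ℝ, 2 * (u2 p.1 p.2 * u1 p.1 p.2 * (4 * u p.1 p.2 ^ 3)) ∂(slab a b))
          + η * (∫ p : ℝ × ℝ, u2 p.1 p.2 ^ 2 * θ p.2 ∂(slab a b))
          + C / η * ∫ p : ℝ × ℝ, u1 p.1 p.2 ^ 2 ∂(slab a b) :=
      integral_linear_combination iZ0 iθ iu1 _ _ _
    have h5 := mul_nonneg hη.le hθ0
    linarith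
  set Z := ∫ p : ℝ × ℝ, 2 * (u2 p.1 p.2 * u1 p.1 p.2 * (4 * u p.1 p.2 ^ 3)) ∂(slab a b) with hZdef
  have fin : ∀ x y : ℝ, (∀ η : ℝ, 0 < η → x ≤ y + η + η * D) → x ≤ y := by
    intro x y hxy
    by_contra hlt
    have hlt := not_le.1 hlt
    have := hxy ((x - y) / (2 * (1 + D))) (by apply div_pos <;> linarith)
    have e : (x - y) / (2 * (1 + D)) + (x - y) / (2 * (1 + D)) * D = (x - y) / 2 := by
      field_simp
    linarith
  have s1 := fin _ _ (side 1 (by simp))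
  have s2 := fin _ _ (side (-1) (by simp))
  linarith

/-- Balance of the potential energy on an interval where the `H¹` norm is bounded. -/
lemma potential_balance (h : IsSol u u1 u2 u3) {a b K : ℝ} (hab : a ≤ b)
    (hK : ∀ t ∈ Set.Icc a b, hNorm u u1 t ≤ K)
    (hi : Integrable (fun p : ℝ × ℝ => 2 * (u2 p.1 p.2 * u1 p.1 p.2 * (4 * u p.1 p.2 ^ 3)))
      (slab a b)) :
    (2 / 5) * (∫ x, u b x ^ 5) - (2 / 5) * ∫ x, u a x ^ 5
      = ∫ p : ℝ × ℝ, 2 * (u2 p.1 p.2 * u1 p.1 p.2 * (4 * u p.1 p.2 ^ 3)) ∂(slab a b) := by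
  obtain ⟨χ, χ1, χ2, χ3, C, hχ⟩ := exists_isCutoff
  have c0 := h.flow.c0
  have c1 := h.flow.c1
  have c2 := h.flow.c2
  have c3 := h.flow.c3
  have m0 := continuous_of_hasDerivAt hχ.d0
  have m1 := continuous_of_hasDerivAt hχ.d1
  have m2 := continuous_of_hasDerivAt hχ.d2
  have hC : 0 ≤ C := (abs_nonneg _).trans (hχ.bd 0).1
  have K0 : 0 ≤ K := (h.hNorm_nonneg a).trans (hK a ⟨le_rfl, hab⟩)
  let r : ℕ → ℝ := fun n => 1 / ((n : ℝ) + 1)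
  have r0 : ∀ n, 0 < r n := fun n => by positivity
  have r1 : ∀ n, r n ≤ 1 := fun n => by
    simp only [r]
    rw [div_le_one (by positivity)]
    have : (0 : ℝ) ≤ n := Nat.cast_nonneg n
    linarith
  have rlim : Tendsto r atTop (nhds 0) := tendsto_one_div_add_atTop_nhds_zero_nat
  have hd : ∀ {k k' : ℝ → ℝ} (_ : ∀ x, HasDerivAt k (k' x) x) (n : ℕ) (x : ℝ),
      HasDerivAt (fun x => k (x * r n)) (k' (x * r n) * r n) x := by
    intro k k' h n x
    have := (h (x * r n)).comp x ((hasDerivAt_id x).mul_const (r n))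
    exact this.congr_deriv (by simp)
  have hχl : ∀ {k : ℝ → ℝ} (_ : Continuous k) (x : ℝ),
      Tendsto (fun n => k (x * r n)) atTop (nhds (k 0)) := by
    intro k hk x
    have : Tendsto (fun n => k (x * r n)) atTop (nhds (k (x * 0))) :=
      (hk.tendsto _).comp (rlim.const_mul x)
    rwa [mul_zero] at this
  have hχ0 : χ 0 = 1 := hχ.eq_one 0 (by simp)
  have bal : ∀ n, (∫ x, 2 / 5 * u b x ^ 5 * χ (x * r n)) - ∫ x, 2 / 5 * u a x ^ 5 * χ (x * r n)
      = ∫ p : ℝ × ℝ, (2 * (u2 p.1 p.2 * u1 p.1 p.2 * (4 * u p.1 p.2 ^ 3)) * χ (p.2 * r n)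
        - 8 * r n * (u p.1 p.2 ^ 3 * u1 p.1 p.2 ^ 2 * χ1 (p.2 * r n))
        - 2 * r n ^ 2 * (u p.1 p.2 ^ 4 * u1 p.1 p.2 * χ2 (p.2 * r n))
        + r n * (u p.1 p.2 ^ 8 * χ1 (p.2 * r n))) ∂(slab a b) := by
    intro n
    refine integral_sub_eq_integral_slab (R := 2 / r n)
      (A := fun t x => 2 / 5 * u t x ^ 5 * χ (x * r n))
      (At := fun t x => -(2 * u t x ^ 4 * χ (x * r n) * (u3 t x + 4 * u t x ^ 3 * u1 t x)))
      (Ξ := fun t x => -(2 * u t x ^ 4 * u2 t x * χ (x * r n))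
        + 2 * r n * (u t x ^ 4 * u1 t x * χ1 (x * r n)) - u t x ^ 8 * χ (x * r n))
      (Ξx := fun t x => -(2 * u t x ^ 4 * χ (x * r n) * (u3 t x + 4 * u t x ^ 3 * u1 t x))
        - (2 * (u2 t x * u1 t x * (4 * u t x ^ 3)) * χ (x * r n)
        - 8 * r n * (u t x ^ 3 * u1 t x ^ 2 * χ1 (x * r n))
        - 2 * r n ^ 2 * (u t x ^ 4 * u1 t x * χ2 (x * r n))
        + r n * (u t x ^ 8 * χ1 (x * r n))))
      (Θ := fun t x => 2 * (u2 t x * u1 t x * (4 * u t x ^ 3)) * χ (x * r n)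
        - 8 * r n * (u t x ^ 3 * u1 t x ^ 2 * χ1 (x * r n))
        - 2 * r n ^ 2 * (u t x ^ 4 * u1 t x * χ2 (x * r n))
        + r n * (u t x ^ 8 * χ1 (x * r n))) hab ?_ ?_ ?_ ?_ ?_ ?_ ?_ ?_ ?_
    · intro t x
      exact ((((h.flow.dt t x).pow 5).const_mul (2 / 5)).mul_const _).congr_deriv
        (by norm_num; ring)
    · intro t x
      have h0 := h.flow.d0 t x
      have h1 := h.flow.d1 t x
      have h2 := h.flow.d2 t x
      have e0 := hd hχ.d0 n x
      have e1 := hd hχ.d1 n x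
      have := (((((h0.pow 4).const_mul 2).mul h2).mul e0).neg.add
        ((((h0.pow 4).mul h1).mul e1).const_mul (2 * r n))).sub ((h0.pow 8).mul e0)
      exact this.congr_deriv (by norm_num; ring)
    · intro t x; ring
    · simp only [Function.uncurry_def]; fun_prop
    · simp only [Function.uncurry_def]; fun_prop
    · simp only [Function.uncurry_def]; fun_prop
    all_goals
      intro t x hx
      obtain ⟨z0, z1, z2, z3⟩ := hχ.eq_zero (x * r n) (by
        rw [abs_mul, abs_of_pos (r0 n)]
        exact (div_le_iff₀ (r0 n)).1 hx)
      simp [z0, z1, z2]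
  have lhs : ∀ t, Tendsto (fun n => ∫ x, 2 / 5 * u t x ^ 5 * χ (x * r n)) atTop
      (nhds (2 / 5 * ∫ x, u t x ^ 5)) := by
    intro t
    have cu := h.cu t
    rw [← integral_const_mul]
    refine tendsto_integral_of_dominated_convergence (fun x => ‖2 / 5 * u t x ^ 5‖ * C)
      (fun n => Continuous.aestronglyMeasurable (by fun_prop))
      ((((h.integrable_pow t 3).const_mul _).norm).mul_const _)
      (fun n => Eventually.of_forall fun x => ?_) (Eventually.of_forall fun x => ?_)
    · rw [norm_mul]; exact mul_le_mul_of_nonneg_left (hχ.bd _).1 (norm_nonneg _)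
    · have := (hχl m0 x).const_mul (2 / 5 * u t x ^ 5)
      rwa [hχ0, mul_one] at this
  have hae : ∀ᵐ p ∂(slab a b), p.1 ∈ Set.Icc a b := by
    rw [slab_eq_restrict]
    exact (ae_restrict_iff' (measurableSet_Icc.prod MeasurableSet.univ)).2
      (Eventually.of_forall fun p hp => hp.1)
  have j1 := h.integrable_slab_deriv_sq hab hK
  have j8 := h.integrable_slab_pow_eight hab hK
  have rhs : Tendsto (fun n => ∫ p : ℝ × ℝ,
        (2 * (u2 p.1 p.2 * u1 p.1 p.2 * (4 * u p.1 p.2 ^ 3)) * χ (p.2 * r n)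
        - 8 * r n * (u p.1 p.2 ^ 3 * u1 p.1 p.2 ^ 2 * χ1 (p.2 * r n))
        - 2 * r n ^ 2 * (u p.1 p.2 ^ 4 * u1 p.1 p.2 * χ2 (p.2 * r n))
        + r n * (u p.1 p.2 ^ 8 * χ1 (p.2 * r n))) ∂(slab a b)) atTop
      (nhds (∫ p : ℝ × ℝ, 2 * (u2 p.1 p.2 * u1 p.1 p.2 * (4 * u p.1 p.2 ^ 3)) ∂(slab a b))) := by
    refine tendsto_integral_of_dominated_convergence
      (fun p => C * ‖2 * (u2 p.1 p.2 * u1 p.1 p.2 * (4 * u p.1 p.2 ^ 3))‖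
        + (C * (8 * (1 + K ^ 2) + 1) * u1 p.1 p.2 ^ 2 + 2 * C * (u p.1 p.2 ^ 4) ^ 2))
      (fun n => Continuous.aestronglyMeasurable (by fun_prop))
      ((hi.norm.const_mul C).add ((j1.const_mul _).add (j8.const_mul _)))
      (fun n => ?_) (Eventually.of_forall fun p => ?_)
    · filter_upwards [hae] with p hp
      have hv : u p.1 p.2 ^ 2 ≤ K := (h.sq_le_hNorm _ _).trans (hK _ hp)
      obtain ⟨e0, e1, e2, -⟩ := hχ.bd (p.2 * r n)
      have rn0 := (r0 n).le
      have rn1 := r1 n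
      rw [norm_eq_abs, norm_eq_abs]
      generalize 2 * (u2 p.1 p.2 * u1 p.1 p.2 * (4 * u p.1 p.2 ^ 3)) = y at *
      generalize u p.1 p.2 = z at *
      generalize u1 p.1 p.2 = z1 at *
      generalize χ (p.2 * r n) = k0 at *
      generalize χ1 (p.2 * r n) = k1 at *
      generalize χ2 (p.2 * r n) = k2 at *
      generalize r n = ρ at *
      have z3 : |z ^ 3| ≤ 1 + K ^ 2 := by
        have : (z ^ 2) ^ 2 ≤ K ^ 2 := pow_le_pow_left₀ (sq_nonneg _) hv 2
        rw [abs_le]; constructor <;>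
        nlinarith [sq_nonneg (z ^ 2 - z), sq_nonneg (z ^ 2 + z), sq_nonneg (z - 1),
          sq_nonneg (z + 1), sq_nonneg (z ^ 2 - 1)]
      have a1 : |y * k0| ≤ C * |y| := by
        rw [abs_mul, mul_comm]; exact mul_le_mul_of_nonneg_right e0 (abs_nonneg _)
      have a2 : |8 * ρ * (z ^ 3 * z1 ^ 2 * k1)| ≤ C * (8 * (1 + K ^ 2)) * z1 ^ 2 := by
        rw [abs_mul, abs_of_nonneg (by positivity : 0 ≤ 8 * ρ), abs_mul, abs_mul,
          abs_of_nonneg (sq_nonneg z1)]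
        calc 8 * ρ * (|z ^ 3| * z1 ^ 2 * |k1|) ≤ 8 * 1 * ((1 + K ^ 2) * z1 ^ 2 * C) := by gcongr
          _ = _ := by ring
      have a3 : |2 * ρ ^ 2 * (z ^ 4 * z1 * k2)| ≤ C * (z1 ^ 2 + (z ^ 4) ^ 2) := by
        have : |2 * (z ^ 4 * z1)| ≤ z1 ^ 2 + (z ^ 4) ^ 2 := by
          rw [abs_le]; constructor <;> nlinarith [sq_nonneg (z1 - z ^ 4), sq_nonneg (z1 + z ^ 4)]
        calc |2 * ρ ^ 2 * (z ^ 4 * z1 * k2)| = ρ ^ 2 * |k2| * |2 * (z ^ 4 * z1)| := by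
              rw [← abs_of_nonneg (sq_nonneg ρ), ← abs_mul, ← abs_mul, abs_of_nonneg (sq_nonneg ρ)]
              congr 1; ring
          _ ≤ 1 ^ 2 * C * (z1 ^ 2 + (z ^ 4) ^ 2) := by gcongr
          _ = _ := by ring
      have a4 : |ρ * (z ^ 8 * k1)| ≤ C * (z ^ 4) ^ 2 := by
        have e : |ρ * (z ^ 8 * k1)| = ρ * ((z ^ 4) ^ 2 * |k1|) := by
          rw [abs_mul, abs_mul, abs_of_nonneg rn0, show z ^ 8 = (z ^ 4) ^ 2 by ring,
            abs_of_nonneg (sq_nonneg (z ^ 4))]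
        rw [e]
        calc ρ * ((z ^ 4) ^ 2 * |k1|) ≤ 1 * ((z ^ 4) ^ 2 * C) := by gcongr
          _ = _ := by ring
      rw [abs_le] at a1 a2 a3 a4 ⊢
      constructor <;> nlinarith
    · have := (((hχl m0 p.2).const_mul
        (2 * (u2 p.1 p.2 * u1 p.1 p.2 * (4 * u p.1 p.2 ^ 3)))).sub
        ((rlim.const_mul 8).mul ((hχl m1 p.2).const_mul (u p.1 p.2 ^ 3 * u1 p.1 p.2 ^ 2)))).sub
        (((rlim.pow 2).const_mul 2).mul ((hχl m2 p.2).const_mul (u p.1 p.2 ^ 4 * u1 p.1 p.2)))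
        |>.add (rlim.mul ((hχl m1 p.2).const_mul (u p.1 p.2 ^ 8)))
      simpa [hχ0] using this
  exact tendsto_nhds_unique (((lhs b).sub (lhs a)).congr bal) rhs

/-- Energy conservation on an interval where the `H¹` norm is bounded. -/
lemma energy_eq_of_bounded (h : IsSol u u1 u2 u3) {a b K : ℝ} (hab : a ≤ b)
    (hK : ∀ t ∈ Set.Icc a b, hNorm u u1 t ≤ K) : energy u u1 b = energy u u1 a := by
  obtain ⟨hi, h1⟩ := h.deriv_balance hab hK
  have h2 := h.potential_balance hab hK hi
  unfold energy
  linarith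

end IsSol

namespace IsSol

variable {u u1 u2 u3 : ℝ → ℝ → ℝ}

lemma abs_cube_le {v δ : ℝ} (hδ : 0 < δ) : |v| ^ 3 ≤ δ * v ^ 4 + δ⁻¹ ^ 3 := by
  have hv := abs_nonneg v
  have e : v ^ 4 = |v| ^ 4 := by rw [← abs_pow, abs_of_nonneg (by positivity)]
  rw [e]
  rcases le_total (|v|) δ⁻¹ with h | h
  · have := pow_le_pow_left₀ hv h 3
    have : 0 ≤ δ * |v| ^ 4 := by positivity
    linarith
  · have : 1 ≤ δ * |v| := by
      have := mul_le_mul_of_nonneg_left h hδ.le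
      rwa [mul_inv_cancel₀ hδ.ne'] at this
    have h2 := mul_le_mul_of_nonneg_right this (by positivity : 0 ≤ |v| ^ 3)
    have : 0 ≤ δ⁻¹ ^ 3 := by positivity
    nlinarith

/-- A bound on `|u|³` yields a bound on the potential energy. -/
lemma abs_integral_pow_five_le (h : IsSol u u1 u2 u3) {t L : ℝ} (hL : ∀ x, |u t x| ^ 3 ≤ L) :
    |∫ x, u t x ^ 5| ≤ L * ∫ x, u t x ^ 2 := by
  rw [← integral_const_mul, ← norm_eq_abs]
  refine (norm_integral_le_integral_norm _).trans (integral_mono (h.integrable_pow t 3).norm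
    ((h.i0 t).const_mul _) fun x => ?_)
  have : ‖u t x ^ 5‖ = |u t x| ^ 3 * u t x ^ 2 := by
    rw [norm_eq_abs, abs_pow, ← sq_abs]; ring
  simp only [this]
  exact mul_le_mul_of_nonneg_right (hL x) (sq_nonneg _)

lemma energy_le (h : IsSol u u1 u2 u3) {t K : ℝ} (hK : hNorm u u1 t ≤ K) :
    energy u u1 t ≤ K + (K ^ 2 + 1) * K := by
  have h0 := h.hNorm_nonneg t
  have h1 := h.mass_le t
  have h2 := h.deriv_le t
  have h5 := h.abs_integral_pow_five_le (t := t) (L := K ^ 2 + 1) fun x => by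
    have := abs_cube_le (v := u t x) one_pos
    have h4 : (u t x ^ 2) ^ 2 ≤ K ^ 2 :=
      pow_le_pow_left₀ (sq_nonneg _) ((h.sq_le_hNorm t x).trans hK) 2
    norm_num at this
    nlinarith
  have := mul_le_mul_of_nonneg_left (h1.trans hK) (by positivity : 0 ≤ K ^ 2 + 1)
  unfold energy
  have := neg_abs_le (∫ x, u t x ^ 5)
  nlinarith

/-- Control of the `H¹` norm by mass and energy. -/
lemma hNorm_le (h : IsSol u u1 u2 u3) (t : ℝ) :
    hNorm u u1 t ≤ (∫ x, u t x ^ 2) + 10 / 3 * (energy u u1 t +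
      (∫ x, u t x ^ 2) * (4 * (∫ x, u t x ^ 2) ^ 2 + 1) ^ 3) := by
  rw [h.hNorm_eq]
  unfold energy
  set m := ∫ x, u t x ^ 2
  set y := ∫ x, u1 t x ^ 2
  have m0 : 0 ≤ m := integral_nonneg fun x => sq_nonneg _
  have y0 : 0 ≤ y := integral_nonneg fun x => sq_nonneg _
  have h4 : ∀ x, u t x ^ 4 ≤ 4 * m * y := fun x => by
    have := sq_le_of_forall_le (sq_nonneg (u t x)) y0 m0
      fun l hl => sq_le_integral_sq (h.flow.d0 t) (h.cu1 t) (h.i0 t) (h.i1 t) hl x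
    nlinarith
  have hδ : 0 < (4 * m ^ 2 + 1)⁻¹ := by positivity
  have h5 := h.abs_integral_pow_five_le (t := t)
    (L := (4 * m ^ 2 + 1)⁻¹ * (4 * m * y) + (4 * m ^ 2 + 1) ^ 3) fun x => by
    have := abs_cube_le (v := u t x) hδ
    rw [inv_inv] at this
    have := mul_le_mul_of_nonneg_left (h4 x) hδ.le
    linarith
  have h6 : (4 * m ^ 2 + 1)⁻¹ * (4 * m * y) * m ≤ y := by
    rw [inv_mul_eq_div, div_mul_eq_mul_div, div_le_iff₀ (by positivity)]
    nlinarith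
  have := le_abs_self (∫ x, u t x ^ 5)
  have h7 : 0 ≤ m * (4 * m ^ 2 + 1) ^ 3 := by positivity
  rw [add_mul] at h5
  linarith

lemma isClosed_hNorm_le (h : IsSol u u1 u2 u3) (K : ℝ) : IsClosed {t | hNorm u u1 t ≤ K} := by
  refine IsSeqClosed.isClosed fun s t hs ht => ?_
  have c0 := h.flow.c0
  have c1 := h.flow.c1
  have lim : ∀ {v : ℝ → ℝ → ℝ} (_ : Continuous fun p : ℝ × ℝ => v p.1 p.2) (x : ℝ),
      Tendsto (fun n => v (s n) x) atTop (nhds (v t x)) := fun {v} hv x => by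
    have : Continuous fun τ => v τ x := hv.comp (continuous_id.prodMk continuous_const)
    exact (this.tendsto t).comp ht
  exact (integrable_of_frequently_integral_le (b := K)
    (F := fun n x => u (s n) x ^ 2 + u1 (s n) x ^ 2)
    (fun n x => by positivity) (fun n => (h.i0 _).add (h.i1 _))
    (fun x => ((lim c0 x).pow 2).add ((lim c1 x).pow 2))
    (Eventually.of_forall fun n => hs n).frequently).2

/-- Mass and energy at the two ends of an interval in whose interior the `H¹` norm is locally
bounded. -/
lemma conserved_of_locally_bounded (h : IsSol u u1 u2 u3) {a b : ℝ} (hab : a < b)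
    (hG : ∀ t ∈ Set.Ioo a b, ∃ K, ∀ᶠ s in nhds t, hNorm u u1 s ≤ K) :
    (∫ x, u b x ^ 2) = (∫ x, u a x ^ 2) ∧ energy u u1 b = energy u u1 a := by
  have bdd : ∀ p q, a < p → p ≤ q → q < b → ∃ K, ∀ t ∈ Set.Icc p q, hNorm u u1 t ≤ K := by
    intro p q hp hpq hq
    refine isCompact_Icc.induction_on (p := fun s => ∃ K, ∀ t ∈ s, hNorm u u1 t ≤ K)
      ⟨0, by simp⟩ (fun s t hst ⟨K, hK⟩ => ⟨K, fun x hx => hK x (hst hx)⟩)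
      (fun s t ⟨K, hK⟩ ⟨L, hL⟩ => ⟨max K L, fun x hx => ?_⟩) fun x hx => ?_
    · rcases hx with hx | hx
      · exact (hK x hx).trans (le_max_left _ _)
      · exact (hL x hx).trans (le_max_right _ _)
    · obtain ⟨K, hK⟩ := hG x ⟨hp.trans_le hx.1, hx.2.trans_lt hq⟩
      exact ⟨{s | hNorm u u1 s ≤ K}, mem_nhdsWithin_of_mem_nhds hK, K, fun t ht => ht⟩
  obtain ⟨m, ham, hmb⟩ := exists_between hab
  have cons : ∀ t ∈ Set.Ioo a b,
      (∫ x, u t x ^ 2) = (∫ x, u m x ^ 2) ∧ energy u u1 t = energy u u1 m := by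
    intro t ht
    rcases le_total t m with htm | htm
    · obtain ⟨K, hK⟩ := bdd t m ht.1 htm hmb
      exact ⟨(h.mass_eq_of_bounded htm hK).symm, (h.energy_eq_of_bounded htm hK).symm⟩
    · obtain ⟨K, hK⟩ := bdd m t ham htm ht.2
      exact ⟨h.mass_eq_of_bounded htm hK, h.energy_eq_of_bounded htm hK⟩
  obtain ⟨K, hK⟩ : ∃ K, ∀ t ∈ Set.Icc a b, hNorm u u1 t ≤ K := by
    refine ⟨max (max (hNorm u u1 a) (hNorm u u1 b)) ((∫ x, u m x ^ 2) + 10 / 3 * (energy u u1 m +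
      (∫ x, u m x ^ 2) * (4 * (∫ x, u m x ^ 2) ^ 2 + 1) ^ 3)), fun t ht => ?_⟩
    rcases ht.1.eq_or_lt with rfl | h1
    · exact (le_max_left _ _).trans (le_max_left _ _)
    rcases ht.2.eq_or_lt with rfl | h2
    · exact (le_max_right _ _).trans (le_max_left _ _)
    have := h.hNorm_le t
    rw [(cons t ⟨h1, h2⟩).1, (cons t ⟨h1, h2⟩).2] at this
    exact this.trans (le_max_right _ _)
  exact ⟨h.mass_eq_of_bounded hab.le hK, h.energy_eq_of_bounded hab.le hK⟩

lemma locally_bounded (h : IsSol u u1 u2 u3) (t : ℝ) :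
    ∃ K, ∀ᶠ s in nhds t, hNorm u u1 s ≤ K := by
  set G : Set ℝ := {t | ∃ K, ∀ᶠ s in nhds t, hNorm u u1 s ≤ K} with hGdef
  have hGo : IsOpen G := by
    rw [isOpen_iff_mem_nhds]
    rintro t ⟨K, hK⟩
    filter_upwards [eventually_eventually_nhds.2 hK] with s hs using ⟨K, hs⟩
  by_contra ht
  have ht : t ∈ Gᶜ := ht
  have hF : IsClosed Gᶜ := hGo.isClosed_compl
  have : CompleteSpace (Gᶜ : Set ℝ) := hF.completeSpace_coe
  have : Nonempty (Gᶜ : Set ℝ) := ⟨⟨t, ht⟩⟩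
  obtain ⟨n, ⟨p, hp⟩, hpn⟩ := nonempty_interior_of_iUnion_of_closed
    (f := fun n : ℕ => {s : (Gᶜ : Set ℝ) | hNorm u u1 s ≤ n})
    (fun n => (h.isClosed_hNorm_le n).preimage continuous_subtype_val) (by
      refine Set.eq_univ_of_forall fun s => ?_
      obtain ⟨n, hn⟩ := exists_nat_ge (hNorm u u1 s)
      exact Set.mem_iUnion.2 ⟨n, hn⟩)
  rw [mem_interior_iff_mem_nhds, Metric.mem_nhds_iff] at hpn
  obtain ⟨δ, δ0, hδ⟩ := hpn
  have hn : ∀ s ∈ Gᶜ, |s - p| < δ → hNorm u u1 s ≤ n := fun s hs hsp =>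
    hδ (a := ⟨s, hs⟩) (by rwa [Metric.mem_ball, Subtype.dist_eq, Real.dist_eq])
  set k : ℝ := (n : ℝ)
  set L : ℝ := k + 10 / 3 * ((k + (k ^ 2 + 1) * k) + k * (4 * k ^ 2 + 1) ^ 3)
  have k0 : 0 ≤ k := Nat.cast_nonneg n
  have step : ∀ a ∈ Gᶜ, |a - p| < δ → ∀ s, (∫ x, u s x ^ 2) = (∫ x, u a x ^ 2) →
      energy u u1 s = energy u u1 a → hNorm u u1 s ≤ L := by
    intro a ha hap s hm he
    have h1 := h.hNorm_le s
    rw [hm, he] at h1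
    have h2 := h.energy_le (hn a ha hap)
    have h3 := (h.mass_le a).trans (hn a ha hap)
    have m0 : 0 ≤ ∫ x, u a x ^ 2 := integral_nonneg fun x => sq_nonneg _
    refine h1.trans ?_
    simp only [L]
    gcongr
  refine hp ⟨max k L, Metric.eventually_nhds_iff.2 ⟨δ, δ0, fun s hs => ?_⟩⟩
  rw [Real.dist_eq] at hs
  by_cases hsF : s ∈ Gᶜ
  · exact (hn s hsF hs).trans (le_max_left _ _)
  refine le_max_of_le_right ?_
  have hsp : s ≠ p := fun e => hsF (e ▸ hp)
  rcases lt_or_gt_of_ne hsp with hlt | hlt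
  · obtain ⟨a, ⟨haF, ha⟩, hmin⟩ := (isCompact_Icc.inter_left hF : IsCompact (Gᶜ ∩ Set.Icc s p))
      |>.exists_isLeast ⟨p, hp, hlt.le, le_rfl⟩
    have hsa : s < a := lt_of_le_of_ne ha.1 fun e => hsF (e ▸ haF)
    have := h.conserved_of_locally_bounded hsa fun t ht => by
      by_contra hc
      exact absurd (hmin ⟨hc, ht.1.le, ht.2.le.trans ha.2⟩) (not_le.2 ht.2)
    refine step a haF (lt_of_le_of_lt ?_ hs) s this.1.symm this.2.symm
    rw [abs_of_nonpos (by linarith [ha.2]), abs_of_neg (by linarith)]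
    linarith
  · obtain ⟨a, ⟨haF, ha⟩, hmax⟩ := (isCompact_Icc.inter_left hF : IsCompact (Gᶜ ∩ Set.Icc p s))
      |>.exists_isGreatest ⟨p, hp, le_rfl, hlt.le⟩
    have hsa : a < s := lt_of_le_of_ne ha.2 fun e => hsF (e ▸ haF)
    have := h.conserved_of_locally_bounded hsa fun t ht => by
      by_contra hc
      exact absurd (hmax ⟨hc, ha.1.trans ht.1.le, ht.2.le⟩) (not_le.2 ht.1)
    refine step a haF (lt_of_le_of_lt ?_ hs) s this.1 this.2
    rw [abs_of_nonneg (by linarith [ha.1]), abs_of_pos (by linarith)]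
    linarith

/-- Conservation of mass and energy. -/
lemma conserved (h : IsSol u u1 u2 u3) (a b : ℝ) :
    (∫ x, u b x ^ 2) = (∫ x, u a x ^ 2) ∧ energy u u1 b = energy u u1 a := by
  rcases lt_trichotomy a b with hab | rfl | hab
  · exact h.conserved_of_locally_bounded hab fun t _ => h.locally_bounded t
  · exact ⟨rfl, rfl⟩
  · have := h.conserved_of_locally_bounded hab fun t _ => h.locally_bounded t
    exact ⟨this.1.symm, this.2.symm⟩

lemma exists_bound (h : IsSol u u1 u2 u3) : ∃ K, ∀ t, hNorm u u1 t ≤ K := by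
  refine ⟨(∫ x, u 0 x ^ 2) + 10 / 3 * (energy u u1 0 +
      (∫ x, u 0 x ^ 2) * (4 * (∫ x, u 0 x ^ 2) ^ 2 + 1) ^ 3), fun t => ?_⟩
  rw [← (h.conserved 0 t).1, ← (h.conserved 0 t).2]
  exact h.hNorm_le t

end IsSol

lemma Q_pos (x : ℝ) : 0 < Q x := by
  have := cosh_pos (3 * x / 2)
  unfold Q; positivity

lemma Q_cube (x : ℝ) : Q x ^ 3 = 5 / (2 * cosh (3 * x / 2) ^ 2) := by
  have := cosh_pos (3 * x / 2)
  rw [Q, ← rpow_natCast, ← rpow_mul (by positivity)]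
  norm_num

lemma Q_neg (x : ℝ) : Q (-x) = Q x := by
  rw [Q, Q, show 3 * -x / 2 = -(3 * x / 2) by ring, cosh_neg]

/-- The derivative of the ground state. -/
noncomputable def Q1 (x : ℝ) : ℝ := -(Q x * (sinh (3 * x / 2) / cosh (3 * x / 2)))

lemma hasDerivAt_Q (x : ℝ) : HasDerivAt Q (Q1 x) x := by
  have hc := cosh_pos (3 * x / 2)
  have h1 : HasDerivAt (fun x : ℝ => 3 * x / 2) (3 / 2) x := by
    simpa using ((hasDerivAt_id x).const_mul 3).div_const 2
  have h2 : HasDerivAt (fun x : ℝ => 5 / (2 * cosh (3 * x / 2) ^ 2))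
      (-(3 * (sinh (3 * x / 2) / cosh (3 * x / 2))) * (5 / (2 * cosh (3 * x / 2) ^ 2))) x := by
    have := (hasDerivAt_const x (5 : ℝ)).div ((h1.cosh.pow 2).const_mul 2)
      (mul_pos two_pos (pow_pos hc 2)).ne'
    refine this.congr_deriv ?_
    simp only [Pi.pow_apply, Nat.cast_ofNat, Nat.add_one_sub_one, pow_one]
    field_simp
    ring
  have h3 := h2.rpow_const (p := 1 / 3) (Or.inl (by positivity))
  refine h3.congr_deriv ?_
  rw [rpow_sub_one (by positivity), Q1, Q]
  field_simp

lemma Q1_sq (x : ℝ) : Q1 x ^ 2 = Q x ^ 2 - 2 / 5 * Q x ^ 5 := by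
  have hc := cosh_pos (3 * x / 2)
  have h := cosh_sq (3 * x / 2)
  have e : Q x ^ 5 = Q x ^ 2 * Q x ^ 3 := by ring
  rw [e, Q_cube, Q1]
  field_simp
  rw [h]; ring

lemma hasDerivAt_Q1 (x : ℝ) : HasDerivAt Q1 (Q x - Q x ^ 4) x := by
  have hc := cosh_pos (3 * x / 2)
  have h1 : HasDerivAt (fun x : ℝ => 3 * x / 2) (3 / 2) x := by
    simpa using ((hasDerivAt_id x).const_mul 3).div_const 2
  refine ((hasDerivAt_Q x).mul (h1.sinh.div h1.cosh hc.ne')).neg.congr_deriv ?_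
  have h := cosh_sq (3 * x / 2)
  have e : Q x ^ 4 = Q x * Q x ^ 3 := by ring
  rw [e, Q_cube, Q1]
  simp only [Pi.div_apply]
  field_simp
  rw [h]; ring

lemma continuous_Q : Continuous Q := continuous_of_hasDerivAt hasDerivAt_Q

lemma continuous_Q1 : Continuous Q1 := continuous_of_hasDerivAt hasDerivAt_Q1

lemma Q_le_exp (x : ℝ) : Q x ≤ 3 * exp (-|x|) := by
  have h : Q x ^ 3 ≤ (3 * exp (-|x|)) ^ 3 := by
    have hc : exp (3 * |x| / 2) ≤ 2 * cosh (3 * x / 2) := by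
      rw [← cosh_abs, show |3 * x / 2| = 3 * |x| / 2 by rw [abs_div, abs_mul]; norm_num, cosh_eq]
      linarith [exp_pos (-(3 * |x| / 2))]
    have h2 := pow_le_pow_left₀ (exp_pos _).le hc 2
    rw [← exp_nat_mul] at h2
    have h3 : (3 * exp (-|x|)) ^ 3 = 27 / exp (3 * |x|) := by
      rw [mul_pow, ← exp_nat_mul, show ((3 : ℕ) : ℝ) * -|x| = -(3 * |x|) by push_cast; ring,
        exp_neg]
      norm_num [div_eq_mul_inv]
    rw [show ((2 : ℕ) : ℝ) * (3 * |x| / 2) = 3 * |x| by push_cast; ring] at h2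
    have := cosh_pos (3 * x / 2)
    rw [Q_cube, h3, div_le_div_iff₀ (by positivity) (exp_pos _)]
    nlinarith
  exact le_of_pow_le_pow_left₀ (by norm_num) (by positivity) h

lemma abs_Q1_le (x : ℝ) : |Q1 x| ≤ 3 * exp (-|x|) := by
  have h := Q_pos x
  refine (abs_le_of_sq_le_sq ?_ h.le).trans (Q_le_exp x)
  rw [Q1_sq]
  have : 0 ≤ Q x ^ 5 := by positivity
  linarith

lemma integrable_exp_neg_mul_abs {κ : ℝ} (hκ : 0 < κ) : Integrable fun x : ℝ => exp (-(κ * |x|)) := by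
  rw [← integrableOn_univ, ← Set.Iic_union_Ioi (a := (0 : ℝ))]
  refine IntegrableOn.union ?_ ?_
  · exact (integrableOn_exp_mul_Iic hκ 0).congr_fun (fun x hx => by
      simp only
      rw [abs_of_nonpos hx]; ring_nf) measurableSet_Iic
  · exact (integrableOn_exp_mul_Ioi (neg_lt_zero.2 hκ) 0).congr_fun (fun x hx => by
      simp only
      rw [abs_of_pos hx]; ring_nf) measurableSet_Ioi

/-- The solitary wave of speed `a ^ 6`. -/
noncomputable def wave (a x : ℝ) : ℝ := a ^ 2 * Q (a ^ 3 * x)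

/-- The derivative of the solitary wave. -/
noncomputable def wave1 (a x : ℝ) : ℝ := a ^ 5 * Q1 (a ^ 3 * x)

lemma Qc_eq_wave {c : ℝ} (hc : 0 < c) (x : ℝ) : Qc c x = wave (c ^ ((1 : ℝ) / 6)) x := by
  rw [Qc, wave, sqrt_eq_rpow, ← rpow_natCast, ← rpow_natCast, ← rpow_mul hc.le, ← rpow_mul hc.le]
  norm_num

lemma hasDerivAt_comp_mul {f f' : ℝ → ℝ} (hf : ∀ x, HasDerivAt f (f' x) x) (k x : ℝ) :
    HasDerivAt (fun x => f (k * x)) (k * f' (k * x)) x :=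
  ((hf (k * x)).comp x ((hasDerivAt_id x).const_mul k)).congr_deriv (by ring)

lemma hasDerivAt_wave (a x : ℝ) : HasDerivAt (wave a) (wave1 a x) x :=
  ((hasDerivAt_comp_mul hasDerivAt_Q (a ^ 3) x).const_mul (a ^ 2)).congr_deriv
    (by rw [wave1]; ring)

lemma hasDerivAt_wave1 (a x : ℝ) : HasDerivAt (wave1 a) (a ^ 6 * wave a x - wave a x ^ 4) x :=
  ((hasDerivAt_comp_mul hasDerivAt_Q1 (a ^ 3) x).const_mul (a ^ 5)).congr_deriv
    (by rw [wave]; ring)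

lemma continuous_wave (a : ℝ) : Continuous (wave a) := continuous_of_hasDerivAt (hasDerivAt_wave a)

lemma continuous_wave1 (a : ℝ) : Continuous (wave1 a) :=
  continuous_of_hasDerivAt (hasDerivAt_wave1 a)

lemma abs_wave_le {a : ℝ} (ha : 0 < a) (x : ℝ) :
    |wave a x| ≤ 3 * a ^ 2 * exp (-(a ^ 3 * |x|)) := by
  rw [wave, abs_of_pos (mul_pos (by positivity) (Q_pos _))]
  have := Q_le_exp (a ^ 3 * x)
  rw [abs_mul, abs_of_pos (by positivity : 0 < a ^ 3)] at this
  have := mul_le_mul_of_nonneg_left this (by positivity : 0 ≤ a ^ 2)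
  linarith

lemma abs_wave1_le {a : ℝ} (ha : 0 < a) (x : ℝ) :
    |wave1 a x| ≤ 3 * a ^ 5 * exp (-(a ^ 3 * |x|)) := by
  rw [wave1, abs_mul, abs_of_pos (by positivity : 0 < a ^ 5)]
  have := abs_Q1_le (a ^ 3 * x)
  rw [abs_mul, abs_of_pos (by positivity : 0 < a ^ 3)] at this
  have := mul_le_mul_of_nonneg_left this (by positivity : 0 ≤ a ^ 5)
  linarith

lemma integrable_Q_pow {p : ℕ} (hp : p ≠ 0) : Integrable fun x => Q x ^ p := by
  refine ((integrable_exp_neg_mul_abs one_pos).const_mul (3 ^ p)).mono'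
    (continuous_Q.pow p).aestronglyMeasurable (Eventually.of_forall fun x => ?_)
  have h0 := Q_pos x
  rw [norm_eq_abs, abs_of_pos (by positivity), one_mul]
  refine (pow_le_pow_left₀ h0.le (Q_le_exp x) p).trans ?_
  rw [mul_pow]
  refine mul_le_mul_of_nonneg_left ?_ (by positivity)
  exact pow_le_of_le_one (exp_pos _).le (exp_le_one_iff.2 (by simp)) hp

lemma integral_Q_pow_pos {p : ℕ} (hp : p ≠ 0) : 0 < ∫ x, Q x ^ p := by
  have h0 := fun x => (Q_pos x).le
  rw [integral_pos_iff_support_of_nonneg (fun x => pow_nonneg (h0 x) p) (integrable_Q_pow hp)]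
  have : Function.support (fun x => Q x ^ p) = Set.univ :=
    Set.eq_univ_of_forall fun x => (pow_pos (Q_pos x) p).ne'
  rw [this]
  simp

lemma integral_Q1_sq : ∫ x, Q1 x ^ 2 = 3 / 7 * ∫ x, Q x ^ 2 ∧ ∫ x, Q x ^ 5 = 10 / 7 * ∫ x, Q x ^ 2 := by
  have i2 := integrable_Q_pow (p := 2) (by norm_num)
  have i5 := integrable_Q_pow (p := 5) (by norm_num)
  have e1 : ∫ x, Q1 x ^ 2 = (∫ x, Q x ^ 2) - 2 / 5 * ∫ x, Q x ^ 5 := by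
    simp_rw [Q1_sq]
    rw [integral_sub i2 (i5.const_mul _), integral_const_mul]
  have iA : Integrable fun x => Q1 x ^ 2 := by
    simp_rw [Q1_sq]; exact i2.sub (i5.const_mul _)
  have iF : Integrable fun x => Q1 x ^ 2 + (Q x ^ 2 - Q x ^ 5) := iA.add (i2.sub i5)
  have e2 : ∫ x, (Q1 x ^ 2 + (Q x ^ 2 - Q x ^ 5)) = 0 := by
    refine integral_eq_zero_of_hasDerivAt_of_integrable (f := fun x => Q x * Q1 x)
      (fun x => ((hasDerivAt_Q x).mul (hasDerivAt_Q1 x)).congr_deriv (by ring)) iF ?_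
    exact integrable_mul_of_sq continuous_Q.aestronglyMeasurable continuous_Q1.aestronglyMeasurable
      i2 iA
  have i25 : Integrable fun x => Q x ^ 2 - Q x ^ 5 := i2.sub i5
  rw [integral_add iA i25, integral_sub i2 i5] at e2
  constructor <;> linarith

lemma integral_wave_pow {a : ℝ} (ha : 0 < a) (p : ℕ) :
    ∫ x, wave a x ^ p = a ^ (2 * p) / a ^ 3 * ∫ x, Q x ^ p := by
  simp_rw [wave, mul_pow, ← pow_mul]
  rw [integral_const_mul, Measure.integral_comp_mul_left (fun x => Q x ^ p),
    abs_of_pos (by positivity), smul_eq_mul]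
  ring

lemma integral_wave1_sq {a : ℝ} (ha : 0 < a) :
    ∫ x, wave1 a x ^ 2 = a ^ 7 * ∫ x, Q1 x ^ 2 := by
  simp_rw [wave1, mul_pow, ← pow_mul]
  rw [integral_const_mul, Measure.integral_comp_mul_left (fun x => Q1 x ^ 2),
    abs_of_pos (by positivity), smul_eq_mul]
  field_simp

lemma integral_wave {a : ℝ} (ha : 0 < a) : ∫ x, wave a x = (∫ x, Q x) / a := by
  have := integral_wave_pow ha 1
  simp only [pow_one, mul_one] at this
  rw [this]; field_simp

lemma integral_wave_sq {a : ℝ} (ha : 0 < a) : ∫ x, wave a x ^ 2 = a * ∫ x, Q x ^ 2 := by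
  rw [integral_wave_pow ha]
  field_simp

lemma wave_energy {a : ℝ} (ha : 0 < a) :
    (∫ x, wave1 a x ^ 2) / 2 - (∫ x, wave a x ^ 5) / 5 = -(∫ x, Q x ^ 2) / 14 * a ^ 7 := by
  rw [integral_wave_pow ha, integral_wave1_sq ha, integral_Q1_sq.1, integral_Q1_sq.2]
  field_simp
  ring

lemma exists_abs_add_pow_sub_le (p : ℕ) {B : ℝ} (hB : 0 ≤ B) : ∃ K, 0 ≤ K ∧ ∀ a b : ℝ, |a| ≤ B → |b| ≤ B →
    |(a + b) ^ (p + 1) - a ^ (p + 1) - b ^ (p + 1)| ≤ K * (|a| * |b|) := by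
  induction p with
  | zero => exact ⟨0, le_rfl, fun a b _ _ => by simp⟩
  | succ p ih =>
    obtain ⟨K, K0, hK⟩ := ih
    refine ⟨2 * B * K + 2 * B ^ p, by positivity, fun a b ha hb => ?_⟩
    have e : (a + b) ^ (p + 1 + 1) - a ^ (p + 1 + 1) - b ^ (p + 1 + 1)
        = (a + b) * ((a + b) ^ (p + 1) - a ^ (p + 1) - b ^ (p + 1))
          + (a ^ p * (a * b) + b ^ p * (a * b)) := by ring
    have h1 : |a + b| ≤ 2 * B := (abs_add_le a b).trans (by linarith)
    have hp : ∀ z : ℝ, |z| ≤ B → |z ^ p * (a * b)| ≤ B ^ p * (|a| * |b|) := fun z hz => by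
      rw [abs_mul, abs_pow, abs_mul]
      exact mul_le_mul_of_nonneg_right (pow_le_pow_left₀ (abs_nonneg z) hz p) (by positivity)
    rw [e]
    refine (abs_add_le _ _).trans ?_
    have h2 : |(a + b) * ((a + b) ^ (p + 1) - a ^ (p + 1) - b ^ (p + 1))|
        ≤ 2 * B * (K * (|a| * |b|)) := by
      rw [abs_mul]; exact mul_le_mul h1 (hK a b ha hb) (abs_nonneg _) (by positivity)
    have h3 := (abs_add_le (a ^ p * (a * b)) (b ^ p * (a * b))).trans (add_le_add (hp a ha) (hp b hb))
    linarith

lemma exists_abs_sum_pow_sub_le {ι : Type*} [DecidableEq ι] (s : Finset ι) (p : ℕ) {B : ℝ}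
    (hB : 0 ≤ B) : ∃ K, 0 ≤ K ∧ ∀ v : ι → ℝ, (∀ j ∈ s, |v j| ≤ B) →
      |(∑ j ∈ s, v j) ^ (p + 1) - ∑ j ∈ s, v j ^ (p + 1)|
        ≤ K * ∑ i ∈ s, ∑ j ∈ s, if i = j then 0 else |v i| * |v j| := by
  induction s using Finset.induction_on with
  | empty => exact ⟨0, le_rfl, fun v _ => by simp⟩
  | insert k s hk ih =>
    obtain ⟨K, K0, hK⟩ := ih
    obtain ⟨L, L0, hL⟩ := exists_abs_add_pow_sub_le p (by positivity : 0 ≤ (s.card + 1) * B)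
    refine ⟨K + L, by positivity, fun v hv => ?_⟩
    have hvs : ∀ j ∈ s, |v j| ≤ B := fun j hj => hv j (Finset.mem_insert_of_mem hj)
    have hvk := hv k (Finset.mem_insert_self _ _)
    have hA : |∑ j ∈ s, v j| ≤ ∑ j ∈ s, |v j| := Finset.abs_sum_le_sum_abs _ _
    have hA2 : ∑ j ∈ s, |v j| ≤ s.card * B := by
      rw [← nsmul_eq_mul]; exact Finset.sum_le_card_nsmul _ _ _ hvs
    have h1 := hL (v k) (∑ j ∈ s, v j) (by nlinarith [(Nat.cast_nonneg s.card : (0:ℝ) ≤ s.card)])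
      (by linarith)
    have h2 := hK v hvs
    have g0 : ∀ i j, 0 ≤ (if i = j then 0 else |v i| * |v j|) := fun i j => by
      split_ifs <;> positivity
    have hk2 : ∑ j ∈ s, (if k = j then 0 else |v k| * |v j|) = |v k| * ∑ j ∈ s, |v j| := by
      rw [Finset.mul_sum]
      refine Finset.sum_congr rfl fun j hj => if_neg ?_
      rintro rfl; exact hk hj
    have h3 : |v k| * |∑ j ∈ s, v j| ≤ ∑ j ∈ s, (if k = j then 0 else |v k| * |v j|) := by
      rw [hk2]; exact mul_le_mul_of_nonneg_left hA (abs_nonneg _)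
    have h4 : (∑ j ∈ s, (if k = j then 0 else |v k| * |v j|))
        + ∑ i ∈ s, ∑ j ∈ s, (if i = j then 0 else |v i| * |v j|)
        ≤ ∑ i ∈ insert k s, ∑ j ∈ insert k s, if i = j then 0 else |v i| * |v j| := by
      rw [Finset.sum_insert hk]
      refine add_le_add ?_ (Finset.sum_le_sum fun i _ => ?_)
      · rw [Finset.sum_insert hk]; linarith [g0 k k]
      · rw [Finset.sum_insert hk]; linarith [g0 i k]
    set P := ∑ i ∈ s, ∑ j ∈ s, (if i = j then 0 else |v i| * |v j|)
    set P' := ∑ j ∈ s, (if k = j then 0 else |v k| * |v j|)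
    have P0 : 0 ≤ P := Finset.sum_nonneg fun i _ => Finset.sum_nonneg fun j _ => g0 i j
    have P0' : 0 ≤ P' := Finset.sum_nonneg fun j _ => g0 k j
    rw [Finset.sum_insert hk, Finset.sum_insert hk]
    have e : (v k + ∑ j ∈ s, v j) ^ (p + 1) - (v k ^ (p + 1) + ∑ j ∈ s, v j ^ (p + 1))
        = ((v k + ∑ j ∈ s, v j) ^ (p + 1) - v k ^ (p + 1) - (∑ j ∈ s, v j) ^ (p + 1))
        + ((∑ j ∈ s, v j) ^ (p + 1) - ∑ j ∈ s, v j ^ (p + 1)) := by ring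
    rw [e]
    refine (abs_add_le _ _).trans ?_
    have h5 := mul_le_mul_of_nonneg_left h3 L0
    have h6 := mul_le_mul_of_nonneg_left h4 (by positivity : 0 ≤ K + L)
    nlinarith [mul_nonneg K0 P0', mul_nonneg L0 P0]

lemma exp_mul_exp_le {κ x y z ρ : ℝ} (hκ : 0 ≤ κ) (h : ρ ≤ |y - z|) :
    exp (-(κ * |x - y|)) * exp (-(κ * |x - z|)) ≤ exp (-(κ / 2 * ρ)) * exp (-(κ / 2 * |x - y|)) := by
  rw [← exp_add, ← exp_add]
  refine exp_le_exp.2 ?_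
  have h1 : |y - z| ≤ |x - y| + |x - z| := by
    have := abs_sub_le y x z
    rwa [abs_sub_comm y x] at this
  have h2 := abs_nonneg (x - z)
  nlinarith

/-- Nonlinear interaction of exponentially localised profiles with distant centres. -/
lemma exists_interaction_le (s : Finset ℕ) (p : ℕ) {C κ : ℝ} (hC : 0 ≤ C) (hκ : 0 < κ) :
    ∃ K, 0 ≤ K ∧ ∀ (r : ℕ → ℝ → ℝ) (y : ℕ → ℝ) (ρ x : ℝ),
      (∀ j ∈ s, ∀ x, |r j x| ≤ C * exp (-(κ * |x|))) →
      (∀ i ∈ s, ∀ j ∈ s, i ≠ j → ρ ≤ |y i - y j|) →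
      |(∑ j ∈ s, r j (x - y j)) ^ (p + 1) - ∑ j ∈ s, r j (x - y j) ^ (p + 1)|
        ≤ K * exp (-(κ / 2 * ρ)) * ∑ i ∈ s, exp (-(κ / 2 * |x - y i|)) := by
  obtain ⟨K, K0, hK⟩ := exists_abs_sum_pow_sub_le s p hC
  refine ⟨K * C ^ 2 * s.card, by positivity, fun r y ρ x hr hy => ?_⟩
  refine (hK (fun j => r j (x - y j)) fun j hj => (hr j hj _).trans ?_).trans ?_
  · exact mul_le_of_le_one_right hC (exp_le_one_iff.2 (by
      have := mul_nonneg hκ.le (abs_nonneg (x - y j)); linarith))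
  · have : ∀ i ∈ s, ∑ j ∈ s, (if i = j then 0 else |r i (x - y i)| * |r j (x - y j)|)
        ≤ s.card * (C ^ 2 * exp (-(κ / 2 * ρ)) * exp (-(κ / 2 * |x - y i|))) := by
      intro i hi
      rw [← nsmul_eq_mul]
      refine Finset.sum_le_card_nsmul _ _ _ fun j hj => ?_
      split_ifs with hij
      · positivity
      · calc |r i (x - y i)| * |r j (x - y j)|
            ≤ (C * exp (-(κ * |x - y i|))) * (C * exp (-(κ * |x - y j|))) :=
              mul_le_mul (hr i hi _) (hr j hj _) (abs_nonneg _) (by positivity)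
          _ = C ^ 2 * (exp (-(κ * |x - y i|)) * exp (-(κ * |x - y j|))) := by ring
          _ ≤ C ^ 2 * (exp (-(κ / 2 * ρ)) * exp (-(κ / 2 * |x - y i|))) :=
              mul_le_mul_of_nonneg_left (exp_mul_exp_le hκ.le (hy i hi j hj hij)) (by positivity)
          _ = _ := by ring
    calc K * _ ≤ K * ∑ i ∈ s, s.card * (C ^ 2 * exp (-(κ / 2 * ρ)) * exp (-(κ / 2 * |x - y i|))) :=
          mul_le_mul_of_nonneg_left (Finset.sum_le_sum this) K0
      _ = _ := by
          rw [← Finset.mul_sum, ← Finset.mul_sum]; ring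

lemma sq_integral_abs_mul_le {f g : ℝ → ℝ} (hf : AEStronglyMeasurable f volume)
    (hg : AEStronglyMeasurable g volume) (h0 : Integrable fun x => f x ^ 2)
    (h1 : Integrable fun x => g x ^ 2) :
    (∫ x, |f x * g x|) ^ 2 ≤ (∫ x, f x ^ 2) * ∫ x, g x ^ 2 := by
  have A : 0 ≤ ∫ x, f x ^ 2 := integral_nonneg fun x => sq_nonneg _
  have B : 0 ≤ ∫ x, g x ^ 2 := integral_nonneg fun x => sq_nonneg _
  have := sq_le_of_forall_le (s := ∫ x, |f x * g x|) (y := (∫ x, f x ^ 2) / 2)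
    (m := (∫ x, g x ^ 2) / 2) (integral_nonneg fun x => abs_nonneg _) (by positivity)
    (by positivity) fun l hl => by
      rw [← integral_div, ← integral_div, ← integral_div, ← integral_const_mul,
        ← integral_add ((h0.div_const 2).const_mul l) ((h1.div_const 2).div_const l)]
      refine integral_mono (integrable_mul_of_sq hf hg h0 h1).abs
        (((h0.div_const 2).const_mul l).add ((h1.div_const 2).div_const l)) fun x => ?_
      have hx := sq_nonneg (l * |f x| - |g x|)
      simp only
      rw [abs_mul, ← sq_abs (f x), ← sq_abs (g x), div_div, ← sub_nonneg]
      have : l * (|f x| ^ 2 / 2) + |g x| ^ 2 / (2 * l) - |f x| * |g x|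
          = (l * |f x| - |g x|) ^ 2 / (2 * l) := by field_simp; ring
      rw [this]; positivity
  nlinarith

lemma integrable_sum_exp {s : Finset ℕ} {κ : ℝ} (hκ : 0 < κ) (y : ℕ → ℝ) :
    Integrable (fun x => ∑ i ∈ s, exp (-(κ * |x - y i|))) ∧
    ∫ x, ∑ i ∈ s, exp (-(κ * |x - y i|)) = s.card * ∫ x, exp (-(κ * |x|)) := by
  have hi : ∀ i ∈ s, Integrable fun x => exp (-(κ * |x - y i|)) := fun i _ =>
    (integrable_exp_neg_mul_abs hκ).comp_sub_right (y i)
  refine ⟨integrable_finsetSum _ hi, ?_⟩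
  rw [integral_finsetSum _ hi]
  rw [Finset.sum_congr rfl fun i _ =>
    integral_sub_right_eq_self (fun x => exp (-(κ * |x|))) (y i)]
  simp

lemma integrable_sum_sq {s : Finset ℕ} {r : ℕ → ℝ → ℝ} {y : ℕ → ℝ} {C κ : ℝ} (hC : 0 ≤ C)
    (hκ : 0 < κ) (cr : ∀ j ∈ s, Continuous (r j))
    (hr : ∀ j ∈ s, ∀ x, |r j x| ≤ C * exp (-(κ * |x|))) :
    (Continuous fun x => ∑ j ∈ s, r j (x - y j)) ∧
    (∀ x, |∑ j ∈ s, r j (x - y j)| ≤ C * ∑ j ∈ s, exp (-(κ * |x - y j|))) ∧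
    (∀ x, |∑ j ∈ s, r j (x - y j)| ≤ C * s.card) ∧
    Integrable fun x => (∑ j ∈ s, r j (x - y j)) ^ 2 := by
  have c : Continuous fun x => ∑ j ∈ s, r j (x - y j) :=
    continuous_finsetSum _ fun j hj => (cr j hj).comp (continuous_id.sub continuous_const)
  have h1 : ∀ x, |∑ j ∈ s, r j (x - y j)| ≤ C * ∑ j ∈ s, exp (-(κ * |x - y j|)) := fun x => by
    rw [Finset.mul_sum]
    exact (Finset.abs_sum_le_sum_abs _ _).trans (Finset.sum_le_sum fun j hj => hr j hj _)
  have h2 : ∀ x, |∑ j ∈ s, r j (x - y j)| ≤ C * s.card := fun x => by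
    refine (h1 x).trans (mul_le_mul_of_nonneg_left ?_ hC)
    have : ∑ j ∈ s, exp (-(κ * |x - y j|)) ≤ s.card • (1 : ℝ) :=
      Finset.sum_le_card_nsmul _ _ _ fun j _ => exp_le_one_iff.2 (by
        have := mul_nonneg hκ.le (abs_nonneg (x - y j)); linarith)
    simpa using this
  refine ⟨c, h1, h2, (((integrable_sum_exp (s := s) hκ y).1.const_mul C).const_mul
    (C * s.card)).mono' (c.pow 2).aestronglyMeasurable (Eventually.of_forall fun x => ?_)⟩
  rw [norm_eq_abs, abs_pow, sq]
  exact mul_le_mul (h2 x) (h1 x) (abs_nonneg _) (by positivity)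

/-- If `U` approaches a sum of separating profiles in `L²`, then its powers approach the
sum of the powers of the profiles in `L¹`. -/
lemma tendsto_integral_pow_sub {s : Finset ℕ} {r : ℕ → ℝ → ℝ} {y : ℕ → ℝ → ℝ} {C κ : ℝ}
    {ρ : ℝ → ℝ} {U : ℝ → ℝ → ℝ} {M L : ℝ} (p : ℕ) (hC : 0 ≤ C) (hκ : 0 < κ)
    (cr : ∀ j ∈ s, Continuous (r j)) (hr : ∀ j ∈ s, ∀ x, |r j x| ≤ C * exp (-(κ * |x|)))
    (hρ : Tendsto ρ atTop atTop)
    (hy : ∀ t, ∀ i ∈ s, ∀ j ∈ s, i ≠ j → ρ t ≤ |y i t - y j t|)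
    (cU : ∀ t, Continuous (U t)) (iU : ∀ t, Integrable fun x => U t x ^ 2)
    (hM : ∀ t, ∫ x, U t x ^ 2 ≤ M)
    (hε : Tendsto (fun t => ∫ x, (U t x - ∑ j ∈ s, r j (x - y j t)) ^ 2) atTop (nhds 0))
    (L0 : 0 ≤ L)
    (hL : ∀ t x, |U t x ^ (p + 1) - (∑ j ∈ s, r j (x - y j t)) ^ (p + 1)|
      ≤ L * (|U t x - ∑ j ∈ s, r j (x - y j t)|
        * (|U t x| + |∑ j ∈ s, r j (x - y j t)|))) :
    (∀ t, Integrable fun x => U t x ^ (p + 1) - ∑ j ∈ s, r j (x - y j t) ^ (p + 1)) ∧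
    Tendsto (fun t => ∫ x, |U t x ^ (p + 1) - ∑ j ∈ s, r j (x - y j t) ^ (p + 1)|) atTop
      (nhds 0) := by
  obtain ⟨K, K0, hK⟩ := exists_interaction_le s p hC hκ
  set R : ℝ → ℝ → ℝ := fun t x => ∑ j ∈ s, r j (x - y j t) with hR
  have M0 : 0 ≤ M := (integral_nonneg fun x => sq_nonneg (U 0 x)).trans (hM 0)
  have cR : ∀ t, Continuous (R t) := fun t => (integrable_sum_sq (y := fun j => y j t) hC hκ cr hr).1
  have iR : ∀ t, Integrable fun x => R t x ^ 2 := fun t =>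
    (integrable_sum_sq (y := fun j => y j t) hC hκ cr hr).2.2.2
  have cS : ∀ t, Continuous fun x => ∑ j ∈ s, r j (x - y j t) ^ (p + 1) := fun t =>
    continuous_finsetSum _ fun j hj => ((cr j hj).comp (continuous_id.sub continuous_const)).pow _
  have iε : ∀ t, Integrable fun x => (U t x - R t x) ^ 2 := fun t => by
    have := (((iU t).const_mul 2).add ((iR t).const_mul 2))
    refine this.mono' (((cU t).sub (cR t)).pow 2).aestronglyMeasurable
      (Eventually.of_forall fun x => ?_)
    rw [norm_eq_abs, abs_of_nonneg (sq_nonneg _)]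
    simp only [Pi.add_apply]
    nlinarith [sq_nonneg (U t x + R t x)]
  have iεU : ∀ t, Integrable fun x => |(U t x - R t x) * U t x| := fun t =>
    (integrable_mul_of_sq ((cU t).sub (cR t)).aestronglyMeasurable (cU t).aestronglyMeasurable
      (iε t) (iU t)).abs
  have iS := fun t => (integrable_sum_exp (s := s) (half_pos hκ) fun j => y j t)
  have iB : ∀ t, Integrable fun x => (L * 2) * |(U t x - R t x) * U t x| + L * (U t x - R t x) ^ 2
      + (K * exp (-(κ / 2 * ρ t))) * ∑ i ∈ s, exp (-(κ / 2 * |x - y i t|)) := fun t =>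
    (((iεU t).const_mul _).add ((iε t).const_mul _)).add ((iS t).1.const_mul _)
  have bd : ∀ t x, |U t x ^ (p + 1) - ∑ j ∈ s, r j (x - y j t) ^ (p + 1)|
      ≤ (L * 2) * |(U t x - R t x) * U t x| + L * (U t x - R t x) ^ 2
      + (K * exp (-(κ / 2 * ρ t))) * ∑ i ∈ s, exp (-(κ / 2 * |x - y i t|)) := by
    intro t x
    have h1 := hK r (fun j => y j t) (ρ t) x hr (hy t)
    have h2 := hL t x
    have h3 := abs_sub_le (U t x ^ (p + 1)) (R t x ^ (p + 1)) (∑ j ∈ s, r j (x - y j t) ^ (p + 1))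
    have h4 : |R t x| ≤ |U t x| + |U t x - R t x| := by
      have := abs_sub_abs_le_abs_sub (R t x) (U t x)
      rw [abs_sub_comm] at this
      linarith
    have h5 : |U t x - R t x| * (|U t x| + |R t x|)
        ≤ 2 * |(U t x - R t x) * U t x| + (U t x - R t x) ^ 2 := by
      rw [abs_mul, ← sq_abs (U t x - R t x)]
      nlinarith [mul_le_mul_of_nonneg_left h4 (abs_nonneg (U t x - R t x))]
    have h6 := mul_le_mul_of_nonneg_left h5 L0
    simp only [hR] at *
    linarith
  have hi : ∀ t, Integrable fun x => U t x ^ (p + 1) - ∑ j ∈ s, r j (x - y j t) ^ (p + 1) :=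
    fun t => (iB t).mono' (((cU t).pow _).sub (cS t)).aestronglyMeasurable
      (Eventually.of_forall fun x => bd t x)
  refine ⟨hi, ?_⟩
  have hup : ∀ t, ∫ x, |U t x ^ (p + 1) - ∑ j ∈ s, r j (x - y j t) ^ (p + 1)|
      ≤ (L * 2) * √((∫ x, (U t x - R t x) ^ 2) * M) + L * (∫ x, (U t x - R t x) ^ 2)
      + (K * exp (-(κ / 2 * ρ t))) * (s.card * ∫ x, exp (-(κ / 2 * |x|))) := by
    intro t
    refine (integral_mono (hi t).abs (iB t) (bd t)).trans ?_
    rw [integral_linear_combination (iεU t) (iε t) (iS t).1, (iS t).2]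
    have h1 := sq_integral_abs_mul_le ((cU t).sub (cR t)).aestronglyMeasurable
      (cU t).aestronglyMeasurable (iε t) (iU t)
    have h2 : ∫ x, |(U t x - R t x) * U t x| ≤ √((∫ x, (U t x - R t x) ^ 2) * M) :=
      le_sqrt_of_sq_le (h1.trans (mul_le_mul_of_nonneg_left (hM t)
        (integral_nonneg fun x => sq_nonneg _)))
    have h3 := mul_le_mul_of_nonneg_left h2 (by positivity : 0 ≤ L * 2)
    linarith
  refine squeeze_zero (fun t => integral_nonneg fun x => abs_nonneg _) hup ?_
  have e1 : Tendsto (fun t => √((∫ x, (U t x - R t x) ^ 2) * M)) atTop (nhds 0) := by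
    have : Tendsto (fun t => √((∫ x, (U t x - R t x) ^ 2) * M)) atTop (nhds (√(0 * M))) :=
      (continuous_sqrt.tendsto _).comp (hε.mul_const M)
    rwa [zero_mul, sqrt_zero] at this
  have e2 : Tendsto (fun t => exp (-(κ / 2 * ρ t))) atTop (nhds 0) :=
    tendsto_exp_neg_atTop_nhds_zero.comp (hρ.const_mul_atTop (half_pos hκ))
  have := ((e1.const_mul (L * 2)).add (hε.const_mul L)).add
    ((e2.const_mul K).mul_const (s.card * ∫ x, exp (-(κ / 2 * |x|))))
  simpa using this

/-- Consequence for the integrals of the powers. -/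
lemma tendsto_integral_pow {s : Finset ℕ} {r : ℕ → ℝ → ℝ} {y : ℕ → ℝ → ℝ} {U : ℝ → ℝ → ℝ} (p : ℕ)
    (iU : ∀ t, Integrable fun x => U t x ^ p) (ir : ∀ j ∈ s, Integrable fun x => r j x ^ p)
    (h : Tendsto (fun t => ∫ x, |U t x ^ p - ∑ j ∈ s, r j (x - y j t) ^ p|) atTop (nhds 0)) :
    Tendsto (fun t => ∫ x, U t x ^ p) atTop (nhds (∑ j ∈ s, ∫ x, r j x ^ p)) := by
  have is : ∀ t, ∀ j ∈ s, Integrable fun x => r j (x - y j t) ^ p := fun t j hj =>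
    (ir j hj).comp_sub_right (y j t)
  rw [tendsto_iff_dist_tendsto_zero]
  refine squeeze_zero (fun t => dist_nonneg) (fun t => ?_) h
  have e : ∑ j ∈ s, ∫ x, r j x ^ p = ∫ x, ∑ j ∈ s, r j (x - y j t) ^ p := by
    rw [integral_finsetSum _ (is t)]
    exact Finset.sum_congr rfl fun j _ =>
      (integral_sub_right_eq_self (fun x => r j x ^ p) (y j t)).symm
  rw [Real.dist_eq, e, ← integral_sub (iU t) (integrable_finsetSum _ (is t))]
  exact abs_integral_le_integral_abs

lemma exists_abs_pow_sub_pow_le (n : ℕ) {B : ℝ} (hB : 0 ≤ B) : ∃ L, 0 ≤ L ∧ ∀ a b : ℝ,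
    |a| ≤ B → |b| ≤ B → |a ^ (n + 1 + 1) - b ^ (n + 1 + 1)| ≤ L * (|a - b| * (|a| + |b|)) := by
  induction n with
  | zero =>
    refine ⟨1, zero_le_one, fun a b _ _ => ?_⟩
    rw [show a ^ (0 + 1 + 1) - b ^ (0 + 1 + 1) = (a - b) * (a + b) by ring, abs_mul, one_mul]
    exact mul_le_mul_of_nonneg_left (abs_add_le a b) (abs_nonneg _)
  | succ n ih =>
    obtain ⟨L, L0, hL⟩ := ih
    refine ⟨B * L + B ^ (n + 1), by positivity, fun a b ha hb => ?_⟩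
    rw [show a ^ (n + 1 + 1 + 1) - b ^ (n + 1 + 1 + 1)
      = a * (a ^ (n + 1 + 1) - b ^ (n + 1 + 1)) + b ^ (n + 1) * ((a - b) * b) by ring]
    refine (abs_add_le _ _).trans ?_
    have h1 : |a * (a ^ (n + 1 + 1) - b ^ (n + 1 + 1))| ≤ B * (L * (|a - b| * (|a| + |b|))) := by
      rw [abs_mul]; exact mul_le_mul ha (hL a b ha hb) (abs_nonneg _) hB
    have h2 : |b ^ (n + 1) * ((a - b) * b)| ≤ B ^ (n + 1) * (|a - b| * (|a| + |b|)) := by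
      rw [abs_mul, abs_pow, abs_mul]
      refine mul_le_mul (pow_le_pow_left₀ (abs_nonneg _) hb _) ?_ (by positivity) (by positivity)
      exact mul_le_mul_of_nonneg_left (by linarith [abs_nonneg a]) (abs_nonneg _)
    linarith

lemma exists_pos_le {ι : Type*} (s : Finset ι) (f : ι → ℝ) (hf : ∀ j ∈ s, 0 < f j) :
    ∃ δ, 0 < δ ∧ ∀ j ∈ s, δ ≤ f j := by
  classical
  induction s using Finset.induction_on with
  | empty => exact ⟨1, one_pos, by simp⟩
  | insert k s hk ih =>
    obtain ⟨δ, h0, h⟩ := ih fun j hj => hf j (Finset.mem_insert_of_mem hj)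
    refine ⟨min δ (f k), lt_min h0 (hf k (Finset.mem_insert_self _ _)), fun j hj => ?_⟩
    rcases Finset.mem_insert.1 hj with rfl | hj
    · exact min_le_right _ _
    · exact (min_le_left _ _).trans (h j hj)

lemma le_sum_abs {ι : Type*} {s : Finset ι} (f : ι → ℝ) {j : ι} (hj : j ∈ s) :
    |f j| ≤ ∑ i ∈ s, |f i| :=
  Finset.single_le_sum (f := fun i => |f i|) (fun _ _ => abs_nonneg _) hj

/-- Sum of the solitary waves of speeds `aⱼ⁶` and shifts `Δⱼ`. -/
noncomputable def train (s : Finset ℕ) (a Δ : ℕ → ℝ) (t x : ℝ) : ℝ :=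
  ∑ j ∈ s, wave (a j) (x - (a j ^ 6 * t + Δ j))

/-- Space derivative of `train`. -/
noncomputable def train1 (s : Finset ℕ) (a Δ : ℕ → ℝ) (t x : ℝ) : ℝ :=
  ∑ j ∈ s, wave1 (a j) (x - (a j ^ 6 * t + Δ j))

/-- `u` converges in `H¹` to a sum of solitary waves with distinct speeds as `t → ∞`. -/
structure IsTrain (u u1 : ℝ → ℝ → ℝ) (s : Finset ℕ) (a Δ : ℕ → ℝ) : Prop where
  pos : ∀ j ∈ s, 0 < a j
  inj : Set.InjOn a s
  lim : Tendsto (fun t => ∫ x, ((u t x - train s a Δ t x) ^ 2 + (u1 t x - train1 s a Δ t x) ^ 2))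
    atTop (nhds 0)

lemma exists_wave_le {s : Finset ℕ} {a : ℕ → ℝ} (ha : ∀ j ∈ s, 0 < a j) :
    ∃ C κ, 0 ≤ C ∧ 0 < κ ∧ (∀ j ∈ s, ∀ x, |wave (a j) x| ≤ C * exp (-(κ * |x|))) ∧
      ∀ j ∈ s, ∀ x, |wave1 (a j) x| ≤ C * exp (-(κ * |x|)) := by
  obtain ⟨κ, κ0, hκ⟩ := exists_pos_le s (fun j => a j ^ 3) fun j hj => pow_pos (ha j hj) 3
  have he : ∀ j ∈ s, ∀ x, exp (-(a j ^ 3 * |x|)) ≤ exp (-(κ * |x|)) := fun j hj x =>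
    exp_le_exp.2 (neg_le_neg (mul_le_mul_of_nonneg_right (hκ j hj) (abs_nonneg x)))
  have b1 : 0 ≤ ∑ i ∈ s, |3 * a i ^ 2| := Finset.sum_nonneg fun _ _ => abs_nonneg _
  have b2 : 0 ≤ ∑ i ∈ s, |3 * a i ^ 5| := Finset.sum_nonneg fun _ _ => abs_nonneg _
  refine ⟨(∑ i ∈ s, |3 * a i ^ 2|) + ∑ i ∈ s, |3 * a i ^ 5|, κ, by positivity, κ0,
    fun j hj x => (abs_wave_le (ha j hj) x).trans (mul_le_mul ?_ (he j hj x) (exp_nonneg _)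
      (by positivity)),
    fun j hj x => (abs_wave1_le (ha j hj) x).trans (mul_le_mul ?_ (he j hj x) (exp_nonneg _)
      (by positivity))⟩
  · have := (le_abs_self _).trans (le_sum_abs (fun i => 3 * a i ^ 2) hj); linarith
  · have := (le_abs_self _).trans (le_sum_abs (fun i => 3 * a i ^ 5) hj); linarith

lemma exists_separation {s : Finset ℕ} {a : ℕ → ℝ} (Δ : ℕ → ℝ) (ha : ∀ j ∈ s, 0 < a j)
    (hinj : Set.InjOn a s) : ∃ δ D, 0 < δ ∧ ∀ t : ℝ, ∀ i ∈ s, ∀ j ∈ s, i ≠ j →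
      δ * t - D ≤ |(a i ^ 6 * t + Δ i) - (a j ^ 6 * t + Δ j)| := by
  classical
  obtain ⟨δ, δ0, hδ⟩ := exists_pos_le ((s ×ˢ s).filter fun p => p.1 ≠ p.2)
    (fun p => |a p.1 ^ 6 - a p.2 ^ 6|) fun p hp => by
      simp only [Finset.mem_filter, Finset.mem_product] at hp
      refine abs_pos.2 (sub_ne_zero.2 fun e => hp.2 (hinj hp.1.1 hp.1.2 ?_))
      exact (pow_left_inj₀ (ha _ hp.1.1).le (ha _ hp.1.2).le (by norm_num)).1 e
  refine ⟨δ, 2 * ∑ i ∈ s, |Δ i|, δ0, fun t i hi j hj hij => ?_⟩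
  have h1 := hδ (i, j) (by simp [hi, hj, hij])
  simp only at h1
  have h2 := le_sum_abs Δ hi
  have h3 := le_sum_abs Δ hj
  have h4 : |(a i ^ 6 - a j ^ 6) * t|
      ≤ |(a i ^ 6 * t + Δ i) - (a j ^ 6 * t + Δ j)| + (|Δ i| + |Δ j|) := by
    have e : (a i ^ 6 - a j ^ 6) * t
        = ((a i ^ 6 * t + Δ i) - (a j ^ 6 * t + Δ j)) + (Δ j - Δ i) := by ring
    rw [e]
    refine (abs_add_le _ _).trans (add_le_add_right ?_ _)
    rw [abs_sub_comm]
    exact abs_sub _ _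
  have h5 : δ * t ≤ |(a i ^ 6 - a j ^ 6) * t| := by
    rw [abs_mul]
    exact (mul_le_mul_of_nonneg_left (le_abs_self t) δ0.le).trans
      (mul_le_mul_of_nonneg_right h1 (abs_nonneg t))
  linarith

namespace IsTrain

variable {u u1 u2 u3 : ℝ → ℝ → ℝ} {s : Finset ℕ} {a Δ : ℕ → ℝ}

lemma continuous_train (s : Finset ℕ) (a Δ : ℕ → ℝ) :
    Continuous fun p : ℝ × ℝ => train s a Δ p.1 p.2 :=
  continuous_finsetSum _ fun j _ => (continuous_wave (a j)).comp (by fun_prop)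

lemma continuous_train1 (s : Finset ℕ) (a Δ : ℕ → ℝ) :
    Continuous fun p : ℝ × ℝ => train1 s a Δ p.1 p.2 :=
  continuous_finsetSum _ fun j _ => (continuous_wave1 (a j)).comp (by fun_prop)

lemma hasDerivAt_train (s : Finset ℕ) (a Δ : ℕ → ℝ) (t x : ℝ) :
    HasDerivAt (train s a Δ t) (train1 s a Δ t x) x :=
  HasDerivAt.fun_sum fun j _ => (hasDerivAt_wave (a j) _).comp_sub_const x (a j ^ 6 * t + Δ j)

lemma integrable_train_sq (ha : ∀ j ∈ s, 0 < a j) (Δ : ℕ → ℝ) (t : ℝ) :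
    Integrable (fun x => train s a Δ t x ^ 2) ∧ Integrable (fun x => train1 s a Δ t x ^ 2) := by
  obtain ⟨C, κ, C0, κ0, hw, hw1⟩ := exists_wave_le ha
  exact ⟨(integrable_sum_sq C0 κ0 (fun j _ => continuous_wave (a j)) hw).2.2.2,
    (integrable_sum_sq C0 κ0 (fun j _ => continuous_wave1 (a j)) hw1).2.2.2⟩

lemma exists_train_le (ha : ∀ j ∈ s, 0 < a j) (Δ : ℕ → ℝ) :
    ∃ B, 0 ≤ B ∧ ∀ t x, |train s a Δ t x| ≤ B := by
  obtain ⟨C, κ, C0, κ0, hw, hw1⟩ := exists_wave_le ha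
  exact ⟨C * s.card, by positivity, fun t x =>
    (integrable_sum_sq C0 κ0 (fun j _ => continuous_wave (a j)) hw).2.2.1 x⟩

lemma integrable_sub_sq {f g : ℝ → ℝ} (cf : Continuous f) (cg : Continuous g)
    (hf : Integrable fun x => f x ^ 2) (hg : Integrable fun x => g x ^ 2) :
    Integrable fun x => (f x - g x) ^ 2 := by
  refine ((hf.const_mul 2).add (hg.const_mul 2)).mono' ((cf.sub cg).pow 2).aestronglyMeasurable
    (Eventually.of_forall fun x => ?_)
  rw [norm_eq_abs, abs_of_nonneg (sq_nonneg _)]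
  simp only [Pi.add_apply]
  nlinarith [sq_nonneg (f x + g x)]

lemma integrable_error (hu : IsSol u u1 u2 u3) (h : IsTrain u u1 s a Δ) (t : ℝ) :
    Integrable (fun x => (u t x - train s a Δ t x) ^ 2) ∧
    Integrable (fun x => (u1 t x - train1 s a Δ t x) ^ 2) :=
  ⟨integrable_sub_sq (hu.cu t) (continuous_section (continuous_train s a Δ) t) (hu.i0 t)
      (integrable_train_sq h.pos Δ t).1,
    integrable_sub_sq (hu.cu1 t) (continuous_section (continuous_train1 s a Δ) t) (hu.i1 t)
      (integrable_train_sq h.pos Δ t).2⟩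

lemma tendsto_error (hu : IsSol u u1 u2 u3) (h : IsTrain u u1 s a Δ) :
    Tendsto (fun t => ∫ x, (u t x - train s a Δ t x) ^ 2) atTop (nhds 0) ∧
    Tendsto (fun t => ∫ x, (u1 t x - train1 s a Δ t x) ^ 2) atTop (nhds 0) := by
  have i := fun t => integrable_error hu h t
  constructor
  · refine squeeze_zero (fun t => integral_nonneg fun x => sq_nonneg _) (fun t => ?_) h.lim
    exact integral_mono (i t).1 ((i t).1.add (i t).2) fun x => le_add_of_nonneg_right (sq_nonneg _)
  · refine squeeze_zero (fun t => integral_nonneg fun x => sq_nonneg _) (fun t => ?_) h.lim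
    exact integral_mono (i t).2 ((i t).1.add (i t).2) fun x => le_add_of_nonneg_left (sq_nonneg _)

/-- Uniform convergence to the train. -/
lemma sq_error_le (hu : IsSol u u1 u2 u3) (h : IsTrain u u1 s a Δ) (t x : ℝ) :
    (u t x - train s a Δ t x) ^ 2
      ≤ ∫ x, ((u t x - train s a Δ t x) ^ 2 + (u1 t x - train1 s a Δ t x) ^ 2) :=
  sq_le_integral_add (f := fun x => u t x - train s a Δ t x)
    (fun x => (hu.flow.d0 t x).sub (hasDerivAt_train s a Δ t x))
    ((hu.cu1 t).sub (continuous_section (continuous_train1 s a Δ) t))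
    (integrable_error hu h t).1 (integrable_error hu h t).2 x

/-- Powers of the solution approach the powers of the waves in `L¹`. -/
lemma tendsto_pow_sub (hu : IsSol u u1 u2 u3) (h : IsTrain u u1 s a Δ) (n : ℕ) :
    (∀ t, Integrable fun x => u t x ^ (n + 1 + 1)
      - ∑ j ∈ s, wave (a j) (x - (a j ^ 6 * t + Δ j)) ^ (n + 1 + 1)) ∧
    Tendsto (fun t => ∫ x, |u t x ^ (n + 1 + 1)
      - ∑ j ∈ s, wave (a j) (x - (a j ^ 6 * t + Δ j)) ^ (n + 1 + 1)|) atTop (nhds 0) := by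
  obtain ⟨C, κ, C0, κ0, hw, hw1⟩ := exists_wave_le h.pos
  obtain ⟨δ, D, δ0, hδ⟩ := exists_separation Δ h.pos h.inj
  obtain ⟨B, B0, hB⟩ := exists_train_le h.pos Δ
  obtain ⟨K, hK⟩ := hu.exists_bound
  obtain ⟨L, L0, hL⟩ := exists_abs_pow_sub_pow_le n (add_nonneg B0 (sqrt_nonneg K))
  exact tendsto_integral_pow_sub (r := fun j => wave (a j)) (y := fun j t => a j ^ 6 * t + Δ j)
    (ρ := fun t => δ * t - D) (n + 1) C0 κ0 (fun j _ => continuous_wave (a j)) hw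
    (tendsto_atTop_add_const_right _ _ (tendsto_id.const_mul_atTop δ0)) hδ hu.cu hu.i0
    (fun t => (hu.mass_le t).trans (hK t)) (tendsto_error hu h).1 L0
    fun t x => hL _ _ ((Real.abs_le_sqrt ((hu.sq_le_hNorm t x).trans (hK t))).trans
      (le_add_of_nonneg_left B0)) ((hB t x).trans (le_add_of_nonneg_right (sqrt_nonneg K)))

lemma tendsto_deriv_sq_sub (hu : IsSol u u1 u2 u3) (h : IsTrain u u1 s a Δ) :
    Tendsto (fun t => ∫ x, |u1 t x ^ 2
      - ∑ j ∈ s, wave1 (a j) (x - (a j ^ 6 * t + Δ j)) ^ 2|) atTop (nhds 0) := by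
  obtain ⟨C, κ, C0, κ0, hw, hw1⟩ := exists_wave_le h.pos
  obtain ⟨δ, D, δ0, hδ⟩ := exists_separation Δ h.pos h.inj
  obtain ⟨K, hK⟩ := hu.exists_bound
  exact (tendsto_integral_pow_sub (r := fun j => wave1 (a j)) (y := fun j t => a j ^ 6 * t + Δ j)
    (ρ := fun t => δ * t - D) 1 C0 κ0 (fun j _ => continuous_wave1 (a j)) hw1
    (tendsto_atTop_add_const_right _ _ (tendsto_id.const_mul_atTop δ0)) hδ hu.cu1 hu.i1
    (fun t => (hu.deriv_le t).trans (hK t)) (tendsto_error hu h).2 zero_le_one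
    fun t x => by
      rw [show ∀ z w : ℝ, z ^ (1 + 1) - w ^ (1 + 1) = (z - w) * (z + w) by intro z w; ring,
        abs_mul, one_mul]
      exact mul_le_mul_of_nonneg_left (abs_add_le _ _) (abs_nonneg _)).2

end IsTrain

lemma integrable_wave_pow {a : ℝ} (ha : 0 < a) {p : ℕ} (hp : p ≠ 0) :
    Integrable fun x => wave a x ^ p := by
  simp_rw [wave, mul_pow]
  exact ((integrable_Q_pow hp).comp_mul_left' (pow_pos ha 3).ne').const_mul _

lemma integrable_wave {a : ℝ} (ha : 0 < a) : Integrable (wave a) := by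
  simpa using integrable_wave_pow ha one_ne_zero

lemma integrable_Q1_sq : Integrable fun x => Q1 x ^ 2 := by
  simp_rw [Q1_sq]
  exact (integrable_Q_pow two_ne_zero).sub ((integrable_Q_pow (by norm_num)).const_mul _)

lemma integrable_wave1_sq {a : ℝ} (ha : 0 < a) : Integrable fun x => wave1 a x ^ 2 := by
  simp_rw [wave1, mul_pow]
  exact (integrable_Q1_sq.comp_mul_left' (pow_pos ha 3).ne').const_mul _

namespace IsTrain

variable {u u1 u2 u3 : ℝ → ℝ → ℝ} {s : Finset ℕ} {a Δ : ℕ → ℝ}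

lemma mass_eq (hu : IsSol u u1 u2 u3) (h : IsTrain u u1 s a Δ) :
    ∫ x, u 0 x ^ 2 = (∑ j ∈ s, a j) * ∫ x, Q x ^ 2 := by
  have key := tendsto_integral_pow 2 hu.i0
    (fun j hj => integrable_wave_pow (h.pos j hj) two_ne_zero) (h.tendsto_pow_sub hu 0).2
  rw [Finset.sum_congr rfl fun j hj => integral_wave_sq (h.pos j hj), ← Finset.sum_mul] at key
  refine tendsto_nhds_unique ?_ key
  simp_rw [fun t => (hu.conserved 0 t).1]
  exact tendsto_const_nhds

lemma energy_eq (hu : IsSol u u1 u2 u3) (h : IsTrain u u1 s a Δ) :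
    energy u u1 0 = -(∫ x, Q x ^ 2) / 14 * ∑ j ∈ s, a j ^ 7 := by
  have k5 := tendsto_integral_pow 5 (fun t => hu.integrable_pow t 3)
    (fun j hj => integrable_wave_pow (h.pos j hj) (by norm_num)) (h.tendsto_pow_sub hu 3).2
  have k2 := tendsto_integral_pow 2 hu.i1
    (fun j hj => integrable_wave1_sq (h.pos j hj)) (h.tendsto_deriv_sq_sub hu)
  have key := (k2.div_const 2).sub (k5.div_const 5)
  rw [Finset.sum_div, Finset.sum_div, ← Finset.sum_sub_distrib,
    Finset.sum_congr rfl fun j hj => wave_energy (h.pos j hj), ← Finset.mul_sum] at key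
  refine tendsto_nhds_unique ?_ key
  have : ∀ t, (∫ x, u1 t x ^ 2) / 2 - (∫ x, u t x ^ 5) / 5 = energy u u1 0 := fun t =>
    (hu.conserved 0 t).2
  simp_rw [this]
  exact tendsto_const_nhds

end IsTrain

/-- Chain rule along a line, from continuous partial derivatives. -/
lemma hasDerivAt_moving {F Ft Fx : ℝ → ℝ → ℝ} (dt : ∀ t x, HasDerivAt (fun s => F s x) (Ft t x) t)
    (dx : ∀ t x, HasDerivAt (F t) (Fx t x) x) (ct : Continuous fun p : ℝ × ℝ => Ft p.1 p.2)
    (cx : Continuous fun p : ℝ × ℝ => Fx p.1 p.2) (σ t x : ℝ) :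
    HasDerivAt (fun s => F s (x + σ * s)) (Ft t (x + σ * t) + σ * Fx t (x + σ * t)) t := by
  let f₁ : ℝ → ℝ → ℝ →L[ℝ] ℝ := fun t x => ContinuousLinearMap.toSpanSingleton ℝ (Ft t x)
  let f₂ : ℝ → ℝ → ℝ →L[ℝ] ℝ := fun t x => ContinuousLinearMap.toSpanSingleton ℝ (Fx t x)
  have cs : Continuous fun r : ℝ => ContinuousLinearMap.toSpanSingleton ℝ r :=
    (ContinuousLinearMap.toSpanSingletonCLE (𝕜 := ℝ) (E := ℝ)).continuous
  have h := hasStrictFDerivAt_uncurry_coprod (𝕜 := ℝ) (u := (t, x + σ * t)) (f := F) (f₁ := f₁)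
    (f₂ := f₂) (Eventually.of_forall fun v => (dt v.1 v.2).hasFDerivAt)
    (Eventually.of_forall fun v => (dx v.1 v.2).hasFDerivAt)
    (cs.comp ct).continuousAt (cs.comp cx).continuousAt
  have h2 : HasDerivAt (fun s : ℝ => (s, x + σ * s)) ((1 : ℝ), σ) t :=
    (hasDerivAt_id t).prodMk ((((hasDerivAt_id t).const_mul σ).const_add x).congr_deriv (by simp))
  refine (h.hasFDerivAt.comp_hasDerivAt t h2).congr_deriv ?_
  simp [f₁, f₂, Function.HasUncurry.uncurry]

/-- A solution in a frame moving with speed `σ`. -/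
lemma IsSol.moving {u u1 u2 u3 : ℝ → ℝ → ℝ} (h : IsSol u u1 u2 u3) (σ : ℝ) :
    IsFlow (fun t x => u t (x + σ * t)) (fun t x => u1 t (x + σ * t))
      (fun t x => u2 t (x + σ * t)) (fun t x => u3 t (x + σ * t))
      (fun t x => u t (x + σ * t) ^ 4 - σ * u t (x + σ * t))
      (fun t x => 4 * u t (x + σ * t) ^ 3 * u1 t (x + σ * t) - σ * u1 t (x + σ * t)) := by
  have f := h.flow
  have hc : ∀ {g : ℝ → ℝ → ℝ} (_ : Continuous fun p : ℝ × ℝ => g p.1 p.2),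
      Continuous fun p : ℝ × ℝ => g p.1 (p.2 + σ * p.1) := fun hg =>
    hg.comp (continuous_fst.prodMk (continuous_snd.add (continuous_fst.const_mul σ)))
  have d0 : ∀ t x, HasDerivAt (fun x => u t (x + σ * t)) (u1 t (x + σ * t)) x := fun t x =>
    (f.d0 t _).comp_add_const x (σ * t)
  have c0 := hc f.c0
  have c1 := hc f.c1
  refine ⟨fun t x => ?_, d0, fun t x => (f.d1 t _).comp_add_const x (σ * t),
    fun t x => (f.d2 t _).comp_add_const x (σ * t), fun t x => ?_, c0, c1, hc f.c2, hc f.c3,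
    (c0.pow 4).sub (c0.const_mul σ), (((c0.pow 3).const_mul 4).mul c1).sub (c1.const_mul σ)⟩
  · exact (hasDerivAt_moving f.dt f.d0 (f.c3.add f.cS1).neg f.c1 σ t x).congr_deriv (by ring)
  · exact (((d0 t x).pow 4).sub ((d0 t x).const_mul σ)).congr_deriv (by norm_num)

lemma isWeight_sigmoid (m : ℝ) : IsWeight (fun x => sigmoid (m * x)) (fun x => m * bell (m * x))
    (fun x => m ^ 2 * bell1 (m * x)) (fun x => m ^ 3 * bell2 (m * x)) := by
  have hd : ∀ {g g' : ℝ → ℝ} (_ : ∀ x, HasDerivAt g (g' x) x) (x : ℝ),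
      HasDerivAt (fun x => g (m * x)) (m * g' (m * x)) x := fun hg x =>
    ((hg (m * x)).comp x ((hasDerivAt_id x).const_mul m)).congr_deriv (by simp [mul_comm])
  exact ⟨hd hasDerivAt_sigmoid_bell,
    fun x => ((hd hasDerivAt_bell x).const_mul m).congr_deriv (by ring),
    fun x => ((hd hasDerivAt_bell1 x).const_mul (m ^ 2)).congr_deriv (by ring),
    (continuous_bell2.comp (by fun_prop)).const_mul _⟩

lemma sigmoid_neg_mul_le {μ κ x : ℝ} (hμ : 0 ≤ μ) (hκ : μ ≤ κ) :
    sigmoid (-κ * x) ≤ exp (-(μ * x)) := by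
  rcases le_total 0 x with hx | hx
  · have h1 : sigmoid (-κ * x) ≤ exp (-(κ * x)) := by
      rw [sigmoid, exp_neg (κ * x), show -(-κ * x) = κ * x by ring]
      exact inv_anti₀ (exp_pos _) (by linarith)
    exact h1.trans (exp_le_exp.2 (by nlinarith))
  · exact (sigmoid_lt_one _).le.trans (one_le_exp (by nlinarith))

lemma exp_mul_sigmoid_le {μ κ β x s : ℝ} (hμ : 0 ≤ μ) (hκ : μ ≤ κ) (hβ : μ ≤ β / 2) :
    exp (-(β * |x - s|)) * sigmoid (-κ * x) ≤ exp (-(β / 2 * |x - s|)) * exp (-(μ * s)) := by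
  refine (mul_le_mul_of_nonneg_left (sigmoid_neg_mul_le hμ hκ) (exp_nonneg _)).trans ?_
  rw [← exp_add, ← exp_add]
  refine exp_le_exp.2 ?_
  have h1 := neg_le_abs (x - s)
  have h2 := mul_le_mul_of_nonneg_left h1 hμ
  have h3 := mul_le_mul_of_nonneg_right hβ (abs_nonneg (x - s))
  linarith

/-- In a slowly moving frame the train leaves the left half-line exponentially fast. -/
lemma exists_train_mul_sigmoid_le {s : Finset ℕ} {a : ℕ → ℝ} (Δ : ℕ → ℝ) {σ κ : ℝ}
    (ha : ∀ j ∈ s, 0 < a j) (hσ : 0 < σ) (hκ : 0 < κ) (hσa : ∀ j ∈ s, 2 * σ ≤ a j ^ 6) :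
    ∃ A γ, 0 ≤ A ∧ 0 < γ ∧ ∀ t, 0 ≤ t →
      Integrable (fun x => |train s a Δ t (x + σ * t)| * sigmoid (-κ * x)) ∧
      ∫ x, |train s a Δ t (x + σ * t)| * sigmoid (-κ * x) ≤ A * exp (-(γ * t)) := by
  obtain ⟨C, β, C0, β0, hw, -⟩ := exists_wave_le ha
  set μ := min κ (β / 2)
  have μ0 : 0 < μ := lt_min hκ (half_pos β0)
  set D := ∑ i ∈ s, |Δ i|
  set E := ∫ x, exp (-(β / 2 * |x|))
  have E0 : 0 ≤ E := integral_nonneg fun x => exp_nonneg _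
  refine ⟨C * exp (μ * D) * (s.card * E), μ * σ, by positivity, by positivity, fun t ht => ?_⟩
  set y : ℕ → ℝ := fun j => (a j ^ 6 - σ) * t + Δ j
  have hy : ∀ j ∈ s, σ * t - D ≤ y j := fun j hj => by
    have h1 := (neg_abs_le _).trans' (neg_le_neg (le_sum_abs Δ hj))
    have h2 := mul_le_mul_of_nonneg_right (hσa j hj) ht
    simp only [y]; simp only [D]; linarith
  have iS := integrable_sum_exp (s := s) (half_pos β0) y
  have bd : ∀ x, |train s a Δ t (x + σ * t)| * sigmoid (-κ * x)
      ≤ C * exp (μ * D) * exp (-(μ * σ * t)) * ∑ j ∈ s, exp (-(β / 2 * |x - y j|)) := by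
    intro x
    have h1 : |train s a Δ t (x + σ * t)| ≤ ∑ j ∈ s, C * exp (-(β * |x - y j|)) := by
      refine (Finset.abs_sum_le_sum_abs _ _).trans (Finset.sum_le_sum fun j hj => ?_)
      have := hw j hj (x + σ * t - (a j ^ 6 * t + Δ j))
      rwa [show x + σ * t - (a j ^ 6 * t + Δ j) = x - y j by simp only [y]; ring] at this ⊢
    refine (mul_le_mul_of_nonneg_right h1 (sigmoid_pos _).le).trans ?_
    rw [Finset.sum_mul, Finset.mul_sum]
    refine Finset.sum_le_sum fun j hj => ?_
    have h2 := exp_mul_sigmoid_le (x := x) (s := y j) μ0.le (min_le_left κ (β / 2))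
      (min_le_right κ (β / 2))
    have h3 : exp (-(μ * y j)) ≤ exp (μ * D) * exp (-(μ * σ * t)) := by
      rw [← exp_add]
      refine exp_le_exp.2 ?_
      have := mul_le_mul_of_nonneg_left (hy j hj) μ0.le
      linarith
    calc C * exp (-(β * |x - y j|)) * sigmoid (-κ * x)
        = C * (exp (-(β * |x - y j|)) * sigmoid (-κ * x)) := by ring
      _ ≤ C * (exp (-(β / 2 * |x - y j|)) * exp (-(μ * y j))) := mul_le_mul_of_nonneg_left h2 C0
      _ ≤ C * (exp (-(β / 2 * |x - y j|)) * (exp (μ * D) * exp (-(μ * σ * t)))) := by gcongr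
      _ = _ := by ring
  have i : Integrable fun x => |train s a Δ t (x + σ * t)| * sigmoid (-κ * x) := by
    refine (iS.1.const_mul (C * exp (μ * D) * exp (-(μ * σ * t)))).mono' (Continuous.aestronglyMeasurable ?_)
      (Eventually.of_forall fun x => ?_)
    · have c := continuous_section (IsTrain.continuous_train s a Δ) t
      have := continuous_sigmoid
      fun_prop
    · rw [norm_eq_abs, abs_of_nonneg (mul_nonneg (abs_nonneg _) (sigmoid_pos _).le)]
      exact bd x
  refine ⟨i, (integral_mono i (iS.1.const_mul _) bd).trans_eq ?_⟩
  rw [integral_const_mul, iS.2]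
  ring

/-- Lower bound for the localised mass production in a moving frame. -/
lemma mass_production_ge {v v1 R : ℝ → ℝ} {σ κ K P : ℝ} (dv : ∀ x, HasDerivAt v (v1 x) x)
    (cv1 : Continuous v1) (i0 : Integrable fun x => v x ^ 2) (i1 : Integrable fun x => v1 x ^ 2)
    (hK : ∀ x, v x ^ 2 ≤ K) (hκ : 0 < κ) (hκσ : κ ^ 2 ≤ σ / 2) (hP : 0 ≤ P)
    (hv : ∀ x, 8 / 5 * |v x| ^ 3 ≤ σ / 2 + P * |R x|)
    (iR : Integrable fun x => |R x| * sigmoid (-κ * x)) :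
    -(κ * K * P) * ∫ x, |R x| * sigmoid (-κ * x)
      ≤ ∫ x, (v x ^ 2 * ((-κ) ^ 3 * bell2 (-κ * x)) - 3 * v1 x ^ 2 * (-κ * bell (-κ * x))
        + 2 * (v1 x * sigmoid (-κ * x) + v x * (-κ * bell (-κ * x))) * (v x ^ 4 - σ * v x)) := by
  have K0 : 0 ≤ K := (sq_nonneg _).trans (hK 0)
  have cv := continuous_of_hasDerivAt dv
  have cs : Continuous fun x => sigmoid (-κ * x) := continuous_sigmoid.comp (by fun_prop)
  have cb : Continuous fun x => bell (-κ * x) := continuous_bell.comp (by fun_prop)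
  have cb2 : Continuous fun x => bell2 (-κ * x) := continuous_bell2.comp (by fun_prop)
  have bs := fun x => abs_sigmoid_le (-κ * x)
  have bb := fun x => abs_bell_le (-κ * x)
  have bb2 := fun x => abs_bell2_le_one (-κ * x)
  have hm : ∀ {g φ : ℝ → ℝ}, Integrable g → Continuous φ → (∃ B, ∀ x, |φ x| ≤ B) →
      Integrable fun x => g x * φ x := fun {g φ} hg cφ ⟨B, hB⟩ =>
    hg.mul_bdd (c := B) cφ.aestronglyMeasurable (Eventually.of_forall hB)
  have hB : ∀ x, |v x| ≤ √K := fun x => Real.abs_le_sqrt (hK x)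
  have i01 : Integrable fun x => v x * v1 x :=
    integrable_mul_of_sq cv.aestronglyMeasurable cv1.aestronglyMeasurable i0 i1
  have hp : ∀ n : ℕ, ∃ B, ∀ x, |v x ^ n| ≤ B := fun n => ⟨√K ^ n, fun x => by
    rw [abs_pow]; exact pow_le_pow_left₀ (abs_nonneg _) (hB x) n⟩
  have c3 : Continuous fun x => v x ^ 3 := cv.pow 3
  have i5 : Integrable fun x => v x ^ 5 := by
    simpa only [← pow_add] using hm i0 c3 (hp 3)
  have i41 : Integrable fun x => v x ^ 4 * v1 x :=
    (hm i01 c3 (hp 3)).congr (Eventually.of_forall fun x => by ring)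
  let φ : ℝ → ℝ := fun x => (2 / 5 * v x ^ 5 - σ * v x ^ 2) * sigmoid (-κ * x)
  let φ' : ℝ → ℝ := fun x => (2 * (v x ^ 4 * v1 x) - 2 * σ * (v x * v1 x)) * sigmoid (-κ * x)
    + (2 / 5 * v x ^ 5 - σ * v x ^ 2) * (-κ * bell (-κ * x))
  let N : ℝ → ℝ := fun x => v x ^ 2 * ((-κ) ^ 3 * bell2 (-κ * x))
    + v1 x ^ 2 * (3 * κ * bell (-κ * x)) + (8 / 5 * v x ^ 5 - σ * v x ^ 2) * (-κ * bell (-κ * x))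
  have dφ : ∀ x, HasDerivAt φ (φ' x) x := fun x => by
    refine (((((dv x).fun_pow 5).const_mul (2 / 5)).fun_sub (((dv x).fun_pow 2).const_mul σ)).fun_mul
      ((isWeight_sigmoid (-κ)).d0 x)).congr_deriv ?_
    simp only [φ', Nat.reduceSub, Nat.cast_ofNat]; ring
  have iq : ∀ c : ℝ, Integrable fun x => c * v x ^ 5 - σ * v x ^ 2 := fun c =>
    (i5.const_mul c).sub (i0.const_mul σ)
  have bκ : ∀ c : ℝ, ∃ B, ∀ x, |c * bell (-κ * x)| ≤ B := fun c => ⟨|c| * 1, fun x => by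
    rw [abs_mul]; exact mul_le_mul_of_nonneg_left (bb x) (abs_nonneg _)⟩
  have iφ : Integrable φ := hm (iq _) cs ⟨1, bs⟩
  have iφ' : Integrable φ' := (hm ((i41.const_mul 2).sub (i01.const_mul (2 * σ))) cs ⟨1, bs⟩).add
    (hm (iq _) (cb.const_mul _) (bκ _))
  have iN : Integrable N := ((hm i0 (cb2.const_mul _) ⟨|(-κ) ^ 3| * 1, fun x => by
      rw [abs_mul]; exact mul_le_mul_of_nonneg_left (bb2 x) (abs_nonneg _)⟩).add
    (hm i1 (cb.const_mul _) (bκ _))).add (hm (iq _) (cb.const_mul _) (bκ _))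
  have e : (fun x => v x ^ 2 * ((-κ) ^ 3 * bell2 (-κ * x)) - 3 * v1 x ^ 2 * (-κ * bell (-κ * x))
        + 2 * (v1 x * sigmoid (-κ * x) + v x * (-κ * bell (-κ * x))) * (v x ^ 4 - σ * v x))
      = fun x => N x + φ' x := by
    funext x; simp only [N, φ']; ring
  rw [e, integral_add iN iφ', integral_eq_zero_of_hasDerivAt_of_integrable dφ iφ' iφ, add_zero,
    ← integral_const_mul]
  refine integral_mono (iR.const_mul _) iN fun x => ?_
  have hb := bell_pos (-κ * x)
  have hb2 := abs_bell2_le (-κ * x)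
  have hbs : bell (-κ * x) ≤ sigmoid (-κ * x) := by
    have := sigmoid_pos (-κ * x)
    rw [bell]; nlinarith
  have t1 : -(κ ^ 2 * (κ * bell (-κ * x) * v x ^ 2)) ≤ v x ^ 2 * ((-κ) ^ 3 * bell2 (-κ * x)) := by
    have := mul_le_mul_of_nonneg_left ((le_abs_self _).trans hb2)
      (by positivity : 0 ≤ κ ^ 3 * v x ^ 2)
    nlinarith
  have t2 : (8 / 5 * v x ^ 5) ≤ v x ^ 2 * (σ / 2 + P * |R x|) := by
    have h1 : v x ^ 5 ≤ v x ^ 2 * |v x| ^ 3 := by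
      have : v x ^ 3 ≤ |v x| ^ 3 := by rw [← abs_pow]; exact le_abs_self _
      calc v x ^ 5 = v x ^ 2 * v x ^ 3 := by ring
        _ ≤ _ := mul_le_mul_of_nonneg_left this (sq_nonneg _)
    have h2 := mul_le_mul_of_nonneg_left (hv x) (sq_nonneg (v x))
    linarith
  have t3 := mul_le_mul_of_nonneg_left t2 (by positivity : 0 ≤ κ * bell (-κ * x))
  have t4 := mul_le_mul_of_nonneg_right hκσ (by positivity : 0 ≤ κ * bell (-κ * x) * v x ^ 2)
  have t5 : κ * bell (-κ * x) * v x ^ 2 * (P * |R x|) ≤ κ * sigmoid (-κ * x) * K * (P * |R x|) := by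
    have h1 := hK x
    have h2 := sigmoid_pos (-κ * x)
    gcongr
  have t6 : 0 ≤ v1 x ^ 2 * (3 * κ * bell (-κ * x)) := by positivity
  simp only [N]
  nlinarith

lemma integral_exp_neg_mul_Icc_le {γ a b : ℝ} (hγ : 0 < γ) (hab : a ≤ b) :
    ∫ t in Set.Icc a b, exp (-(γ * t)) ≤ exp (-(γ * a)) / γ := by
  rw [integral_Icc_eq_integral_Ioc, ← intervalIntegral.integral_of_le hab,
    intervalIntegral.integral_eq_sub_of_hasDerivAt (f := fun t => -(exp (-(γ * t)) / γ))]
  · have := div_pos (exp_pos (-(γ * b))) hγ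
    linarith
  · intro t _
    have h : HasDerivAt (fun t => exp (-(γ * t))) (exp (-(γ * t)) * (-γ)) t :=
      (((hasDerivAt_id t).const_mul γ).neg.congr_deriv (by simp)).exp
    exact (h.div_const γ).neg.congr_deriv (by field_simp)
  · exact Continuous.intervalIntegrable (by fun_prop) _ _

namespace IsTrain

variable {u u1 u2 u3 : ℝ → ℝ → ℝ} {s : Finset ℕ} {a Δ : ℕ → ℝ}

lemma exists_cube_le (hu : IsSol u u1 u2 u3) (h : IsTrain u u1 s a Δ) {σ : ℝ} (hσ : 0 < σ) :
    ∃ P T, 0 ≤ P ∧ 0 ≤ T ∧ ∀ t, T ≤ t → ∀ x,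
      8 / 5 * |u t x| ^ 3 ≤ σ / 2 + P * |train s a Δ t x| := by
  obtain ⟨B, B0, hB⟩ := exists_train_le h.pos Δ
  set θ := min 1 (σ / 13)
  have θ0 : 0 < θ := lt_min one_pos (by positivity)
  have θ1 : θ ≤ 1 := min_le_left _ _
  have θ2 : θ ≤ σ / 13 := min_le_right _ _
  obtain ⟨T, hT⟩ := eventually_atTop.1 (h.lim.eventually (gt_mem_nhds (pow_pos θ0 2)))
  refine ⟨32 / 5 * B ^ 2, max T 0, by positivity, le_max_right _ _, fun t ht x => ?_⟩
  have h1 := (h.sq_error_le hu t x).trans (hT t ((le_max_left _ _).trans ht)).le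
  have h2 : |u t x - train s a Δ t x| ≤ θ := abs_le_of_sq_le_sq h1 θ0.le
  have h3 : |u t x| ≤ θ + |train s a Δ t x| := by
    have := abs_sub_abs_le_abs_sub (u t x) (train s a Δ t x)
    linarith
  set r := |train s a Δ t x|
  have r0 : 0 ≤ r := abs_nonneg _
  have h4 : |u t x| ^ 3 ≤ (θ + r) ^ 3 := pow_le_pow_left₀ (abs_nonneg _) h3 3
  have h5 : (θ + r) ^ 3 ≤ 4 * θ ^ 3 + 4 * r ^ 3 := by
    nlinarith [mul_nonneg (add_nonneg θ0.le r0) (sq_nonneg (θ - r))]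
  have h6 : θ ^ 3 ≤ θ := by nlinarith [mul_nonneg θ0.le (sub_nonneg.2 θ1), sq_nonneg θ]
  have h7 : r ^ 3 ≤ B ^ 2 * r := by
    have : r ^ 2 ≤ B ^ 2 := pow_le_pow_left₀ r0 (hB t x) 2
    nlinarith
  nlinarith

/-- The mass to the left of a slow line is exponentially small. -/
lemma exists_left_decay (hu : IsSol u u1 u2 u3) (h : IsTrain u u1 s a Δ) :
    ∃ σ κ A γ T, 0 < σ ∧ 0 < κ ∧ 0 ≤ A ∧ 0 < γ ∧ 0 ≤ T ∧ ∀ t, T ≤ t →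
      ∫ x, u t (x + σ * t) ^ 2 * sigmoid (-κ * x) ≤ A * exp (-(γ * t)) ∧
      Integrable (fun x => |train s a Δ t (x + σ * t)| * sigmoid (-κ * x)) ∧
      ∫ x, |train s a Δ t (x + σ * t)| * sigmoid (-κ * x) ≤ A * exp (-(γ * t)) := by
  obtain ⟨σ, σ0, hσ⟩ := exists_pos_le s (fun j => a j ^ 6 / 2) fun j hj =>
    half_pos (pow_pos (h.pos j hj) 6)
  set κ := min 1 (σ / 2) with hκdef
  have κ0 : 0 < κ := lt_min one_pos (half_pos σ0)
  have κ1 : κ ≤ 1 := min_le_left _ _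
  have κσ : κ ^ 2 ≤ σ / 2 := by
    have : κ ≤ σ / 2 := min_le_right _ _
    nlinarith
  obtain ⟨P, T, P0, T0, hP⟩ := h.exists_cube_le hu σ0
  obtain ⟨A, γ, A0, γ0, hA⟩ := exists_train_mul_sigmoid_le Δ h.pos σ0 κ0
    fun j hj => by linarith [hσ j hj]
  obtain ⟨K, hK⟩ := hu.exists_bound
  obtain ⟨B, B0, hB⟩ := exists_train_le h.pos Δ
  have K0 : 0 ≤ K := (hu.hNorm_nonneg 0).trans (hK 0)
  have i0 : ∀ t, Integrable fun x => u t (x + σ * t) ^ 2 := fun t =>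
    (hu.i0 t).comp_add_right (σ * t)
  have i1 : ∀ t, Integrable fun x => u1 t (x + σ * t) ^ 2 := fun t =>
    (hu.i1 t).comp_add_right (σ * t)
  have e0 : ∀ t, ∫ x, u t (x + σ * t) ^ 2 ≤ K := fun t => by
    rw [integral_add_right_eq_self (fun x => u t x ^ 2)]; exact (hu.mass_le t).trans (hK t)
  have e1 : ∀ t, ∫ x, u1 t (x + σ * t) ^ 2 ≤ K := fun t => by
    rw [integral_add_right_eq_self (fun x => u1 t x ^ 2)]; exact (hu.deriv_le t).trans (hK t)
  have hf := hu.moving σ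
  set v : ℝ → ℝ → ℝ := fun t x => u t (x + σ * t) with hv
  set v1 : ℝ → ℝ → ℝ := fun t x => u1 t (x + σ * t) with hv1
  have cv := fun t => continuous_section hf.c0 t
  have cv1 := fun t => continuous_section hf.c1 t
  have v2 : ∀ t x, v t x ^ 2 ≤ K := fun t x => (hu.sq_le_hNorm t _).trans (hK t)
  let L : ℝ := 2 * K ^ 3 + 2 * σ ^ 2
  have hS : ∀ t x, (v t x ^ 4 - σ * v t x) ^ 2 ≤ L * v t x ^ 2 := fun t x => by
    have h1 : (v t x ^ 2) ^ 3 ≤ K ^ 3 := pow_le_pow_left₀ (sq_nonneg _) (v2 t x) 3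
    have h2 := mul_le_mul_of_nonneg_right h1 (sq_nonneg (v t x))
    simp only [L]
    nlinarith [sq_nonneg (v t x ^ 4 + σ * v t x)]
  have L0 : 0 ≤ L := by positivity
  have iS : ∀ t, Integrable fun x => (v t x ^ 4 - σ * v t x) ^ 2 := fun t => by
    refine ((i0 t).const_mul L).mono' (by have c := cv t; fun_prop)
      (Eventually.of_forall fun x => ?_)
    rw [norm_eq_abs, abs_of_nonneg (sq_nonneg _)]
    exact hS t x
  have eS : ∀ t, ∫ x, (v t x ^ 4 - σ * v t x) ^ 2 ≤ L * K := fun t =>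
    (integral_mono (iS t) ((i0 t).const_mul L) (hS t)).trans (by
      rw [integral_const_mul]; exact mul_le_mul_of_nonneg_left (e0 t) L0)
  have hsl : ∀ t, T ≤ t → -(κ * K * P * A) * exp (-(γ * t)) ≤ ∫ x,
      (v t x ^ 2 * ((-κ) ^ 3 * bell2 (-κ * x)) - 3 * v1 t x ^ 2 * (-κ * bell (-κ * x))
        + 2 * (v1 t x * sigmoid (-κ * x) + v t x * (-κ * bell (-κ * x)))
          * (v t x ^ 4 - σ * v t x)) := fun t ht => by
    have hAt := hA t (T0.trans ht)
    refine le_trans ?_ (mass_production_ge (R := fun x => train s a Δ t (x + σ * t)) (hf.d0 t)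
      (cv1 t) (i0 t) (i1 t) (v2 t) κ0 κσ P0 (fun x => hP t ht _) hAt.1)
    have := mul_le_mul_of_nonneg_left hAt.2 (by positivity : 0 ≤ κ * K * P)
    linarith
  have bw : ∀ x, |sigmoid (-κ * x)| ≤ 1 ∧ |-κ * bell (-κ * x)| ≤ 1 ∧
      |(-κ) ^ 2 * bell1 (-κ * x)| ≤ 1 ∧ |(-κ) ^ 3 * bell2 (-κ * x)| ≤ 1 := by
    intro x
    have hk : ∀ n : ℕ, |(-κ) ^ n| ≤ 1 := fun n => by
      rw [abs_pow, abs_neg, abs_of_pos κ0]; exact pow_le_one₀ κ0.le κ1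
    have hk1 := hk 1
    rw [pow_one] at hk1
    have hm : ∀ {p q : ℝ}, |p| ≤ 1 → |q| ≤ 1 → |p * q| ≤ 1 := fun hp hq => by
      rw [abs_mul]; exact mul_le_one₀ hp (abs_nonneg _) hq
    exact ⟨abs_sigmoid_le _, hm hk1 (abs_bell_le _), hm (hk 2) (abs_bell1_le_one _),
      hm (hk 3) (abs_bell2_le_one _)⟩
  have step : ∀ t b, T ≤ t → t ≤ b → ∫ x, v t x ^ 2 * sigmoid (-κ * x)
      ≤ κ * K * P * A / γ * exp (-(γ * t)) + ∫ x, v b x ^ 2 * sigmoid (-κ * x) := by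
    intro t b ht hb
    have key := hf.mass (isWeight_sigmoid (-κ)) (K := K + L * K) (B := 1) hb (fun x => ?_)
      (fun t _ => i0 t) (fun t _ => i1 t) (fun t _ => iS t)
      (fun t _ => (e0 t).trans (by nlinarith)) (fun t _ => (e1 t).trans (by nlinarith))
      (fun t _ => (eS t).trans (by linarith))
    · have c0 := hf.c0
      have c1 := hf.c1
      have cS : Continuous fun p : ℝ × ℝ => v p.1 p.2 ^ 4 - σ * v p.1 p.2 := hf.cS
      have cs : Continuous fun p : ℝ × ℝ => sigmoid (-κ * p.2) :=
        continuous_sigmoid.comp (by fun_prop)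
      have cb : Continuous fun p : ℝ × ℝ => -κ * bell (-κ * p.2) :=
        (continuous_bell.comp (by fun_prop)).const_mul _
      have cb2 : Continuous fun p : ℝ × ℝ => (-κ) ^ 3 * bell2 (-κ * p.2) :=
        (continuous_bell2.comp (by fun_prop)).const_mul _
      have j0 : Integrable (fun p : ℝ × ℝ => v p.1 p.2 ^ 2) (slab t b) :=
        (integrable_slab (F := fun t x => v t x ^ 2) hb (by simp only [Function.uncurry_def]; fun_prop) (fun _ _ => sq_nonneg _)
          (fun t _ => i0 t) (fun t _ => e0 t)).1
      have j1 : Integrable (fun p : ℝ × ℝ => v1 p.1 p.2 ^ 2) (slab t b) :=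
        (integrable_slab (F := fun t x => v1 t x ^ 2) hb (by simp only [Function.uncurry_def]; fun_prop) (fun _ _ => sq_nonneg _)
          (fun t _ => i1 t) (fun t _ => e1 t)).1
      have jS : Integrable (fun p : ℝ × ℝ => (v p.1 p.2 ^ 4 - σ * v p.1 p.2) ^ 2) (slab t b) :=
        (integrable_slab (F := fun t x => (v t x ^ 4 - σ * v t x) ^ 2) hb
          (by simp only [Function.uncurry_def]; fun_prop)
          (fun _ _ => sq_nonneg _) (fun t _ => iS t) (fun t _ => eS t)).1
      have hm : ∀ {g φ : ℝ × ℝ → ℝ}, Integrable g (slab t b) → Continuous φ →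
          (∀ p, |φ p| ≤ 1) → Integrable (fun p => g p * φ p) (slab t b) := fun hg cφ hB =>
        hg.mul_bdd (c := 1) cφ.aestronglyMeasurable (Eventually.of_forall hB)
      have jG : Integrable (fun p : ℝ × ℝ => v p.1 p.2 ^ 2 * ((-κ) ^ 3 * bell2 (-κ * p.2))
          - 3 * v1 p.1 p.2 ^ 2 * (-κ * bell (-κ * p.2))
          + 2 * (v1 p.1 p.2 * sigmoid (-κ * p.2) + v p.1 p.2 * (-κ * bell (-κ * p.2)))
            * (v p.1 p.2 ^ 4 - σ * v p.1 p.2)) (slab t b) := by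
        refine (((hm j0 cb2 fun p => (bw p.2).2.2.2).sub
          (hm (j1.const_mul 3) cb fun p => (bw p.2).2.1)).add
          (((hm (integrable_mul_of_sq c1.aestronglyMeasurable cS.aestronglyMeasurable j1 jS) cs
              fun p => (bw p.2).1).const_mul 2).add
            ((hm (integrable_mul_of_sq c0.aestronglyMeasurable cS.aestronglyMeasurable j0 jS) cb
              fun p => (bw p.2).2.1).const_mul 2))).congr (Eventually.of_forall fun p => ?_)
        simp only [Pi.add_apply, Pi.sub_apply]
        ring
      have h1 : ∫ t in Set.Icc t b, -(κ * K * P * A) * exp (-(γ * t))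
          ≤ ∫ t in Set.Icc t b, ∫ x, (v t x ^ 2 * ((-κ) ^ 3 * bell2 (-κ * x))
            - 3 * v1 t x ^ 2 * (-κ * bell (-κ * x))
            + 2 * (v1 t x * sigmoid (-κ * x) + v t x * (-κ * bell (-κ * x)))
              * (v t x ^ 4 - σ * v t x)) :=
        setIntegral_mono_on ((Continuous.continuousOn (by fun_prop)).integrableOn_compact
          isCompact_Icc) jG.integral_prod_left measurableSet_Icc
          fun r hr => hsl r (ht.trans hr.1)
      rw [integral_const_mul] at h1
      have h2 := mul_le_mul_of_nonneg_left (integral_exp_neg_mul_Icc_le γ0 hb)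
        (by positivity : 0 ≤ κ * K * P * A)
      rw [integral_prod _ jG] at key
      have h3 : κ * K * P * A / γ * exp (-(γ * t)) = κ * K * P * A * (exp (-(γ * t)) / γ) := by
        ring
      rw [h3]
      linarith
    · exact bw x
  refine ⟨σ, κ, κ * K * P * A / γ + A, γ, T, σ0, κ0, by positivity, γ0, T0, fun t ht => ?_⟩
  have hAt := hA t (T0.trans ht)
  have hc : 0 ≤ κ * K * P * A / γ := by positivity
  have e0t := exp_pos (-(γ * t))
  refine ⟨le_trans ?_ (mul_le_mul_of_nonneg_right (le_add_of_nonneg_right A0) e0t.le), hAt.1,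
    hAt.2.trans (mul_le_mul_of_nonneg_right (le_add_of_nonneg_left hc) e0t.le)⟩
  have hlim : Tendsto (fun b => κ * K * P * A / γ * exp (-(γ * t))
      + (2 * (∫ x, (u b x - train s a Δ b x) ^ 2) + 2 * B * (A * exp (-(γ * b))))) atTop
      (nhds (κ * K * P * A / γ * exp (-(γ * t)) + (2 * 0 + 2 * B * (A * 0)))) := by
    have e2 : Tendsto (fun t => exp (-(γ * t))) atTop (nhds 0) :=
      tendsto_exp_neg_atTop_nhds_zero.comp (tendsto_id.const_mul_atTop γ0)
    exact ((((h.tendsto_error hu).1.const_mul 2).add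
      ((e2.const_mul A).const_mul (2 * B))).const_add _)
  rw [mul_zero, mul_zero, mul_zero, add_zero, add_zero] at hlim
  refine ge_of_tendsto hlim (eventually_atTop.2 ⟨t, fun b hb => (step t b ht hb).trans ?_⟩)
  refine add_le_add_right ?_ _
  have hAb := hA b ((T0.trans ht).trans hb)
  have iε := (h.integrable_error hu b).1.comp_add_right (σ * b)
  have eε := integral_add_right_eq_self (μ := volume) (fun x => (u b x - train s a Δ b x) ^ 2) (σ * b)
  rw [← eε]
  refine le_trans ?_ (add_le_add_right (mul_le_mul_of_nonneg_left hAb.2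
    (by positivity : 0 ≤ 2 * B)) _)
  rw [← integral_const_mul, ← integral_const_mul,
    ← integral_add (iε.const_mul 2) (hAb.1.const_mul (2 * B))]
  have cs : Continuous fun x : ℝ => sigmoid (-κ * x) := continuous_sigmoid.comp (by fun_prop)
  refine integral_mono ((i0 b).mul_bdd (c := 1) cs.aestronglyMeasurable
    (Eventually.of_forall fun x => abs_sigmoid_le _))
    ((iε.const_mul 2).add (hAb.1.const_mul (2 * B))) fun x => ?_
  have s0 := sigmoid_pos (-κ * x)
  have s1 := (sigmoid_lt_one (-κ * x)).le
  have hBx := hB b (x + σ * b)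
  simp only [hv]
  generalize hU : u b (x + σ * b) = U
  generalize train s a Δ b (x + σ * b) = R at *
  generalize sigmoid (-κ * x) = q at *
  have q1 : U ^ 2 ≤ 2 * (U - R) ^ 2 + 2 * R ^ 2 := by nlinarith [sq_nonneg (U - 2 * R)]
  have q2 : R ^ 2 ≤ B * |R| := by
    rw [← sq_abs, sq]; exact mul_le_mul_of_nonneg_right hBx (abs_nonneg _)
  have q3 := mul_le_mul_of_nonneg_right q1 s0.le
  have q4 := mul_le_mul_of_nonneg_right q2 s0.le
  have q5 := mul_le_of_le_one_right (sq_nonneg (U - R)) s1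
  nlinarith

end IsTrain

section
variable {w w1 w2 w3 S S1 v v1 v2 v3 R R1 : ℝ → ℝ → ℝ} {f f1 f2 f3 : ℝ → ℝ}

/-- The balance law of a linear functional with a compactly supported weight. -/
lemma IsFlow.linear_balance (hw : IsFlow w w1 w2 w3 S S1) (hf : IsWeight f f1 f2 f3) {a b r : ℝ}
    (hab : a ≤ b)
    (hz : ∀ x, r ≤ |x| → f x = 0 ∧ f1 x = 0 ∧ f2 x = 0 ∧ f3 x = 0) :
    (∫ x, w b x * f x) - ∫ x, w a x * f x
      = ∫ p : ℝ × ℝ, (w p.1 p.2 * f3 p.2 + S p.1 p.2 * f1 p.2) ∂(slab a b) := by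
  have c0 := hw.c0
  have c1 := hw.c1
  have c2 := hw.c2
  have c3 := hw.c3
  have cS := hw.cS
  have cS1 := hw.cS1
  have k0 := continuous_of_hasDerivAt hf.d0
  have k1 := continuous_of_hasDerivAt hf.d1
  have k2 := continuous_of_hasDerivAt hf.d2
  have k3 := hf.c3
  refine integral_sub_eq_integral_slab (R := r)
    (A := fun t x => w t x * f x)
    (At := fun t x => -(w3 t x + S1 t x) * f x)
    (Ξ := fun t x => -(w2 t x * f x) - S t x * f x + w1 t x * f1 x - w t x * f2 x)
    (Ξx := fun t x => -(w3 t x + S1 t x) * f x - S t x * f1 x - w t x * f3 x)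
    (Θ := fun t x => w t x * f3 x + S t x * f1 x) hab ?_ ?_ ?_ ?_ ?_ ?_ ?_ ?_ ?_
  · intro t x
    exact (hw.dt t x).mul_const (f x)
  · intro t x
    have h0 := hw.d0 t x
    have h1 := hw.d1 t x
    have h2 := hw.d2 t x
    have hS := hw.dS t x
    have e0 := hf.d0 x
    have e1 := hf.d1 x
    have e2 := hf.d2 x
    exact ((((h2.mul e0).neg.sub (hS.mul e0)).add (h1.mul e1)).sub (h0.mul e2)).congr_deriv
      (by ring)
  · intro t x; ring
  · simp only [Function.uncurry_def]; fun_prop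
  · simp only [Function.uncurry_def]; fun_prop
  · simp only [Function.uncurry_def]; fun_prop
  all_goals
    intro t x hx
    obtain ⟨z0, z1, z2, z3⟩ := hz x hx
    simp [z0, z1, z2, z3]

lemma IsFlow.sub (hw : IsFlow w w1 w2 w3 S S1) (hv : IsFlow v v1 v2 v3 R R1) :
    IsFlow (fun t x => w t x - v t x) (fun t x => w1 t x - v1 t x) (fun t x => w2 t x - v2 t x)
      (fun t x => w3 t x - v3 t x) (fun t x => S t x - R t x) (fun t x => S1 t x - R1 t x) where
  dt t x := ((hw.dt t x).fun_sub (hv.dt t x)).congr_deriv (by ring)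
  d0 t x := (hw.d0 t x).fun_sub (hv.d0 t x)
  d1 t x := (hw.d1 t x).fun_sub (hv.d1 t x)
  d2 t x := (hw.d2 t x).fun_sub (hv.d2 t x)
  dS t x := (hw.dS t x).fun_sub (hv.dS t x)
  c0 := hw.c0.sub hv.c0
  c1 := hw.c1.sub hv.c1
  c2 := hw.c2.sub hv.c2
  c3 := hw.c3.sub hv.c3
  cS := hw.cS.sub hv.cS
  cS1 := hw.cS1.sub hv.cS1

lemma IsFlow.sum {s : Finset ℕ} {W W1 W2 W3 Z Z1 : ℕ → ℝ → ℝ → ℝ}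
    (h : ∀ j, IsFlow (W j) (W1 j) (W2 j) (W3 j) (Z j) (Z1 j)) :
    IsFlow (fun t x => ∑ j ∈ s, W j t x) (fun t x => ∑ j ∈ s, W1 j t x)
      (fun t x => ∑ j ∈ s, W2 j t x) (fun t x => ∑ j ∈ s, W3 j t x)
      (fun t x => ∑ j ∈ s, Z j t x) (fun t x => ∑ j ∈ s, Z1 j t x) where
  dt t x := (HasDerivAt.fun_sum fun j _ => (h j).dt t x).congr_deriv (by
    rw [Finset.sum_neg_distrib, Finset.sum_add_distrib])
  d0 t x := HasDerivAt.fun_sum fun j _ => (h j).d0 t x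
  d1 t x := HasDerivAt.fun_sum fun j _ => (h j).d1 t x
  d2 t x := HasDerivAt.fun_sum fun j _ => (h j).d2 t x
  dS t x := HasDerivAt.fun_sum fun j _ => (h j).dS t x
  c0 := continuous_finsetSum _ fun j _ => (h j).c0
  c1 := continuous_finsetSum _ fun j _ => (h j).c1
  c2 := continuous_finsetSum _ fun j _ => (h j).c2
  c3 := continuous_finsetSum _ fun j _ => (h j).c3
  cS := continuous_finsetSum _ fun j _ => (h j).cS
  cS1 := continuous_finsetSum _ fun j _ => (h j).cS1

end

/-- A travelling wave solves the equation. -/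
lemma isFlow_wave (a d : ℝ) :
    IsFlow (fun t x => wave a (x - (a ^ 6 * t + d))) (fun t x => wave1 a (x - (a ^ 6 * t + d)))
      (fun t x => a ^ 6 * wave a (x - (a ^ 6 * t + d)) - wave a (x - (a ^ 6 * t + d)) ^ 4)
      (fun t x => a ^ 6 * wave1 a (x - (a ^ 6 * t + d))
        - 4 * wave a (x - (a ^ 6 * t + d)) ^ 3 * wave1 a (x - (a ^ 6 * t + d)))
      (fun t x => wave a (x - (a ^ 6 * t + d)) ^ 4)
      (fun t x => 4 * wave a (x - (a ^ 6 * t + d)) ^ 3 * wave1 a (x - (a ^ 6 * t + d))) := by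
  have hx : ∀ t x, HasDerivAt (fun x : ℝ => x - (a ^ 6 * t + d)) 1 x := fun t x =>
    (hasDerivAt_id x).sub_const _
  have ht : ∀ t x, HasDerivAt (fun t : ℝ => x - (a ^ 6 * t + d)) (-(a ^ 6)) t := fun t x =>
    (((hasDerivAt_id t).const_mul (a ^ 6)).add_const d |>.const_sub x).congr_deriv (by simp)
  have d0 : ∀ t x, HasDerivAt (fun x => wave a (x - (a ^ 6 * t + d)))
      (wave1 a (x - (a ^ 6 * t + d))) x := fun t x =>
    ((hasDerivAt_wave a _).comp x (hx t x)).congr_deriv (mul_one _)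
  have d1 : ∀ t x, HasDerivAt (fun x => wave1 a (x - (a ^ 6 * t + d)))
      (a ^ 6 * wave a (x - (a ^ 6 * t + d)) - wave a (x - (a ^ 6 * t + d)) ^ 4) x := fun t x =>
    ((hasDerivAt_wave1 a _).comp x (hx t x)).congr_deriv (mul_one _)
  have d4 : ∀ t x, HasDerivAt (fun x => wave a (x - (a ^ 6 * t + d)) ^ 4)
      (4 * wave a (x - (a ^ 6 * t + d)) ^ 3 * wave1 a (x - (a ^ 6 * t + d))) x := fun t x =>
    ((d0 t x).fun_pow 4).congr_deriv (by norm_num)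
  have c0 : Continuous fun p : ℝ × ℝ => wave a (p.2 - (a ^ 6 * p.1 + d)) :=
    (continuous_wave a).comp (by fun_prop)
  have c1 : Continuous fun p : ℝ × ℝ => wave1 a (p.2 - (a ^ 6 * p.1 + d)) :=
    (continuous_wave1 a).comp (by fun_prop)
  refine ⟨fun t x => ?_, d0, d1, fun t x => ((d0 t x).const_mul _).sub (d4 t x), d4, c0, c1, ?_, ?_,
    ?_, ?_⟩
  · exact ((hasDerivAt_wave a _).comp t (ht t x)).congr_deriv (by ring)
  all_goals fun_prop

lemma IsCutoff.one_le {χ χ1 χ2 χ3 : ℝ → ℝ} {C : ℝ} (h : IsCutoff χ χ1 χ2 χ3 C) : 1 ≤ C := by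
  have := (h.bd 0).1
  rwa [h.eq_one 0 (by simp), abs_one] at this

lemma IsCutoff.isWeight {χ χ1 χ2 χ3 : ℝ → ℝ} {C : ℝ} (h : IsCutoff χ χ1 χ2 χ3 C) (r : ℝ) :
    IsWeight (fun x => χ (x * r)) (fun x => r * χ1 (x * r)) (fun x => r ^ 2 * χ2 (x * r))
      (fun x => r ^ 3 * χ3 (x * r)) := by
  have hd : ∀ {f f' : ℝ → ℝ}, (∀ x, HasDerivAt f (f' x) x) → ∀ x,
      HasDerivAt (fun x => f (x * r)) (r * f' (x * r)) x := fun hf x => by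
    have := (hf (x * r)).comp x ((hasDerivAt_id x).mul_const r)
    exact this.congr_deriv (by simp [mul_comm])
  refine ⟨hd h.d0, fun x => ((hd h.d1 x).const_mul r).congr_deriv (by ring),
    fun x => ((hd h.d2 x).const_mul (r ^ 2)).congr_deriv (by ring), ?_⟩
  have := h.c3
  fun_prop

lemma IsCutoff.eq_zero_of_le {χ χ1 χ2 χ3 : ℝ → ℝ} {C r : ℝ} (h : IsCutoff χ χ1 χ2 χ3 C)
    (hr : 0 < r) {x : ℝ} (hx : 2 / r ≤ |x|) :
    χ (x * r) = 0 ∧ r * χ1 (x * r) = 0 ∧ r ^ 2 * χ2 (x * r) = 0 ∧ r ^ 3 * χ3 (x * r) = 0 := by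
  obtain ⟨z0, z1, z2, z3⟩ := h.eq_zero (x * r) (by
    rw [abs_mul, abs_of_pos hr]
    exact (div_le_iff₀ hr).1 hx)
  simp [z0, z1, z2, z3]

lemma integrable_indicator_Icc (a b : ℝ) :
    Integrable ((Set.Icc a b).indicator fun _ => (1 : ℝ)) :=
  (integrable_indicator_iff measurableSet_Icc).2 (integrable_const _)

lemma integral_indicator_Icc {a b : ℝ} (hab : a ≤ b) :
    ∫ x, (Set.Icc a b).indicator (fun _ => (1 : ℝ)) x = b - a := by
  rw [integral_indicator measurableSet_Icc]
  simp [hab]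

/-- The flux through a wide cutoff is controlled by the mass of `f` and the `L¹` norm of `g`. -/
lemma IsCutoff.abs_integral_flux_le {χ χ1 χ2 χ3 : ℝ → ℝ} {C r : ℝ} (h : IsCutoff χ χ1 χ2 χ3 C)
    (hr : 0 < r) {f g : ℝ → ℝ} (hf : Integrable fun x => f x ^ 2) (hg : Integrable g) :
    |∫ x, (f x * (r ^ 3 * χ3 (x * r)) + g x * (r * χ1 (x * r)))|
      ≤ C * r ^ 3 * ((∫ x, f x ^ 2) + 4 / r) + C * r * ∫ x, |g x| := by
  have C0 : 0 ≤ C := zero_le_one.trans h.one_le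
  have hi := integrable_indicator_Icc (-(2 / r)) (2 / r)
  have e := integral_indicator_Icc (a := -(2 / r)) (b := 2 / r)
    (by have : 0 < 2 / r := by positivity
        linarith)
  have e4 : 4 / r = 2 / r - -(2 / r) := by ring
  have hfi : Integrable fun x =>
      f x ^ 2 + (Set.Icc (-(2 / r)) (2 / r)).indicator (fun _ => (1 : ℝ)) x := hf.add hi
  rw [e4, ← e, ← integral_add hf hi, ← integral_const_mul, ← integral_const_mul,
    ← integral_add (hfi.const_mul _) (hg.abs.const_mul _)]
  refine (abs_integral_le_integral_abs).trans (integral_mono_of_nonneg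
    (Eventually.of_forall fun x => abs_nonneg _)
    ((hfi.const_mul _).add (hg.abs.const_mul _)) (Eventually.of_forall fun x => ?_))
  have r3 : 0 < r ^ 3 := by positivity
  have a1 : |g x * (r * χ1 (x * r))| ≤ C * r * |g x| := by
    rw [abs_mul, abs_mul, abs_of_pos hr]
    have := mul_le_mul_of_nonneg_left (h.bd (x * r)).2.1 (mul_nonneg hr.le (abs_nonneg (g x)))
    linarith
  have a2 : |f x * (r ^ 3 * χ3 (x * r))|
      ≤ C * r ^ 3 * (f x ^ 2 + (Set.Icc (-(2 / r)) (2 / r)).indicator (fun _ => (1 : ℝ)) x) := by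
    by_cases hx : x ∈ Set.Icc (-(2 / r)) (2 / r)
    · rw [Set.indicator_of_mem hx, abs_mul, abs_mul, abs_of_pos r3]
      have q1 : |f x| ≤ f x ^ 2 + 1 := by
        rw [← sq_abs]; nlinarith [sq_nonneg (|f x| - 1), sq_nonneg (|f x|)]
      calc |f x| * (r ^ 3 * |χ3 (x * r)|) ≤ (f x ^ 2 + 1) * (r ^ 3 * C) :=
            mul_le_mul q1 (mul_le_mul_of_nonneg_left (h.bd (x * r)).2.2.2 r3.le)
              (by positivity) (by positivity)
        _ = _ := by ring
    · rw [(h.eq_zero_of_le hr (x := x) ?_).2.2.2, mul_zero, abs_zero,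
        Set.indicator_of_notMem hx]
      · positivity
      · rw [Set.mem_Icc, ← abs_le, not_le] at hx
        exact hx.le
  exact (abs_add_le _ _).trans (add_le_add a2 a1)

/-- Estimate of a truncated integral in terms of weighted norms. -/
lemma abs_integral_sub_mul_le {U R Φ q : ℝ → ℝ} {C L l : ℝ} (hL : 0 ≤ L) (hl : 0 < l)
    (hΦ : ∀ x, |Φ x| ≤ C) (hz : ∀ x, x ∉ Set.Icc (-L) 0 → Φ x = 0) (hq : ∀ x, 0 ≤ q x)
    (hq' : ∀ x ∈ Set.Icc (-L) 0, 1 / 2 ≤ q x) (hU : Integrable fun x => U x ^ 2 * q x)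
    (hR : Integrable fun x => |R x| * q x) :
    |∫ x, (U x - R x) * Φ x|
      ≤ l * (∫ x, U x ^ 2 * q x) + C ^ 2 / (2 * l) * L + 2 * C * ∫ x, |R x| * q x := by
  have C0 : 0 ≤ C := (abs_nonneg _).trans (hΦ 0)
  have hi := integrable_indicator_Icc (-L) 0
  have e := integral_indicator_Icc (a := -L) (b := 0) (by linarith)
  rw [zero_sub, neg_neg] at e
  have hUi : Integrable fun x => l * (U x ^ 2 * q x)
      + C ^ 2 / (2 * l) * (Set.Icc (-L) 0).indicator (fun _ => (1 : ℝ)) x :=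
    (hU.const_mul _).add (hi.const_mul _)
  conv_rhs => rw [← e]
  rw [← integral_const_mul, ← integral_const_mul, ← integral_const_mul,
    ← integral_add (hU.const_mul _) (hi.const_mul _),
    ← integral_add (hUi) (hR.const_mul _)]
  refine (abs_integral_le_integral_abs).trans (integral_mono_of_nonneg
    (Eventually.of_forall fun x => abs_nonneg _)
    (hUi.add (hR.const_mul _))
    (Eventually.of_forall fun x => ?_))
  by_cases hx : x ∈ Set.Icc (-L) 0
  · beta_reduce
    rw [Set.indicator_of_mem hx, mul_one, abs_mul]
    have h1 := hq' x hx
    have h2 : |U x - R x| * |Φ x| ≤ (|U x| + |R x|) * C :=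
      mul_le_mul (abs_sub _ _) (hΦ x) (abs_nonneg _) (by positivity)
    have h3 : |U x| * C ≤ l * U x ^ 2 / 2 + C ^ 2 / (2 * l) := by
      rw [← sub_nonneg]
      have : l * U x ^ 2 / 2 + C ^ 2 / (2 * l) - |U x| * C = (l * |U x| - C) ^ 2 / (2 * l) := by
        rw [← sq_abs (U x)]; field_simp; ring
      rw [this]; positivity
    have h4 := mul_le_mul_of_nonneg_left h1 (mul_nonneg hl.le (sq_nonneg (U x)))
    have h5 := mul_le_mul_of_nonneg_left h1 (mul_nonneg C0 (abs_nonneg (R x)))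
    linarith
  · beta_reduce
    rw [hz x hx, mul_zero, abs_zero]
    have := hq x
    have : 0 ≤ (Set.Icc (-L) 0).indicator (fun _ => (1 : ℝ)) x :=
      Set.indicator_nonneg (fun _ _ => zero_le_one) _
    positivity

namespace IsTrain
variable {u u1 u2 u3 : ℝ → ℝ → ℝ} {s : Finset ℕ} {a Δ : ℕ → ℝ}

lemma exists_error_bound (hu : IsSol u u1 u2 u3) (h : IsTrain u u1 s a Δ) :
    ∃ K, 0 ≤ K ∧ ∀ t, ∫ x, (u t x - train s a Δ t x) ^ 2 ≤ K ∧
      ∫ x, |u t x ^ 4 - ∑ j ∈ s, wave (a j) (x - (a j ^ 6 * t + Δ j)) ^ 4| ≤ K := by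
  obtain ⟨K, hK⟩ := hu.exists_bound
  have K0 : 0 ≤ K := (hu.hNorm_nonneg 0).trans (hK 0)
  have iw : ∀ p, p ≠ 0 → ∀ t, ∀ j ∈ s,
      Integrable fun x => wave (a j) (x - (a j ^ 6 * t + Δ j)) ^ p := fun p hp t j hj =>
    (integrable_wave_pow (h.pos j hj) hp).comp_sub_right _
  have ew : ∀ p, p ≠ 0 → ∀ t, ∫ x, ∑ j ∈ s, wave (a j) (x - (a j ^ 6 * t + Δ j)) ^ p
      = ∑ j ∈ s, ∫ x, wave (a j) x ^ p := fun p hp t => by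
    rw [integral_finsetSum _ (iw p hp t)]
    exact Finset.sum_congr rfl fun j _ =>
      integral_sub_right_eq_self (fun x => wave (a j) x ^ p) _
  have M2 : ∀ t, ∫ x, u t x ^ 2 ≤ K := fun t => (hu.mass_le t).trans (hK t)
  have n2 : 0 ≤ ∑ j ∈ s, ∫ x, wave (a j) x ^ 2 :=
    Finset.sum_nonneg fun j _ => integral_nonneg fun x => sq_nonneg _
  have n4 : 0 ≤ ∑ j ∈ s, ∫ x, wave (a j) x ^ 4 :=
    Finset.sum_nonneg fun j _ => integral_nonneg fun x => by positivity
  refine ⟨2 * K + 2 * (s.card * ∑ j ∈ s, ∫ x, wave (a j) x ^ 2)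
    + (K * K + ∑ j ∈ s, ∫ x, wave (a j) x ^ 4), by positivity, fun t => ⟨?_, ?_⟩⟩
  · have i2 := integrable_finsetSum _ (iw 2 two_ne_zero t)
    refine le_trans ?_ (le_add_of_nonneg_right (by positivity))
    refine le_trans ?_ (add_le_add_left (mul_le_mul_of_nonneg_left (M2 t) zero_le_two) _)
    rw [← ew 2 two_ne_zero t, ← integral_const_mul, ← integral_const_mul, ← integral_const_mul,
      ← integral_add ((hu.i0 t).const_mul 2) ((i2.const_mul _).const_mul _)]
    refine integral_mono_of_nonneg (Eventually.of_forall fun x => sq_nonneg _)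
      (((hu.i0 t).const_mul 2).add ((i2.const_mul _).const_mul _))
      (Eventually.of_forall fun x => ?_)
    have := sq_sum_le_card_mul_sum_sq (s := s) (f := fun j => wave (a j) (x - (a j ^ 6 * t + Δ j)))
    simp only [train]
    nlinarith [sq_nonneg (u t x + ∑ j ∈ s, wave (a j) (x - (a j ^ 6 * t + Δ j)))]
  · have i4 := integrable_finsetSum _ (iw 4 four_ne_zero t)
    refine le_trans ?_ (le_add_of_nonneg_left (by positivity))
    refine le_trans ?_ (add_le_add_left (mul_le_mul_of_nonneg_left (M2 t) K0) _)
    rw [← ew 4 four_ne_zero t, ← integral_const_mul, ← integral_add ((hu.i0 t).const_mul K) i4]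
    refine integral_mono_of_nonneg (Eventually.of_forall fun x => abs_nonneg _)
      (((hu.i0 t).const_mul K).add i4) (Eventually.of_forall fun x => ?_)
    have h0 := (hu.sq_le_hNorm t x).trans (hK t)
    have h4 : u t x ^ 4 ≤ K * u t x ^ 2 := by nlinarith [sq_nonneg (u t x)]
    have h5 : 0 ≤ ∑ j ∈ s, wave (a j) (x - (a j ^ 6 * t + Δ j)) ^ 4 :=
      Finset.sum_nonneg fun j _ => by positivity
    have h6 : 0 ≤ u t x ^ 4 := by positivity
    rw [abs_le]
    constructor <;> linarith

end IsTrain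

namespace IsTrain
variable {u u1 u2 u3 : ℝ → ℝ → ℝ} {s : Finset ℕ} {a Δ : ℕ → ℝ} {χ χ1 χ2 χ3 : ℝ → ℝ} {C : ℝ}

/-- The total flux through a cutoff at distance `T` vanishes on time intervals of length `O(T)`. -/
lemma tendsto_flux (hu : IsSol u u1 u2 u3) (h : IsTrain u u1 s a Δ) (hχ : IsCutoff χ χ1 χ2 χ3 C)
    {m : ℝ} (hm : 0 < m) :
    Tendsto (fun T : ℝ => ∫ p : ℝ × ℝ, ((u p.1 p.2 - train s a Δ p.1 p.2)
      * (T⁻¹ ^ 3 * χ3 (p.2 * T⁻¹)) + (u p.1 p.2 ^ 4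
      - ∑ j ∈ s, wave (a j) (p.2 - (a j ^ 6 * p.1 + Δ j)) ^ 4) * (T⁻¹ * χ1 (p.2 * T⁻¹)))
      ∂(slab 0 (m * T))) atTop (nhds 0) := by
  obtain ⟨K, K0, hK⟩ := h.exists_error_bound hu
  have hH := h.tendsto_pow_sub hu 2
  have C0 : 0 < C := zero_lt_one.trans_le hχ.one_le
  rw [NormedAddGroup.tendsto_nhds_zero]
  intro ε ε0
  set η := ε / (2 * m * C) with hη
  have η0 : 0 < η := by positivity
  obtain ⟨T0, hT0⟩ := eventually_atTop.1 ((tendsto_order.1 hH.2).2 η η0)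
  have hlim : Tendsto (fun T : ℝ => m * C * K * (T⁻¹ * T⁻¹) + 4 * m * C * T⁻¹
      + C * K * exp T0 * T⁻¹) atTop (nhds (m * C * K * (0 * 0) + 4 * m * C * 0
      + C * K * exp T0 * 0)) := by
    have hi := tendsto_inv_atTop_zero (𝕜 := ℝ)
    exact (((hi.mul hi).const_mul _).add (hi.const_mul _)).add (hi.const_mul _)
  simp only [mul_zero, add_zero] at hlim
  filter_upwards [(tendsto_order.1 hlim).2 (ε / 2) (half_pos ε0), eventually_gt_atTop 0]
    with T hT Tpos
  have r0 : 0 < T⁻¹ := inv_pos.2 Tpos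
  have hab : 0 ≤ m * T := by positivity
  have cu := hu.flow.c0
  have cR := continuous_train s a Δ
  have cW : Continuous fun p : ℝ × ℝ => ∑ j ∈ s, wave (a j) (p.2 - (a j ^ 6 * p.1 + Δ j)) ^ 4 :=
    continuous_finsetSum _ fun j _ => (isFlow_wave (a j) (Δ j)).cS
  have c1 : Continuous χ1 := continuous_of_hasDerivAt hχ.d1
  have c3 := hχ.c3
  have jF := integrable_slab_of_continuous (a := 0) (b := m * T) (R := 2 / T⁻¹)
    (F := fun t x => (u t x - train s a Δ t x) * (T⁻¹ ^ 3 * χ3 (x * T⁻¹)) + (u t x ^ 4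
      - ∑ j ∈ s, wave (a j) (x - (a j ^ 6 * t + Δ j)) ^ 4) * (T⁻¹ * χ1 (x * T⁻¹)))
    (by simp only [Function.uncurry_def]; fun_prop) (fun t x hx => by
      obtain ⟨_, z1, _, z3⟩ := hχ.eq_zero_of_le r0 hx
      rw [z1, z3, mul_zero, mul_zero, add_zero])
  rw [integral_prod _ jF]
  have slice : ∀ t, ‖∫ x, ((u t x - train s a Δ t x) * (T⁻¹ ^ 3 * χ3 (x * T⁻¹)) + (u t x ^ 4
      - ∑ j ∈ s, wave (a j) (x - (a j ^ 6 * t + Δ j)) ^ 4) * (T⁻¹ * χ1 (x * T⁻¹)))‖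
      ≤ (C * T⁻¹ ^ 3 * (K + 4 * T) + C * T⁻¹ * η) + C * T⁻¹ * K * exp T0 * exp (-(1 * t)) := by
    intro t
    refine (hχ.abs_integral_flux_le r0 (h.integrable_error hu t).1 (hH.1 t)).trans ?_
    have e1 : (∫ x, |u t x ^ (2 + 1 + 1)
        - ∑ j ∈ s, wave (a j) (x - (a j ^ 6 * t + Δ j)) ^ (2 + 1 + 1)|)
        ≤ η + K * (exp T0 * exp (-(1 * t))) := by
      rcases le_total T0 t with ht | ht
      · exact (hT0 t ht).le.trans (le_add_of_nonneg_right (by positivity))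
      · refine (hK t).2.trans ?_
        have : 1 ≤ exp T0 * exp (-(1 * t)) := by
          rw [← exp_add]; exact one_le_exp (by linarith)
        nlinarith
    have e2 := mul_le_mul_of_nonneg_left e1 (by positivity : 0 ≤ C * T⁻¹)
    have e3 := mul_le_mul_of_nonneg_left (add_le_add_left (hK t).1 (4 * T))
      (by positivity : 0 ≤ C * T⁻¹ ^ 3)
    rw [div_inv_eq_mul]
    linarith
  calc ‖∫ t in Set.Icc 0 (m * T), ∫ x, ((u t x - train s a Δ t x) * (T⁻¹ ^ 3 * χ3 (x * T⁻¹))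
        + (u t x ^ 4 - ∑ j ∈ s, wave (a j) (x - (a j ^ 6 * t + Δ j)) ^ 4)
          * (T⁻¹ * χ1 (x * T⁻¹)))‖
      ≤ ∫ t in Set.Icc 0 (m * T), ((C * T⁻¹ ^ 3 * (K + 4 * T) + C * T⁻¹ * η)
        + C * T⁻¹ * K * exp T0 * exp (-(1 * t))) :=
        norm_integral_le_of_norm_le ((Continuous.continuousOn (by fun_prop)).integrableOn_compact
          isCompact_Icc) (Eventually.of_forall slice)
    _ ≤ m * T * (C * T⁻¹ ^ 3 * (K + 4 * T) + C * T⁻¹ * η) + C * T⁻¹ * K * exp T0 * 1 := by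
        rw [integral_add (integrable_const _)
          ((Continuous.continuousOn (by fun_prop)).integrableOn_compact isCompact_Icc),
          integral_const_mul, setIntegral_const, smul_eq_mul]
        have e := integral_exp_neg_mul_Icc_le one_pos hab
        have e' := mul_le_mul_of_nonneg_left e (by positivity : 0 ≤ C * T⁻¹ * K * exp T0)
        have ev : volume.real (Set.Icc 0 (m * T)) = m * T := by simp [hab]
        rw [ev]
        simp only [mul_zero, neg_zero, exp_zero, div_one] at e'
        linarith
    _ = m * C * K * (T⁻¹ * T⁻¹) + 4 * m * C * T⁻¹ + C * K * exp T0 * T⁻¹ + ε / 2 := by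
        rw [hη]; field_simp; ring
    _ < ε := by linarith

/-- The error to the left of the solitons is negligible at large times. -/
lemma tendsto_integral_error_mul_cutoff (hu : IsSol u u1 u2 u3) (h : IsTrain u u1 s a Δ)
    (hχ : IsCutoff χ χ1 χ2 χ3 C) :
    ∃ m, 0 < m ∧ Tendsto (fun T : ℝ => ∫ x, (u (m * T) x - train s a Δ (m * T) x) * χ (x * T⁻¹))
      atTop (nhds 0) := by
  obtain ⟨σ, κ, A, γ, T0, σ0, κ0, A0, γ0, -, hd⟩ := h.exists_left_decay hu
  have C0 : 0 < C := zero_lt_one.trans_le hχ.one_le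
  refine ⟨2 / σ, by positivity, squeeze_zero_norm' (a := fun T : ℝ =>
    A * exp (-(γ / σ * T)) + 2 * C ^ 2 * (σ / γ) * ((γ / σ * T) * exp (-(γ / σ * T)))
      + 2 * C * (A * (exp (-(γ / σ * T)) * exp (-(γ / σ * T))))) ?_ ?_⟩
  · filter_upwards [eventually_gt_atTop 0, eventually_ge_atTop (σ * T0 / 2)] with T Tpos hT
    have r0 : 0 < T⁻¹ := inv_pos.2 Tpos
    obtain ⟨h1, i2, h2⟩ := hd (2 / σ * T) (by
      rw [div_mul_eq_mul_div, le_div_iff₀ σ0]; linarith)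
    set t := 2 / σ * T with ht
    have hσt : σ * t = 2 * T := by rw [ht]; field_simp
    have cs : Continuous fun x : ℝ => sigmoid (-κ * x) := continuous_sigmoid.comp (by fun_prop)
    have i1 : Integrable fun x => u t (x + σ * t) ^ 2 * sigmoid (-κ * x) :=
      ((hu.i0 t).comp_add_right (σ * t)).mul_bdd (c := 1) cs.aestronglyMeasurable
        (Eventually.of_forall fun x => abs_sigmoid_le _)
    have key := abs_integral_sub_mul_le (U := fun x => u t (x + σ * t))
      (R := fun x => train s a Δ t (x + σ * t)) (Φ := fun x => χ ((x + σ * t) * T⁻¹))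
      (q := fun x => sigmoid (-κ * x)) (C := C) (L := 4 * T) (by positivity)
      (exp_pos (γ / σ * T)) (fun x => (hχ.bd _).1) (fun x hx => ?_)
      (fun x => (sigmoid_pos _).le) (fun x hx => ?_) i1 i2
    · rw [integral_add_right_eq_self (μ := volume)
        (fun x => (u t x - train s a Δ t x) * χ (x * T⁻¹)) (σ * t)] at key
      refine key.trans ?_
      have e1 := mul_le_mul_of_nonneg_left h1 (exp_pos (γ / σ * T)).le
      have e2 := mul_le_mul_of_nonneg_left h2 (by positivity : 0 ≤ 2 * C)
      have et : exp (-(γ * t)) = exp (-(γ / σ * T)) * exp (-(γ / σ * T)) := by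
        rw [← exp_add]; congr 1; rw [ht]; ring
      have em : exp (γ / σ * T) * exp (-(γ / σ * T)) = 1 := by rw [← exp_add]; simp
      have ec : C ^ 2 / (2 * exp (γ / σ * T)) * (4 * T)
          = 2 * C ^ 2 * (σ / γ) * ((γ / σ * T) * exp (-(γ / σ * T))) := by
        rw [exp_neg]; field_simp; ring
      have e1' : exp (γ / σ * T) * (A * exp (-(γ * t))) = A * exp (-(γ / σ * T)) := by
        rw [et]
        linear_combination A * exp (-(γ / σ * T)) * em
      rw [e1'] at e1
      rw [et] at e2
      linarith
    · refine (hχ.eq_zero_of_le r0 ?_).1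
      rw [div_inv_eq_mul, hσt]
      by_contra hlt
      rw [not_le, abs_lt] at hlt
      exact hx ⟨by linarith [hlt.1], by linarith [hlt.2]⟩
    · have : 0 ≤ -κ * x := by nlinarith [hx.2]
      have := sigmoid_monotone this
      rw [sigmoid_zero] at this
      linarith
  · have e1 : Tendsto (fun T : ℝ => γ / σ * T) atTop atTop :=
      tendsto_id.const_mul_atTop (by positivity)
    have l1 : Tendsto (fun T : ℝ => exp (-(γ / σ * T))) atTop (nhds 0) :=
      tendsto_exp_neg_atTop_nhds_zero.comp e1
    have l2 : Tendsto (fun T : ℝ => (γ / σ * T) * exp (-(γ / σ * T))) atTop (nhds 0) := by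
      have := (tendsto_pow_mul_exp_neg_atTop_nhds_zero 1).comp e1
      simpa [Function.comp_def] using this
    simpa using ((l1.const_mul A).add (l2.const_mul (2 * C ^ 2 * (σ / γ)))).add
      (((l1.mul l1).const_mul A).const_mul (2 * C))

/-- The conditionally convergent integral of the solution is the sum of those of the solitons. -/
theorem tendsto_integral_mul_cutoff (hu : IsSol u u1 u2 u3) (h : IsTrain u u1 s a Δ)
    (hχ : IsCutoff χ χ1 χ2 χ3 C) :
    Tendsto (fun T : ℝ => ∫ x, u 0 x * χ (x * T⁻¹)) atTop (nhds ((∑ j ∈ s, (a j)⁻¹) * ∫ x, Q x)) := by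
  obtain ⟨m, hm, hend⟩ := h.tendsto_integral_error_mul_cutoff hu hχ
  have hflux := h.tendsto_flux hu hχ hm
  have cχ : Continuous χ := continuous_of_hasDerivAt hχ.d0
  have cu := hu.cu 0
  have cR := continuous_section (continuous_train s a Δ) 0
  have iw : ∀ j ∈ s, Integrable fun x => wave (a j) (x - (a j ^ 6 * 0 + Δ j)) := fun j hj =>
    (integrable_wave (h.pos j hj)).comp_sub_right _
  have iR : Integrable (train s a Δ 0) := integrable_finsetSum _ iw
  have eR : ∫ x, train s a Δ 0 x = (∑ j ∈ s, (a j)⁻¹) * ∫ x, Q x := by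
    simp only [train]
    rw [integral_finsetSum _ iw, Finset.sum_mul]
    refine Finset.sum_congr rfl fun j hj => ?_
    rw [integral_sub_right_eq_self (fun x => wave (a j) x), integral_wave (h.pos j hj)]
    ring
  have hR : Tendsto (fun T : ℝ => ∫ x, train s a Δ 0 x * χ (x * T⁻¹)) atTop
      (nhds (∫ x, train s a Δ 0 x)) := by
    refine tendsto_integral_filter_of_dominated_convergence (fun x => |train s a Δ 0 x| * C)
      (Eventually.of_forall fun T => Continuous.aestronglyMeasurable (by fun_prop))
      (Eventually.of_forall fun T => Eventually.of_forall fun x => ?_) (iR.abs.mul_const C)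
      (Eventually.of_forall fun x => ?_)
    · rw [norm_eq_abs, abs_mul]
      exact mul_le_mul_of_nonneg_left (hχ.bd _).1 (abs_nonneg _)
    · have : Tendsto (fun T : ℝ => χ (x * T⁻¹)) atTop (nhds (χ (x * 0))) :=
        (cχ.tendsto _).comp (tendsto_inv_atTop_zero.const_mul x)
      rw [mul_zero, hχ.eq_one 0 (by simp)] at this
      simpa using this.const_mul (train s a Δ 0 x)
  rw [← eR]
  have := (hR.add hend).sub hflux
  rw [add_zero, sub_zero] at this
  refine this.congr' ?_
  filter_upwards [eventually_gt_atTop 0] with T Tpos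
  have r0 : 0 < T⁻¹ := inv_pos.2 Tpos
  have hfl := hu.flow.sub (IsFlow.sum (s := s) fun j => isFlow_wave (a j) (Δ j))
  have bal := hfl.linear_balance (hχ.isWeight T⁻¹) (a := 0) (b := m * T) (r := 2 / T⁻¹)
    (by positivity) fun x hx => hχ.eq_zero_of_le r0 hx
  simp only [← train.eq_1] at bal
  rw [← bal]
  have hz : ∀ f : ℝ → ℝ, Continuous f → Integrable fun x => f x * χ (x * T⁻¹) := fun f hf =>
    integrable_of_continuous_of_eq_zero (R := 2 / T⁻¹) (by fun_prop) fun x hx => by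
      rw [(hχ.eq_zero_of_le r0 hx).1, mul_zero]
  have e : ∫ x, (u 0 x - train s a Δ 0 x) * χ (x * T⁻¹)
      = (∫ x, u 0 x * χ (x * T⁻¹)) - ∫ x, train s a Δ 0 x * χ (x * T⁻¹) := by
    rw [← integral_sub (hz _ cu) (hz _ cR)]
    exact integral_congr_ae (Eventually.of_forall fun x => sub_mul _ _ _)
  rw [e]
  ring

end IsTrain

lemma H1norm_comp_neg (f : ℝ → ℝ) : H1norm (fun x => f (-x)) = H1norm f := by
  simp only [H1norm, deriv_comp_neg, neg_sq]
  rw [integral_neg_eq_self (fun x => f x ^ 2 + deriv f x ^ 2)]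

lemma Qc_neg (c x : ℝ) : Qc c (-x) = Qc c x := by
  rw [Qc, Qc, mul_neg, Q_neg]

lemma rpow_sixth_pow {c : ℝ} (hc : 0 ≤ c) : (c ^ ((1 : ℝ) / 6)) ^ 6 = c := by
  rw [← rpow_natCast, ← rpow_mul hc]; norm_num

/-- Convergence in `H¹` to a sum of solitons, in terms of the profiles `wave`. -/
lemma isTrain_of_tendsto {u u1 u2 u3 : ℝ → ℝ → ℝ} {s : Finset ℕ} {c Δ : ℕ → ℝ}
    (hu : IsSol u u1 u2 u3) (hc : ∀ j ∈ s, 0 < c j) (hinj : Set.InjOn c s)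
    (hlim : Tendsto (fun t => H1norm (fun x => u t x - ∑ j ∈ s, Qc (c j) (x - c j * t - Δ j)))
      atTop (nhds 0)) :
    IsTrain u u1 s (fun j => c j ^ ((1 : ℝ) / 6)) Δ := by
  refine ⟨fun j hj => rpow_pos_of_pos (hc j hj) _, fun i hi j hj hij => hinj hi hj ?_, ?_⟩
  · rw [← rpow_sixth_pow (hc i hi).le, ← rpow_sixth_pow (hc j hj).le]
    exact congrArg (· ^ 6) hij
  · have := hlim.pow 2
    rw [zero_pow two_ne_zero] at this
    refine this.congr fun t => ?_
    have e : (fun x => u t x - ∑ j ∈ s, Qc (c j) (x - c j * t - Δ j))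
        = fun x => u t x - train s (fun j => c j ^ ((1 : ℝ) / 6)) Δ t x := by
      funext x
      rw [train]
      congr 1
      refine Finset.sum_congr rfl fun j hj => ?_
      rw [Qc_eq_wave (hc j hj), rpow_sixth_pow (hc j hj).le, sub_sub]
    rw [e, H1norm, sq_sqrt (integral_nonneg fun x => by positivity)]
    refine integral_congr_ae (Eventually.of_forall fun x => ?_)
    beta_reduce
    rw [((hu.flow.d0 t x).fun_sub (IsTrain.hasDerivAt_train s _ Δ t x)).deriv]

lemma tendsto_reverse {u : ℝ → ℝ → ℝ} {s : Finset ℕ} {c Δ : ℕ → ℝ}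
    (hlim : Tendsto (fun t => H1norm (fun x => u t x - ∑ j ∈ s, Qc (c j) (x - c j * t - Δ j)))
      atBot (nhds 0)) :
    Tendsto (fun t => H1norm (fun x => u (-t) (-x) - ∑ j ∈ s, Qc (c j) (x - c j * t - -Δ j)))
      atTop (nhds 0) := by
  refine (hlim.comp tendsto_neg_atTop_atBot).congr fun t => ?_
  rw [Function.comp_apply, ← H1norm_comp_neg]
  congr 1
  funext x
  congr 1
  refine Finset.sum_congr rfl fun j _ => ?_
  rw [← Qc_neg]
  congr 1
  ring

lemma injOn_Icc_of_succ_lt {N : ℕ} {c : ℕ → ℝ} (h : ∀ j, 1 ≤ j → j < N → c (j + 1) < c j) :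
    Set.InjOn c (Finset.Icc 1 N) := by
  have : StrictAntiOn c (Finset.Icc 1 N : Finset ℕ) := by
    rw [Finset.coe_Icc]
    refine strictAntiOn_of_succ_lt Set.ordConnected_Icc fun j _ hj hj' => ?_
    exact h j hj.1 (Nat.lt_of_succ_le hj'.2)
  exact this.injOn

/-- The three scalar relations between the outgoing and incoming solitons. -/
lemma IsSol.train_relations {u u1 u2 u3 : ℝ → ℝ → ℝ} {s s' : Finset ℕ} {a b Δ Δ' : ℕ → ℝ}
    (hu : IsSol u u1 u2 u3) (h : IsTrain u u1 s a Δ)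
    (h' : IsTrain (fun t x => u (-t) (-x)) (fun t x => -u1 (-t) (-x)) s' b Δ') :
    ∑ j ∈ s, a j = ∑ j ∈ s', b j ∧ ∑ j ∈ s, a j ^ 7 = ∑ j ∈ s', b j ^ 7 ∧
      ∑ j ∈ s, (a j)⁻¹ = ∑ j ∈ s', (b j)⁻¹ := by
  have hv := hu.reverse
  have p1 : 0 < ∫ x, Q x := by simpa using integral_Q_pow_pos one_ne_zero
  have p2 := integral_Q_pow_pos two_ne_zero
  refine ⟨?_, ?_, ?_⟩
  · have m1 := h.mass_eq hu
    have m2 := h'.mass_eq hv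
    rw [neg_zero, integral_neg_eq_self (fun x => u 0 x ^ 2), m1] at m2
    exact mul_right_cancel₀ p2.ne' m2
  · have e1 := h.energy_eq hu
    have e2 := h'.energy_eq hv
    have e : energy (fun t x => u (-t) (-x)) (fun t x => -u1 (-t) (-x)) 0 = energy u u1 0 := by
      simp only [energy, neg_zero, neg_sq]
      rw [integral_neg_eq_self (fun x => u1 0 x ^ 2), integral_neg_eq_self (fun x => u 0 x ^ 5)]
    rw [e, e1] at e2
    refine mul_left_cancel₀ ?_ e2
    have : 0 < (∫ x, Q x ^ 2) / 14 := by positivity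
    linarith
  · obtain ⟨χ, χ1, χ2, χ3, C, hχ⟩ := exists_isCutoff
    have l1 := h.tendsto_integral_mul_cutoff hu hχ
    have l2 := h'.tendsto_integral_mul_cutoff hv hχ
    refine mul_right_cancel₀ p1.ne' (tendsto_nhds_unique l1 (l2.congr fun T => ?_))
    rw [neg_zero, ← integral_neg_eq_self (fun x => u 0 x * χ (x * T⁻¹))]
    refine integral_congr_ae (Eventually.of_forall fun x => ?_)
    beta_reduce
    rw [neg_mul, hχ.even]

/-- A combination of the conserved quantities of a solitary wave which is nonnegative and vanishes
exactly at unit speed. -/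
noncomputable def defect (a : ℝ) : ℝ := 3 * a⁻¹ - 4 * a + a ^ 7

lemma defect_mul {a : ℝ} (ha : 0 < a) : defect a * a = (a ^ 2 - 1) ^ 2 * (a ^ 4 + 2 * a ^ 2 + 3) := by
  rw [defect]; field_simp; ring

lemma defect_le {a : ℝ} (ha : 0 < a) (h : 3 / 4 ≤ a ^ 6) : defect a ≤ (1 - a ^ 6) ^ 2 := by
  refine le_of_mul_le_mul_right ?_ ha
  rw [defect_mul ha]
  have h9 : 9 / 10 ≤ a := by
    by_contra! hlt
    have := pow_le_pow_left₀ ha.le hlt.le 6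
    norm_num at this
    linarith
  have hs : (9 / 10 : ℝ) ≤ a ^ 2 := by
    by_contra! hlt
    have := pow_le_pow_left₀ (sq_nonneg a) hlt.le 3
    rw [← pow_mul] at this
    norm_num at this
    linarith
  have e : (1 - a ^ 6) ^ 2 * a
      = (a ^ 2 - 1) ^ 2 * ((1 + a ^ 2 + a ^ 4) ^ 2 * a) := by ring
  rw [e]
  refine mul_le_mul_of_nonneg_left ?_ (sq_nonneg _)
  have e4 : a ^ 4 = (a ^ 2) ^ 2 := by ring
  rw [e4]
  generalize a ^ 2 = s at hs ⊢
  have h1 := mul_le_mul_of_nonneg_left h9 (sq_nonneg (1 + s + s ^ 2))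
  refine le_trans ?_ h1
  have h2 : 271 / 100 ≤ 1 + s + s ^ 2 := by nlinarith
  nlinarith [mul_le_mul_of_nonneg_right h2 (by positivity : 0 ≤ 1 + s + s ^ 2)]

lemma pow_six_bounds_of_defect_lt {a : ℝ} (ha : 0 < a) (h : defect a < 1 / 16) :
    16 / 25 < a ^ 6 ∧ a ^ 6 < 3 / 2 := by
  have h1 : 3 - 4 * a ^ 2 + (a ^ 2) ^ 4 < a / 16 := by
    have := mul_lt_mul_of_pos_right h ha
    rw [defect_mul ha] at this
    linarith
  have tangent : ∀ p s : ℝ, 4 * p ^ 3 * s - 3 * p ^ 4 ≤ s ^ 4 := fun p s => by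
    nlinarith [sq_nonneg (s ^ 2 - p ^ 2), sq_nonneg (p * (s - p))]
  constructor
  · by_contra! hc
    have hs : a ^ 2 ≤ 431 / 500 := by
      by_contra! hlt
      have := pow_le_pow_left₀ (by norm_num) hlt.le 3
      rw [← pow_mul] at this
      norm_num at this
      linarith
    have a1 : a ≤ 1 := by nlinarith
    linarith [tangent (431 / 500) (a ^ 2)]
  · by_contra! hc
    have hs : 57 / 50 ≤ a ^ 2 := by
      by_contra! hlt
      have := pow_le_pow_left₀ (sq_nonneg a) hlt.le 3
      rw [← pow_mul] at this
      norm_num at this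
      linarith
    have a1 : a ≤ a ^ 2 := by nlinarith
    linarith [tangent (57 / 50) (a ^ 2)]

lemma defect_bounds {a : ℝ} (ha : 0 < a) :
    0 ≤ a + a⁻¹ - 2 ∧ 3 * (a + a⁻¹ - 2) ≤ defect a := by
  have e : a + a⁻¹ - 2 = (a - 1) ^ 2 / a := by field_simp; ring
  have e' : defect a = (a - 1) ^ 2 / a * ((a + 1) ^ 2 * (a ^ 4 + 2 * a ^ 2 + 3)) := by
    rw [defect]; field_simp; ring
  rw [e, e', mul_comm (3 : ℝ)]
  refine ⟨by positivity, mul_le_mul_of_nonneg_left ?_ (by positivity)⟩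
  have h1 : 1 ≤ (a + 1) ^ 2 := by nlinarith
  have h2 : 3 ≤ a ^ 4 + 2 * a ^ 2 + 3 := by
    have : 0 ≤ a ^ 4 + 2 * a ^ 2 := by positivity
    linarith
  nlinarith

/-- Two families with the same scalar invariants, one of which is close to `1`. -/
lemma bounds_of_relations {s s' : Finset ℕ} {a b : ℕ → ℝ} (ha : ∀ j ∈ s, 0 < a j)
    (hb : ∀ j ∈ s', 0 < b j) (h1 : ∑ j ∈ s, a j = ∑ j ∈ s', b j)
    (h7 : ∑ j ∈ s, a j ^ 7 = ∑ j ∈ s', b j ^ 7) (hi : ∑ j ∈ s, (a j)⁻¹ = ∑ j ∈ s', (b j)⁻¹)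
    (hs : ∑ j ∈ s, (1 - a j ^ 6) ^ 2 < 1 / 16) :
    (∀ j ∈ s', 16 / 25 < b j ^ 6 ∧ b j ^ 6 < 3 / 2) ∧ |(s'.card : ℝ) - s.card| ≤ 1 / 8 := by
  have hd : ∑ j ∈ s, defect (a j) = ∑ j ∈ s', defect (b j) := by
    simp only [defect, Finset.sum_add_distrib, Finset.sum_sub_distrib, ← Finset.mul_sum, h1, h7, hi]
  have hlt : ∑ j ∈ s, defect (a j) < 1 / 16 := by
    refine lt_of_le_of_lt (Finset.sum_le_sum fun j hj => defect_le (ha j hj) ?_) hs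
    have := (Finset.single_le_sum (f := fun j => (1 - a j ^ 6) ^ 2) (fun i _ => sq_nonneg _)
      hj).trans_lt hs
    nlinarith
  have nb : ∀ j ∈ s', 0 ≤ defect (b j) := fun j hj => by
    linarith [(defect_bounds (hb j hj)).1, (defect_bounds (hb j hj)).2]
  have card_eq : ∀ (r : Finset ℕ) (d : ℕ → ℝ),
      (r.card : ℝ) = (∑ j ∈ r, d j + ∑ j ∈ r, (d j)⁻¹ - ∑ j ∈ r, (d j + (d j)⁻¹ - 2)) / 2 :=
    fun r d => by
      simp only [Finset.sum_sub_distrib, Finset.sum_add_distrib, Finset.sum_const, nsmul_eq_mul]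
      ring
  have bounds : ∀ (r : Finset ℕ) (d : ℕ → ℝ), (∀ j ∈ r, 0 < d j) →
      0 ≤ ∑ j ∈ r, (d j + (d j)⁻¹ - 2) ∧
        3 * ∑ j ∈ r, (d j + (d j)⁻¹ - 2) ≤ ∑ j ∈ r, defect (d j) := fun r d h => by
    refine ⟨Finset.sum_nonneg fun j hj => (defect_bounds (h j hj)).1, ?_⟩
    rw [Finset.mul_sum]
    exact Finset.sum_le_sum fun j hj => (defect_bounds (h j hj)).2
  refine ⟨fun j hj => pow_six_bounds_of_defect_lt (hb j hj)
    ((Finset.single_le_sum nb hj).trans_lt (hd ▸ hlt)), ?_⟩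
  obtain ⟨p1, p2⟩ := bounds s a ha
  obtain ⟨q1, q2⟩ := bounds s' b hb
  rw [card_eq s' b, card_eq s a, h1, hi, abs_le]
  constructor <;> linarith

/-- Control of the speeds at `−∞` for a pure multi-soliton:
`16/25 < c⁻_j < 3/2` for every `j`, and `|N⁻ − N| ≤ √N / 8`. -/
theorem speeds_control_at_minus_infinity
    (N : ℕ) (hN : 2 ≤ N) (c Δ : ℕ → ℝ)
    (hc1 : c 1 = 1)
    (hcpos : ∀ j, 1 ≤ j → j ≤ N → 0 < c j)
    (hcdec : ∀ j, 1 ≤ j → j < N → c (j + 1) < c j)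
    (hspeeds : ∑ j ∈ Finset.Icc 2 N, (1 - c j) ^ 2 < 1 / 16)
    (u : ℝ → ℝ → ℝ) (hu : IsGKdVSolution u)
    (hout : Tendsto
      (fun t => H1norm (fun x =>
        u t x - ∑ j ∈ Finset.Icc 1 N, Qc (c j) (x - c j * t - Δ j)))
      atTop (nhds 0))
    (M : ℕ) (hM : 2 ≤ M) (c' Δ' : ℕ → ℝ)
    (hc'pos : ∀ j, 1 ≤ j → j ≤ M → 0 < c' j)
    (hc'dec : ∀ j, 1 ≤ j → j < M → c' (j + 1) < c' j)
    (hin : Tendsto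
      (fun t => H1norm (fun x =>
        u t x - ∑ j ∈ Finset.Icc 1 M, Qc (c' j) (x - c' j * t - Δ' j)))
      atBot (nhds 0)) :
    (∀ j, 1 ≤ j → j ≤ M → 16 / 25 < c' j ∧ c' j < 3 / 2) ∧
    |(M : ℝ) - (N : ℝ)| ≤ Real.sqrt N / 8 := by
  obtain ⟨u1, u2, u3, hsol⟩ := hu.exists_isSol
  have pos : ∀ j ∈ Finset.Icc 1 N, 0 < c j := fun j hj =>
    hcpos j (Finset.mem_Icc.1 hj).1 (Finset.mem_Icc.1 hj).2
  have pos' : ∀ j ∈ Finset.Icc 1 M, 0 < c' j := fun j hj =>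
    hc'pos j (Finset.mem_Icc.1 hj).1 (Finset.mem_Icc.1 hj).2
  have h := isTrain_of_tendsto hsol pos (injOn_Icc_of_succ_lt hcdec) hout
  have h' := isTrain_of_tendsto (Δ := fun j => -Δ' j) hsol.reverse pos'
    (injOn_Icc_of_succ_lt hc'dec) (tendsto_reverse hin)
  obtain ⟨r1, r7, ri⟩ := hsol.train_relations h h'
  have hs : ∑ j ∈ Finset.Icc 1 N, (1 - (c j ^ ((1 : ℝ) / 6)) ^ 6) ^ 2 < 1 / 16 := by
    rw [Finset.sum_congr rfl fun j hj => by rw [rpow_sixth_pow (pos j hj).le],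
      ← Finset.add_sum_Ioc_eq_sum_Icc (by lia), hc1, sub_self, zero_pow two_ne_zero, zero_add]
    exact hspeeds
  obtain ⟨hb, hcard⟩ := bounds_of_relations h.pos h'.pos r1 r7 ri hs
  refine ⟨fun j hj hj' => ?_, ?_⟩
  · have hmem := Finset.mem_Icc.2 ⟨hj, hj'⟩
    have := hb j hmem
    rwa [rpow_sixth_pow (pos' j hmem).le] at this
  · rw [Nat.card_Icc, Nat.card_Icc, Nat.add_sub_cancel, Nat.add_sub_cancel] at hcard
    have : 1 ≤ √(N : ℝ) := by
      rw [one_le_sqrt]; exact_mod_cast (by lia : 1 ≤ N)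
    linarith
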